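/- arXiv:1505.04309 — 2 statements merged into one kernel-verified Lean document; each statement's English description precedes it below -/
import Mathlib

section
/- Let T be a tree on t vertices with t > 4. The following are equivalent: (i) there exists a natural number k'_T such that every k'_T-edge-connected bipartite graph G with |E(G)| divisible by |E(T)| admits a T-decomposition; (ii) there exists a natural number k_T such that every k_T-edge-connected graph G with |E(G)| divisible by |E(T)| admits a T-decomposition. Moreover, one may take k_T ≤ 4k'_T + 16(t−1)^{6t−5}, and if in addition T has diameter at most 3, one may take k_T ≤ 4k'_T + 16t(t−1). -/
open SimpleGraph

/-- A graph `G` is `k`-edge-connected if it remains connected after the deletion of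
any fewer than `k` edges. -/
def IsKEdgeConnected {V : Type} (G : SimpleGraph V) (k : ℕ) : Prop :=
  ∀ S : Finset (Sym2 V), S.card < k → (G.deleteEdges ↑S).Connected

/-- `D` is a decomposition of `G` into copies of `T`: a set of pairwise edge-disjoint
subgraphs of `G`, each isomorphic to `T`, whose union is `G`. -/
def IsDecompInto {V W : Type} (G : SimpleGraph V) (T : SimpleGraph W)
    (D : Set G.Subgraph) : Prop :=
  (∀ H ∈ D, Nonempty (H.coe ≃g T)) ∧
  (∀ H ∈ D, ∀ K ∈ D, H ≠ K → Disjoint H.edgeSet K.edgeSet) ∧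
  (⋃ H ∈ D, H.edgeSet) = G.edgeSet

/-- Statement (i): every `k`-edge-connected bipartite (finite) graph whose number of
edges is divisible by the number of edges of `T` admits a `T`-decomposition. -/
def BipDecompProp {W : Type} (T : SimpleGraph W) (k : ℕ) : Prop :=
  ∀ (V : Type) [Fintype V] (G : SimpleGraph V), G.Colorable 2 →
    IsKEdgeConnected G k → T.edgeSet.ncard ∣ G.edgeSet.ncard →
    ∃ D : Set G.Subgraph, IsDecompInto G T D

/-- Statement (ii): every `k`-edge-connected (finite) graph whose number of
edges is divisible by the number of edges of `T` admits a `T`-decomposition. -/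
def DecompProp {W : Type} (T : SimpleGraph W) (k : ℕ) : Prop :=
  ∀ (V : Type) [Fintype V] (G : SimpleGraph V),
    IsKEdgeConnected G k → T.edgeSet.ncard ∣ G.edgeSet.ncard →
    ∃ D : Set G.Subgraph, IsDecompInto G T D

section

/-- Abstract matroid rank function. -/
structure RankFn {α : Type} [DecidableEq α] (r : Finset α → ℕ) : Prop where
  empty : r ∅ = 0
  unit : ∀ A e, r (insert e A) ≤ r A + 1
  mono : ∀ A B, A ⊆ B → r A ≤ r B
  submod : ∀ A B, r (A ∪ B) + r (A ∩ B) ≤ r A + r B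

theorem RankFn.closure {α : Type} [DecidableEq α] {r : Finset α → ℕ}
    (mono : ∀ A B, A ⊆ B → r A ≤ r B)
    (submod : ∀ A B, r (A ∪ B) + r (A ∩ B) ≤ r A + r B) {J U : Finset α} {e : α}
    (hJU : J ⊆ U) (h : r (insert e J) ≤ r J) : r (insert e U) ≤ r U := by
  have h1 := submod (insert e J) U
  have h2 : insert e J ∪ U = insert e U := by
    ext x; simp only [Finset.mem_union, Finset.mem_insert]
    constructor
    · rintro ((h | h) | h)
      · exact Or.inl h
      · exact Or.inr (hJU h)
      · exact Or.inr h
    · rintro (h | h)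
      · exact Or.inl (Or.inl h)
      · exact Or.inr h
  have h3 : r J ≤ r (insert e J ∩ U) := by
    apply mono
    intro x hx
    simp [hx, hJU hx]
  rw [h2] at h1
  omega

theorem RankFn.contract {α : Type} [DecidableEq α] {r : Finset α → ℕ} (h : RankFn r) (e : α) :
    RankFn (fun J => r (insert e J) - r {e}) where
  empty := by simp
  unit := by
    intro A x
    have h1 := h.unit (insert e A) x
    rw [Finset.insert_comm] at h1
    have h2 := h.mono {e} (insert e A) (by simp)
    show r (insert e (insert x A)) - r {e} ≤ r (insert e A) - r {e} + 1
    omega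
  mono := by
    intro A B hAB
    have h1 := h.mono (insert e A) (insert e B) (Finset.insert_subset_insert _ hAB)
    show r (insert e A) - r {e} ≤ r (insert e B) - r {e}
    omega
  submod := by
    intro A B
    have h1 := h.submod (insert e A) (insert e B)
    rw [← Finset.insert_union_distrib, ← Finset.insert_inter_distrib] at h1
    have h2 := h.mono {e} (insert e A) (by simp)
    have h3 := h.mono {e} (insert e B) (by simp)
    show r (insert e (A ∪ B)) - r {e} + (r (insert e (A ∩ B)) - r {e}) ≤
      r (insert e A) - r {e} + (r (insert e B) - r {e})
    have h4 := h.mono {e} (insert e (A ∪ B)) (by simp)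
    have h5 := h.mono {e} (insert e (A ∩ B)) (by simp)
    omega

/-- Tight sets are closed under finite unions. -/
theorem tight_biUnion {α β : Type} [DecidableEq α] {f : Finset α → ℕ}
    (h0 : f ∅ = 0)
    (submod : ∀ A B, f (A ∪ B) + f (A ∩ B) ≤ f A + f B) {I : Finset α}
    (hI : ∀ J ⊆ I, J.card ≤ f J) (s : Finset β) (J : β → Finset α)
    (hJ : ∀ b ∈ s, J b ⊆ I ∧ f (J b) ≤ (J b).card) :
    s.biUnion J ⊆ I ∧ f (s.biUnion J) ≤ (s.biUnion J).card := by
  classical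
  induction s using Finset.induction_on with
  | empty => simp [h0]
  | insert b s hb ih =>
    obtain ⟨h1, h2⟩ := ih (fun b' hb' => hJ b' (Finset.mem_insert_of_mem hb'))
    obtain ⟨h3, h4⟩ := hJ b (Finset.mem_insert_self _ _)
    rw [Finset.biUnion_insert]
    refine ⟨Finset.union_subset h3 h1, ?_⟩
    have h5 := submod (J b) (s.biUnion J)
    have h6 := hI (J b ∩ s.biUnion J) (Finset.inter_subset_left.trans h3)
    have h7 := Finset.card_union_add_card_inter (J b) (s.biUnion J)
    omega

theorem sum_submod {α ι : Type} [DecidableEq α] [Fintype ι] {r : ι → Finset α → ℕ} (hr : ∀ i, RankFn (r i)) :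
    ∀ A B, (∑ i, r i (A ∪ B)) + (∑ i, r i (A ∩ B)) ≤ (∑ i, r i A) + ∑ i, r i B := by
  intro A B
  rw [← Finset.sum_add_distrib, ← Finset.sum_add_distrib]
  exact Finset.sum_le_sum (fun i _ => (hr i).submod A B)

/-- Matroid partition theorem. -/
theorem matroid_partition {α ι : Type} [DecidableEq α] [DecidableEq ι] [Fintype ι] [Nonempty ι] (I : Finset α) :
    ∀ (r : ι → Finset α → ℕ), (∀ i, RankFn (r i)) →
    (∀ J ⊆ I, J.card ≤ ∑ i, r i J) →
    ∃ c : α → ι, ∀ i, (I.filter (fun a => c a = i)).card ≤ r i (I.filter (fun a => c a = i)) := by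
  induction I using Finset.induction_on with
  | empty => 
    intro r hr _
    exact ⟨fun _ => Classical.arbitrary ι, by simp⟩
  | insert e I he ih =>
    intro r hr hI
    by_cases hex : ∃ i, 1 ≤ r i {e} ∧ ∀ J ⊆ I,
        J.card ≤ ∑ j, (if j = i then r i (insert e J) - r i {e} else r j J)
    · obtain ⟨i, hi1, hi⟩ := hex
      obtain ⟨c, hc⟩ := ih (fun j => if j = i then (fun J => r i (insert e J) - r i {e}) else r j)
        (by
          intro j
          by_cases hj : j = i
          · subst hj; simp only [if_true]; exact (hr j).contract e
          · simp only [hj, if_false]; exact hr j)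
        (by
          intro J hJ
          refine (hi J hJ).trans (le_of_eq ?_)
          apply Finset.sum_congr rfl
          intro j _
          by_cases hj : j = i <;> simp [hj])
      refine ⟨fun a => if a = e then i else c a, fun j => ?_⟩
      have hcj := hc j
      have hfil : I.filter (fun a => (if a = e then i else c a) = j) = I.filter (fun a => c a = j) := by
        apply Finset.filter_congr
        intro a ha
        have : a ≠ e := fun h => he (h ▸ ha)
        simp [this]
      rw [Finset.filter_insert, hfil]
      by_cases hj : j = i
      · subst hj
        simp only [if_true] at hcj ⊢
        rw [Finset.card_insert_of_notMem (by simp [he])]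
        have := (hr j).mono {e} (insert e (I.filter (fun a => c a = j))) (by simp)
        omega
      · simp only [hj, if_false, if_true] at hcj ⊢
        rw [if_neg (fun h => hj h.symm)]
        exact hcj
    · exfalso
      push Not at hex
      have hI' : ∀ J ⊆ I, J.card ≤ ∑ i, r i J := fun J hJ => hI J (hJ.trans (Finset.subset_insert _ _))
      have key : ∀ i, ∃ J ⊆ I, ∑ j, r j J ≤ J.card ∧ r i (insert e J) ≤ r i J := by
        intro i
        by_cases hi : 1 ≤ r i {e}
        · obtain ⟨J, hJ, hlt⟩ := hex i hi
          have hu : r i {e} ≤ 1 := by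
            have := (hr i).unit ∅ e
            rw [(hr i).empty] at this
            simpa using this
          rw [← Finset.add_sum_erase _ _ (Finset.mem_univ i)] at hlt
          have hsum : ∑ j ∈ Finset.univ.erase i, (if j = i then r i (insert e J) - r i {e} else r j J)
              = ∑ j ∈ Finset.univ.erase i, r j J := by
            apply Finset.sum_congr rfl
            intro j hj
            rw [if_neg (Finset.ne_of_mem_erase hj)]
          rw [hsum, if_pos rfl] at hlt
          have h1 := hI' J hJ
          rw [← Finset.add_sum_erase _ _ (Finset.mem_univ i)] at h1
          have h2 := (hr i).mono J (insert e J) (Finset.subset_insert _ _)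
          have h3 := (hr i).mono {e} (insert e J) (by simp)
          refine ⟨J, hJ, ?_, ?_⟩
          · rw [← Finset.add_sum_erase _ _ (Finset.mem_univ i)]
            omega
          · omega
        · refine ⟨∅, by simp, ?_, ?_⟩
          · simp [fun i => (hr i).empty]
          · rw [(hr i).empty]; simp; omega
      choose J hJI hJt hJc using key
      obtain ⟨hU1, hU2⟩ := tight_biUnion (f := fun A => ∑ i, r i A) (by simp [fun i => (hr i).empty])
        (sum_submod hr) hI' Finset.univ J (fun i _ => ⟨hJI i, hJt i⟩)
      set U := Finset.univ.biUnion J with hU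
      have h1 : ∑ i, r i (insert e U) ≤ ∑ i, r i U := by
        apply Finset.sum_le_sum
        intro i _
        exact RankFn.closure (hr i).mono (hr i).submod
          (Finset.subset_biUnion_of_mem J (Finset.mem_univ i)) (hJc i)
      have h2 := hI (insert e U) (Finset.insert_subset_insert _ hU1)
      rw [Finset.card_insert_of_notMem (fun h => he (hU1 h))] at h2
      omega

/-- Rank formula (one direction) for the sum of rank functions. -/
theorem exists_max_tight {α : Type} [DecidableEq α] (E : Finset α) (f : Finset α → ℕ) (h0 : f ∅ = 0)
    (mono : ∀ A B, A ⊆ B → f A ≤ f B)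
    (submod : ∀ A B, f (A ∪ B) + f (A ∩ B) ≤ f A + f B) :
    ∃ I ⊆ E, (∀ J ⊆ I, J.card ≤ f J) ∧ ∃ A ⊆ E, f A + (E \ A).card ≤ I.card := by
  classical
  obtain ⟨I, hI, hmax⟩ := Finset.exists_max_image
    (E.powerset.filter (fun I => ∀ J ⊆ I, J.card ≤ f J)) Finset.card
    ⟨∅, by simp [h0]⟩
  simp only [Finset.mem_filter, Finset.mem_powerset] at hI hmax
  obtain ⟨hIE, hI⟩ := hI
  refine ⟨I, hIE, hI, ?_⟩
  have key : ∀ e : α, ∃ J ⊆ I, f J ≤ J.card ∧ (e ∈ E \ I → f (insert e J) ≤ f J) := by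
    intro e
    by_cases he : e ∈ E \ I
    · simp only [Finset.mem_sdiff] at he
      have : ¬ (∀ J ⊆ insert e I, J.card ≤ f J) := by
        intro h
        have := hmax (insert e I) ⟨Finset.insert_subset he.1 hIE, h⟩
        rw [Finset.card_insert_of_notMem he.2] at this
        omega
      push Not at this
      obtain ⟨J, hJ, hlt⟩ := this
      have heJ : e ∈ J := by
        by_contra hn
        have : J ⊆ I := by
          intro x hx
          rcases Finset.mem_insert.1 (hJ hx) with h | h
          · exact absurd (h ▸ hx) hn
          · exact h
        have := hI J this
        omega
      have hJ' : J.erase e ⊆ I := by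
        intro x hx
        rw [Finset.mem_erase] at hx
        rcases Finset.mem_insert.1 (hJ hx.2) with h | h
        · exact absurd h hx.1
        · exact h
      have h1 := hI _ hJ'
      have h2 := mono (J.erase e) J (Finset.erase_subset _ _)
      have h3 := Finset.card_erase_add_one heJ
      refine ⟨J.erase e, hJ', by omega, fun _ => ?_⟩
      rw [Finset.insert_erase heJ]
      omega
    · exact ⟨∅, by simp, by simp [h0], fun h => absurd h he⟩
  choose J hJI hJt hJc using key
  obtain ⟨hU1, hU2⟩ := tight_biUnion h0 submod hI (E \ I) J (fun i _ => ⟨hJI i, hJt i⟩)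
  set U := (E \ I).biUnion J with hU
  refine ⟨U ∪ (E \ I), Finset.union_subset (hU1.trans hIE) Finset.sdiff_subset, ?_⟩
  have h1 : ∀ Y ⊆ E \ I, f (U ∪ Y) ≤ f U := by
    intro Y
    induction Y using Finset.induction_on with
    | empty => simp
    | insert e Y heY ih =>
      intro hY
      have h2 := ih ((Finset.subset_insert _ _).trans hY)
      have heE := hY (Finset.mem_insert_self _ _)
      rw [Finset.union_insert]
      refine le_trans ?_ h2
      exact RankFn.closure mono submod
        ((Finset.subset_biUnion_of_mem J heE).trans Finset.subset_union_left) (hJc e heE)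
  have h2 := h1 _ subset_rfl
  have h3 : E \ (U ∪ (E \ I)) = I \ U := by
    ext x
    simp only [Finset.mem_sdiff, Finset.mem_union, not_or, not_and, not_not]
    constructor
    · rintro ⟨a, b, c⟩; exact ⟨c a, b⟩
    · rintro ⟨a, b⟩; exact ⟨hIE a, b, fun _ => a⟩
  rw [h3, Finset.card_sdiff_of_subset hU1]
  have := Finset.card_le_card hU1
  omega

end

section
open scoped Classical

/-- the edge `e` crosses the cut given by `f`. -/
def Crosses {V : Type} (f : V → Bool) (e : Sym2 V) : Prop :=
  ∃ a b, e = s(a, b) ∧ f a ≠ f b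

theorem crosses_mk {V : Type} (f : V → Bool) (a b : V) : Crosses f s(a, b) ↔ f a ≠ f b := by
  constructor
  · rintro ⟨c, d, h, hf⟩
    rw [Sym2.eq_iff] at h
    rcases h with ⟨rfl, rfl⟩ | ⟨rfl, rfl⟩
    · exact hf
    · exact hf.symm
  · intro h
    exact ⟨a, b, rfl, h⟩

/-- functions constant along the edges of `A`. -/
def constSub {V : Type} (A : Finset (Sym2 V)) : Submodule ℝ (V → ℝ) where
  carrier := {x | ∀ a b, s(a, b) ∈ A → x a = x b}
  add_mem' := by
    intro x y hx hy a b h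
    simp [hx a b h, hy a b h]
  zero_mem' := by intro a b _; rfl
  smul_mem' := by
    intro c x hx a b h
    simp [hx a b h]

theorem constSub_finrank {V : Type} [Fintype V] (A : Finset (Sym2 V)) :
    Module.finrank ℝ (constSub A) =
      Nat.card (SimpleGraph.fromEdgeSet (A : Set (Sym2 V))).ConnectedComponent := by
  rw [Nat.card_eq_fintype_card, SimpleGraph.card_connectedComponent_eq_finrank_ker_toLin'_lapMatrix]
  have : constSub A = (((SimpleGraph.fromEdgeSet (A : Set (Sym2 V))).lapMatrix ℝ).toLin').ker := by
    ext x
    rw [LinearMap.mem_ker, Matrix.toLin'_apply,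
      SimpleGraph.lapMatrix_mulVec_eq_zero_iff_forall_adj]
    constructor
    · intro h a b hab
      rw [SimpleGraph.fromEdgeSet_adj] at hab
      exact h a b hab.1
    · intro h a b hab
      by_cases hne : a = b
      · rw [hne]
      · exact h a b ((SimpleGraph.fromEdgeSet_adj _).2 ⟨hab, hne⟩)
  rw [this]

theorem constSub_anti {V : Type} {A B : Finset (Sym2 V)} (h : A ⊆ B) : constSub B ≤ constSub A :=
  fun _ hx a b hab => hx a b (h hab)

noncomputable def gRank {V : Type} [Fintype V] (A : Finset (Sym2 V)) : ℕ :=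
  Fintype.card V - Module.finrank ℝ (constSub A)

theorem finrank_constSub_le {V : Type} [Fintype V] (A : Finset (Sym2 V)) :
    Module.finrank ℝ (constSub A) ≤ Fintype.card V := by
  have := Submodule.finrank_le (constSub A)
  simpa using this

theorem gRank_submod {V : Type} [Fintype V] (A B : Finset (Sym2 V)) :
    gRank (A ∪ B) + gRank (A ∩ B) ≤ gRank A + gRank B := by
  have h1 := Submodule.finrank_sup_add_finrank_inf_eq (constSub A) (constSub B)
  have h2 : constSub A ⊓ constSub B = constSub (A ∪ B) := by
    ext x
    rw [Submodule.mem_inf]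
    constructor
    · rintro ⟨h, h'⟩ a b hab
      rcases Finset.mem_union.1 hab with h3 | h3
      · exact h a b h3
      · exact h' a b h3
    · intro h
      exact ⟨constSub_anti Finset.subset_union_left h, constSub_anti Finset.subset_union_right h⟩
  have h3 : constSub A ⊔ constSub B ≤ constSub (A ∩ B) :=
    sup_le (constSub_anti Finset.inter_subset_left) (constSub_anti Finset.inter_subset_right)
  have h4 := Submodule.finrank_mono h3
  rw [h2] at h1
  have := finrank_constSub_le (A ∪ B)
  have := finrank_constSub_le (A ∩ B)
  have := finrank_constSub_le A
  have := finrank_constSub_le B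
  unfold gRank
  omega

theorem gRank_mono {V : Type} [Fintype V] (A B : Finset (Sym2 V)) (h : A ⊆ B) :
    gRank A ≤ gRank B := by
  have := Submodule.finrank_mono (constSub_anti h)
  unfold gRank
  omega

theorem gRank_empty {V : Type} [Fintype V] : gRank (∅ : Finset (Sym2 V)) = 0 := by
  have : constSub (∅ : Finset (Sym2 V)) = ⊤ := by
    ext x; simp [constSub]
  unfold gRank
  rw [this]
  simp

theorem gRank_single {V : Type} [Fintype V] (e : Sym2 V) : gRank ({e} : Finset (Sym2 V)) ≤ 1 := by
  induction e using Sym2.ind with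
  | _ a b =>
  let φ : (V → ℝ) →ₗ[ℝ] ℝ :=
    LinearMap.proj (R := ℝ) (φ := fun _ : V => ℝ) a - LinearMap.proj (R := ℝ) (φ := fun _ : V => ℝ) b
  have h1 := LinearMap.finrank_range_add_finrank_ker φ
  have h2 : Module.finrank ℝ (LinearMap.range φ) ≤ 1 := by
    have := Submodule.finrank_le (LinearMap.range φ)
    simpa using this
  have h3 : LinearMap.ker φ ≤ constSub {s(a, b)} := by
    intro x hx c d hcd
    have hx' : x a - x b = 0 := hx
    rw [Finset.mem_singleton, Sym2.eq_iff] at hcd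
    rcases hcd with ⟨rfl, rfl⟩ | ⟨rfl, rfl⟩ <;> linarith
  have h4 := Submodule.finrank_mono h3
  simp only [Module.finrank_fintype_fun_eq_card] at h1
  unfold gRank
  omega

theorem gRank_rankFn {V : Type} [Fintype V] : RankFn (gRank (V := V)) where
  empty := gRank_empty
  mono := gRank_mono
  submod := gRank_submod
  unit := by
    intro A e
    have h1 := gRank_submod {e} A
    have h2 := gRank_single e
    rw [← Finset.insert_eq] at h1
    omega

/-- Tree packing: a graph all of whose cuts have at least twice `m` edges has `m` edge-disjoint
connected spanning subgraphs. -/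
theorem tree_packing {V : Type} [Fintype V] [Nonempty V] (m : ℕ) (E : Finset (Sym2 V))
    (hcut : ∀ f : V → Bool, (∃ a, f a = true) → (∃ b, f b = false) →
      2 * m ≤ (E.filter (Crosses f)).card) :
    ∃ c : Fin m → Finset (Sym2 V), (∀ i, c i ⊆ E) ∧ (∀ i j, i ≠ j → Disjoint (c i) (c j)) ∧
      ∀ i, (SimpleGraph.fromEdgeSet (c i : Set (Sym2 V))).Connected := by
  by_cases hm : m = 0
  · subst hm
    exact ⟨fun _ => ∅, fun i => i.elim0, fun i => i.elim0, fun i => i.elim0⟩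
  have : Nonempty (Fin m) := ⟨⟨0, by omega⟩⟩
  have hsm := sum_submod (ι := Fin m) (r := fun _ => gRank (V := V)) (fun _ => gRank_rankFn)
  obtain ⟨I, hIE, hI, A, hAE, hA⟩ := exists_max_tight E (fun A => ∑ _i : Fin m, gRank A)
    (by simp [gRank_empty]) (fun A B h => Finset.sum_le_sum (fun _ _ => gRank_mono A B h)) hsm
  obtain ⟨c, hc⟩ := matroid_partition (ι := Fin m) I (fun _ => gRank) (fun _ => gRank_rankFn) hI
  have hpos : ∀ A : Finset (Sym2 V), 1 ≤ Module.finrank ℝ (constSub A) := by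
    intro A
    rw [constSub_finrank, Nat.card_eq_fintype_card]
    exact Fintype.card_pos
  -- counting
  have hcount : m * (Module.finrank ℝ (constSub A) - 1) ≤ (E \ A).card := by
    rw [constSub_finrank]
    obtain ⟨H, hH⟩ : ∃ H, H = SimpleGraph.fromEdgeSet (A : Set (Sym2 V)) := ⟨_, rfl⟩
    rw [← hH, Nat.card_eq_fintype_card]
    by_cases h1 : Fintype.card H.ConnectedComponent ≤ 1
    · have : Fintype.card H.ConnectedComponent - 1 = 0 := by omega
      rw [this]; simp
    · let r : H.ConnectedComponent → Sym2 V → Prop := fun C e =>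
        Crosses (fun v => decide (H.connectedComponentMk v = C)) e
      have h2 := Finset.card_mul_le_card_mul (s := (Finset.univ : Finset H.ConnectedComponent))
        (t := E \ A) r (m := 2 * m) (n := 2) (by
          intro C _
          have hex : ∃ D : H.ConnectedComponent, D ≠ C := by
            by_contra hno
            push Not at hno
            apply h1
            rw [Fintype.card_le_one_iff]
            intro a b
            rw [hno a, hno b]
          obtain ⟨D, hD⟩ := hex
          refine (hcut (fun v => decide (H.connectedComponentMk v = C)) ?_ ?_).trans ?_
          · obtain ⟨v, hv⟩ := C.exists_rep
            exact ⟨v, decide_eq_true hv⟩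
          · obtain ⟨v, hv⟩ := D.exists_rep
            refine ⟨v, ?_⟩
            have : H.connectedComponentMk v = D := hv
            simp [this, hD]
          · apply Finset.card_le_card
            intro e he
            rw [Finset.mem_filter] at he
            rw [Finset.mem_bipartiteAbove, Finset.mem_sdiff]
            refine ⟨⟨he.1, fun heA => ?_⟩, he.2⟩
            obtain ⟨a, b, rfl, hab⟩ := he.2
            have hne : a ≠ b := by rintro rfl; exact hab rfl
            have hadj : H.Adj a b := hH ▸ (SimpleGraph.fromEdgeSet_adj _).2 ⟨heA, hne⟩
            have := SimpleGraph.ConnectedComponent.sound hadj.reachable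
            apply hab
            simp only [this]) (by
          intro e _
          induction e using Sym2.ind with
          | _ a b =>
          have : (Finset.univ.bipartiteBelow r s(a, b)) ⊆
              {H.connectedComponentMk a, H.connectedComponentMk b} := by
            intro C hC
            rw [Finset.mem_bipartiteBelow] at hC
            have h3 := (crosses_mk _ a b).1 hC.2
            by_contra hn
            simp only [Finset.mem_insert, Finset.mem_singleton, not_or] at hn
            apply h3
            simp [Ne.symm hn.1, Ne.symm hn.2]
          exact (Finset.card_le_card this).trans Finset.card_le_two)
      rw [Finset.card_univ] at h2
      have h3 : m * (Fintype.card H.ConnectedComponent - 1) ≤ m * Fintype.card H.ConnectedComponent :=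
        Nat.mul_le_mul_left _ (Nat.sub_le _ _)
      have h4 : Fintype.card H.ConnectedComponent * (2 * m) = 2 * (m * Fintype.card H.ConnectedComponent) := by ring
      omega
  have hle : ∀ B : Finset (Sym2 V), gRank B ≤ Fintype.card V - 1 := by
    intro B
    have := hpos B
    unfold gRank
    omega
  have hIcard : m * (Fintype.card V - 1) ≤ I.card := by
    refine le_trans ?_ hA
    simp only [Finset.sum_const, Finset.card_univ, Fintype.card_fin, smul_eq_mul]
    have h1 : Fintype.card V - 1 = gRank A + (Module.finrank ℝ (constSub A) - 1) := by
      have := hpos A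
      have := finrank_constSub_le A
      unfold gRank
      omega
    rw [h1, Nat.mul_add]
    omega
  have hsum : I.card = ∑ i : Fin m, (I.filter (fun a => c a = i)).card :=
    Finset.card_eq_sum_card_fiberwise (fun a _ => Finset.mem_univ (c a))
  have heq : ∀ i : Fin m, gRank (I.filter (fun a => c a = i)) = Fintype.card V - 1 := by
    intro i
    by_contra hne
    have hlt : (I.filter (fun a => c a = i)).card < Fintype.card V - 1 :=
      lt_of_le_of_lt (hc i) (lt_of_le_of_ne (hle _) hne)
    have : ∑ i : Fin m, (I.filter (fun a => c a = i)).card < ∑ _i : Fin m, (Fintype.card V - 1) :=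
      Finset.sum_lt_sum (fun j _ => (hc j).trans (hle _)) ⟨i, Finset.mem_univ _, hlt⟩
    simp only [Finset.sum_const, Finset.card_univ, Fintype.card_fin, smul_eq_mul] at this
    omega
  refine ⟨fun i => I.filter (fun a => c a = i), fun i => (Finset.filter_subset _ _).trans hIE, ?_, ?_⟩
  · intro i j hij
    rw [Finset.disjoint_left]
    intro e h1 h2
    rw [Finset.mem_filter] at h1 h2
    exact hij (h1.2.symm.trans h2.2)
  · intro i
    have h1 := heq i
    have h2 := hpos (I.filter (fun a => c a = i))
    have h3 := finrank_constSub_le (I.filter (fun a => c a = i))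
    have h4 : Module.finrank ℝ (constSub (I.filter (fun a => c a = i))) ≤ 1 := by
      have : 0 < Fintype.card V := Fintype.card_pos
      unfold gRank at h1
      omega
    rw [constSub_finrank, Nat.card_eq_fintype_card, Fintype.card_le_one_iff] at h4
    refine { preconnected := ?_, nonempty := inferInstance }
    intro a b
    exact SimpleGraph.ConnectedComponent.exact (h4 _ _)

/-- cuts of edge connected graphs -/
theorem cut_of_conn {V : Type} (G : SimpleGraph V) (E : Finset (Sym2 V)) (k : ℕ)
    (hE : ∀ e, e ∈ E ↔ e ∈ G.edgeSet)
    (h : ∀ S : Finset (Sym2 V), S.card < k → (G.deleteEdges ↑S).Connected)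
    (f : V → Bool) (ha : ∃ a, f a = true) (hb : ∃ b, f b = false) :
    k ≤ (E.filter (Crosses f)).card := by
  by_contra hlt
  push Not at hlt
  have hc := h _ hlt
  obtain ⟨a, ha⟩ := ha
  obtain ⟨b, hb⟩ := hb
  obtain ⟨w⟩ := hc.preconnected a b
  have : ∀ {x y : V}, (G.deleteEdges ↑(E.filter (Crosses f))).Walk x y → f x = f y := by
    intro x y w
    induction w with
    | nil => rfl
    | cons hadj _ ih =>
      rw [← ih]
      rw [SimpleGraph.deleteEdges_adj] at hadj
      by_contra hne
      apply hadj.2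
      simp only [Finset.coe_filter, Set.mem_ofPred_eq]
      exact ⟨(hE _).2 hadj.1, (crosses_mk _ _ _).2 hne⟩
  have := this w
  rw [ha, hb] at this
  cases this

/-- A maximum cut keeps at least half of every cut. -/
theorem max_cut {V : Type} [Fintype V] (E : Finset (Sym2 V)) :
    ∃ χ : V → Bool, ∀ f : V → Bool,
      (E.filter (Crosses f)).card ≤ 2 * ((E.filter (Crosses χ)).filter (Crosses f)).card := by
  obtain ⟨χ, -, hχ⟩ := Finset.exists_max_image (Finset.univ : Finset (V → Bool))
    (fun χ => (E.filter (Crosses χ)).card) Finset.univ_nonempty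
  refine ⟨χ, fun f => ?_⟩
  have h1 := hχ (fun v => xor (χ v) (f v)) (Finset.mem_univ _)
  have hx : ∀ e, Crosses (fun v => xor (χ v) (f v)) e ↔ ¬ (Crosses χ e ↔ Crosses f e) := by
    intro e
    induction e using Sym2.ind with
    | _ a b =>
    simp only [crosses_mk]
    cases χ a <;> cases χ b <;> cases f a <;> cases f b <;> simp
  -- split
  have e1 := Finset.card_filter_add_card_filter_not (s := E.filter (Crosses f)) (Crosses χ)
  have e2 := Finset.card_filter_add_card_filter_not (s := E.filter (Crosses χ)) (Crosses f)
  have e3 := Finset.card_filter_add_card_filter_not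
    (s := E.filter (Crosses (fun v => xor (χ v) (f v)))) (Crosses f)
  simp only [Finset.filter_filter] at e1 e2 e3 ⊢
  have e4 : E.filter (fun a => Crosses f a ∧ Crosses χ a) = E.filter (fun a => Crosses χ a ∧ Crosses f a) :=
    Finset.filter_congr (fun e _ => and_comm)
  have e5 : E.filter (fun a => Crosses (fun v => xor (χ v) (f v)) a ∧ Crosses f a) =
      E.filter (fun a => Crosses f a ∧ ¬ Crosses χ a) :=
    Finset.filter_congr (fun e _ => by rw [hx]; tauto)
  have e6 : E.filter (fun a => Crosses (fun v => xor (χ v) (f v)) a ∧ ¬ Crosses f a) =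
      E.filter (fun a => Crosses χ a ∧ ¬ Crosses f a) :=
    Finset.filter_congr (fun e _ => by rw [hx]; tauto)
  rw [e4] at e1
  rw [e5, e6] at e3
  omega

end

section
open scoped Classical

/-- Grouping the in-neighbours in blocks of size `q` and assigning blocks by the Hall theorem. -/
theorem blocks {V K : Type} [Fintype V] (q M : ℕ) (hq : 0 < q) (out1 : V → Finset V)
    (J : V → Finset K) (hJ : ∀ u, (J u).card ≤ M) (hout : ∀ u, q * M ≤ (out1 u).card) :
    ∃ (y : V → K → V) (B : V → K → Finset V),
      (∀ u, ∀ k ∈ J u, y u k ∈ out1 u ∧ u ∈ B u k) ∧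
      (∀ u, ∀ k ∈ J u, ∀ w ∈ B u k, y u k ∈ out1 w) ∧
      (∀ u k u' k', k ∈ J u → k' ∈ J u' → (u, k) ≠ (u', k') → y u k = y u' k' →
        Disjoint (B u k) (B u' k') ∧ (q ≤ (B u k).card ∨ q ≤ (B u' k').card)) := by
  let inn : V → Finset V := fun y => Finset.univ.filter (fun w => y ∈ out1 w)
  have hidx : ∀ y, ∃ idx : V → ℕ, Set.InjOn idx (inn y) ∧
      (inn y).image idx = Finset.range (inn y).card := by
    intro y
    let e := (inn y).equivFin
    refine ⟨fun w => if h : w ∈ inn y then (e ⟨w, h⟩).val else 0, ?_, ?_⟩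
    · intro a ha b hb hab
      have ha' : a ∈ inn y := ha
      have hb' : b ∈ inn y := hb
      simp only [ha', hb', dif_pos] at hab
      have := e.injective (Fin.ext hab)
      simpa using this
    · ext n
      simp only [Finset.mem_image, Finset.mem_range]
      constructor
      · rintro ⟨a, ha, rfl⟩
        rw [dif_pos ha]
        exact (e ⟨a, ha⟩).isLt
      · intro hn
        refine ⟨(e.symm ⟨n, hn⟩).val, (e.symm ⟨n, hn⟩).2, ?_⟩
        rw [dif_pos (e.symm ⟨n, hn⟩).2]
        simp
  choose idx hinj himg using hidx
  let blk : V → ℕ → Finset V := fun y n => (inn y).filter (fun w => idx y w / q = n)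
  have hblk_le : ∀ y n, (blk y n).card ≤ q := by
    intro y n
    have : (blk y n).card ≤ (Finset.Ico (n * q) (n * q + q)).card := by
      apply Finset.card_le_card_of_injOn (idx y)
      · intro w hw
        have hw' := (Finset.mem_filter.1 hw).2
        have := (Nat.div_eq_iff hq).1 hw'
        simp only [Finset.coe_Ico, Set.mem_Ico]
        omega
      · intro a ha b hb hab
        exact hinj y (Finset.mem_filter.1 ha).1 (Finset.mem_filter.1 hb).1 hab
    simpa using this
  have hblk_ge : ∀ y n, n < (inn y).card / q → q ≤ (blk y n).card := by
    intro y n hn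
    have h1 : Finset.Ico (n * q) (n * q + q) ⊆ (blk y n).image (idx y) := by
      intro m hm
      rw [Finset.mem_Ico] at hm
      have h2 : (n + 1) * q ≤ (inn y).card := by
        have : n + 1 ≤ (inn y).card / q := hn
        exact (Nat.le_div_iff_mul_le hq).1 this
      have h3 : m ∈ (inn y).image (idx y) := by
        rw [himg, Finset.mem_range]
        have : (n + 1) * q = n * q + q := by ring
        omega
      obtain ⟨w, hw, rfl⟩ := Finset.mem_image.1 h3
      refine Finset.mem_image.2 ⟨w, Finset.mem_filter.2 ⟨hw, ?_⟩, rfl⟩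
      rw [Nat.div_eq_iff hq]
      omega
    have h2 := (Finset.card_le_card h1).trans Finset.card_image_le
    simpa using h2
  let ι := {p : V × K // p.2 ∈ J p.1}
  let tt : ι → Finset (V × ℕ) := fun p => (out1 p.1.1).image (fun y => (y, idx y p.1.1 / q))
  have htt : ∀ p, q * M ≤ (tt p).card := by
    intro p
    rw [Finset.card_image_of_injective]
    · exact hout _
    · intro a b hab
      exact (Prod.mk.inj hab).1
  have hall : ∀ s : Finset ι, s.card ≤ (s.biUnion tt).card := by
    intro s
    rcases Nat.eq_zero_or_pos M with hM | hM
    · have : s = ∅ := by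
        rw [Finset.eq_empty_iff_forall_notMem]
        rintro ⟨⟨u, k⟩, hk⟩ _
        have h1 := hJ u
        have h2 : 0 < (J u).card := Finset.card_pos.2 ⟨k, hk⟩
        omega
      rw [this]; simp
    · have := Finset.card_mul_le_card_mul (s := s) (t := s.biUnion tt) (fun a b => b ∈ tt a)
        (m := q * M) (n := q * M) (by
          intro a ha
          refine (htt a).trans (Finset.card_le_card ?_)
          intro b hb
          rw [Finset.mem_bipartiteAbove]
          exact ⟨Finset.mem_biUnion.2 ⟨a, ha, hb⟩, hb⟩) (by
          rintro ⟨y, n⟩ _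
          have h1 : (s.bipartiteBelow (fun a b => b ∈ tt a) (y, n)).card ≤
              ((blk y n).sigma J).card := by
            apply Finset.card_le_card_of_injOn (fun p : ι => (⟨p.1.1, p.1.2⟩ : Σ _ : V, K))
            · intro p hp
              have hp' := (Finset.mem_bipartiteBelow _).1 hp
              obtain ⟨y', hy', heq⟩ := Finset.mem_image.1 hp'.2
              obtain ⟨rfl, rfl⟩ := Prod.mk.inj heq
              simp only [Finset.coe_sigma, Set.mem_sigma_iff]
              refine ⟨?_, p.2⟩
              show p.1.1 ∈ blk y' _
              exact Finset.mem_filter.2 ⟨Finset.mem_filter.2 ⟨Finset.mem_univ _, hy'⟩, rfl⟩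
            · rintro ⟨⟨a, b⟩, h⟩ _ ⟨⟨a', b'⟩, h'⟩ _ heq
              simp only [Sigma.mk.injEq, heq_eq_eq] at heq
              obtain ⟨rfl, rfl⟩ := heq
              rfl
          refine h1.trans ?_
          rw [Finset.card_sigma]
          refine (Finset.sum_le_card_nsmul _ _ M (fun w _ => hJ w)).trans ?_
          rw [smul_eq_mul]
          exact Nat.mul_le_mul_right _ (hblk_le y n))
      exact Nat.le_of_mul_le_mul_right this (Nat.mul_pos hq hM)
  obtain ⟨β, hβinj, hβ⟩ := (Finset.all_card_le_biUnion_card_iff_exists_injective tt).1 hall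
  have hβ' : ∀ p : ι, (β p).1 ∈ out1 p.1.1 ∧ p.1.1 ∈ blk (β p).1 (β p).2 := by
    intro p
    obtain ⟨y, hy, heq⟩ := Finset.mem_image.1 (hβ p)
    rw [← heq]
    exact ⟨hy, Finset.mem_filter.2 ⟨Finset.mem_filter.2 ⟨Finset.mem_univ _, hy⟩, rfl⟩⟩
  refine ⟨fun u k => if h : k ∈ J u then (β ⟨(u, k), h⟩).1 else u,
    fun u k => if h : k ∈ J u then blk (β ⟨(u, k), h⟩).1 (β ⟨(u, k), h⟩).2 else ∅, ?_, ?_, ?_⟩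
  · intro u k hk
    simp only [dif_pos hk]
    exact hβ' ⟨(u, k), hk⟩
  · intro u k hk w hw
    simp only [dif_pos hk] at hw ⊢
    exact (Finset.mem_filter.1 (Finset.mem_filter.1 hw).1).2
  · intro u k u' k' hk hk' hne hy
    simp only [dif_pos hk, dif_pos hk'] at hy ⊢
    have h1 := (hβ' ⟨(u, k), hk⟩).2
    have h2 := (hβ' ⟨(u', k'), hk'⟩).2
    have hn : β ⟨(u, k), hk⟩ ≠ β ⟨(u', k'), hk'⟩ := by
      intro h
      have := hβinj h
      exact hne (congrArg Subtype.val this)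
    generalize β ⟨(u, k), hk⟩ = b1 at hy h1 h2 hn ⊢
    generalize β ⟨(u', k'), hk'⟩ = b2 at hy h1 h2 hn ⊢
    obtain ⟨y1, n1⟩ := b1
    obtain ⟨y2, n2⟩ := b2
    simp only at hy h1 h2 ⊢
    subst hy
    have hnn : n1 ≠ n2 := fun h => hn (by rw [h])
    constructor
    · rw [Finset.disjoint_left]
      intro w hw hw'
      exact hnn ((Finset.mem_filter.1 hw).2.symm.trans (Finset.mem_filter.1 hw').2)
    · have hb : ∀ n v, v ∈ blk y1 n → n ≤ (inn y1).card / q := by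
        intro n v hv
        have hv' := Finset.mem_filter.1 hv
        rw [← hv'.2]
        apply Nat.div_le_div_right
        have : idx y1 v ∈ (inn y1).image (idx y1) := Finset.mem_image_of_mem _ hv'.1
        rw [himg, Finset.mem_range] at this
        omega
      have h3 := hb _ _ h1
      have h4 := hb _ _ h2
      by_cases h5 : n1 < (inn y1).card / q
      · exact Or.inl (hblk_ge _ _ h5)
      · exact Or.inr (hblk_ge _ _ (by omega))

/-- validity of a resource -/
def ValidRes {V : Type} (out1 : V → Finset V) (w : V) (o : Option V) : Prop :=
  ∀ y, o = some y → y ∈ out1 w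

theorem plant {V K : Type} [Fintype V] (q M : ℕ) (hq : 0 < q) (out1 : V → Finset V)
    (J : V → Finset K) (hJ : ∀ u, (J u).card ≤ M) (hout : ∀ u, q * M ≤ (out1 u).card)
    (ρ : V → Option V → Set (Sym2 V)) (Pr : V → Set (Sym2 V) → Prop)
    (hdis : ∀ w o w' o', ValidRes out1 w o → ValidRes out1 w' o' → (w, o) ≠ (w', o') →
      Disjoint (ρ w o) (ρ w' o'))
    (hmem : ∀ w, ∀ y ∈ out1 w, s(w, y) ∈ ρ w (some y))
    (hA : ∀ y (C : Finset V) (R : Set (Sym2 V)), q ≤ C.card →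
      (∀ w ∈ C, y ∈ out1 w ∧ ρ w (some y) ⊆ R) → Pr y R)
    (hB : ∀ y (R : Set (Sym2 V)), ρ y none ⊆ R → Pr y R) :
    ∃ (y : V → K → V) (R : V → K → Set (Sym2 V)),
      (∀ u, ∀ k ∈ J u, y u k ∈ out1 u ∧ s(u, y u k) ∈ R u k ∧ Pr (y u k) (R u k) ∧
        ∀ e ∈ R u k, ∃ w o, ValidRes out1 w o ∧ e ∈ ρ w o) ∧
      (∀ u k u' k', k ∈ J u → k' ∈ J u' → (u, k) ≠ (u', k') → Disjoint (R u k) (R u' k')) := by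
  obtain ⟨y, B, h1, h2, h3⟩ := blocks q M hq out1 J hJ hout
  have vsome : ∀ u, ∀ k ∈ J u, ∀ w ∈ B u k, ValidRes out1 w (some (y u k)) := by
    intro u k hk w hw z hz
    cases hz
    exact h2 u k hk w hw
  have vnone : ∀ w, ValidRes out1 w none := by
    intro w z hz
    cases hz
  refine ⟨y, fun u k => {e | (∃ w ∈ B u k, e ∈ ρ w (some (y u k))) ∨
    ((B u k).card < q ∧ e ∈ ρ (y u k) none)}, ?_, ?_⟩
  · intro u k hk
    obtain ⟨h4, h5⟩ := h1 u k hk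
    refine ⟨h4, Or.inl ⟨u, h5, hmem u _ h4⟩, ?_, ?_⟩
    · by_cases hc : q ≤ (B u k).card
      · apply hA (y u k) (B u k) _ hc
        intro w hw
        refine ⟨h2 u k hk w hw, ?_⟩
        intro e he
        exact Or.inl ⟨w, hw, he⟩
      · apply hB
        intro e he
        exact Or.inr ⟨by omega, he⟩
    · rintro e (⟨w, hw, he⟩ | ⟨_, he⟩)
      · exact ⟨w, _, vsome u k hk w hw, he⟩
      · exact ⟨y u k, none, vnone _, he⟩
  · intro u k u' k' hk hk' hne
    rw [Set.disjoint_left]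
    rintro e (⟨w, hw, he⟩ | ⟨hc, he⟩) (⟨w', hw', he'⟩ | ⟨hc', he'⟩)
    · refine Set.disjoint_left.1 (hdis _ _ _ _ (vsome u k hk w hw) (vsome u' k' hk' w' hw') ?_) he he'
      intro heq
      simp only [Prod.mk.injEq, Option.some.injEq] at heq
      obtain ⟨rfl, hy⟩ := heq
      exact Finset.disjoint_left.1 (h3 u k u' k' hk hk' hne hy).1 hw hw'
    · exact Set.disjoint_left.1 (hdis _ _ _ _ (vsome u k hk w hw) (vnone _) (by simp)) he he'
    · exact Set.disjoint_left.1 (hdis _ _ _ _ (vnone _) (vsome u' k' hk' w' hw') (by simp)) he he'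
    · refine Set.disjoint_left.1 (hdis _ _ _ _ (vnone _) (vnone _) ?_) he he'
      intro heq
      simp only [Prod.mk.injEq, and_true] at heq
      rcases (h3 u k u' k' hk hk' hne heq).2 with h | h <;> omega

def Rich {V : Type} (q : ℕ) (F : Set (Sym2 V)) : ℕ → V → Prop
  | 0, _ => True
  | h + 1, u => ∃ C : Finset V, q ≤ C.card ∧ ∀ y ∈ C, s(u, y) ∈ F ∧ Rich q F h y

theorem Rich.mono {V : Type} {q : ℕ} {F F' : Set (Sym2 V)} (hF : F ⊆ F') :
    ∀ {h : ℕ} {u : V}, Rich q F h u → Rich q F' h u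
  | 0, _, _ => trivial
  | h + 1, u, ⟨C, hC, hy⟩ => ⟨C, hC, fun y hyC => ⟨hF (hy y hyC).1, Rich.mono hF (hy y hyC).2⟩⟩

theorem Rich.pred {V : Type} {q : ℕ} {F : Set (Sym2 V)} :
    ∀ {h : ℕ} {u : V}, Rich q F (h + 1) u → Rich q F h u
  | 0, _, _ => trivial
  | h + 1, u, ⟨C, hC, hy⟩ => ⟨C, hC, fun y hyC => ⟨(hy y hyC).1, Rich.pred (hy y hyC).2⟩⟩

def need (q : ℕ) : ℕ → ℕ → ℕ
  | 0, _ => 0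
  | h + 1, N => q * (N * q) + need q h (q * (N * q) + 1)

def IsArc {V : Type} (out : V → Finset V) (e : Sym2 V) : Prop :=
  ∃ a b, b ∈ out a ∧ e = s(a, b)

theorem arc_inj {V : Type} {out : V → Finset V} (anti : ∀ u v, v ∈ out u → u ∉ out v)
    {a b c d : V} (h1 : b ∈ out a) (h2 : d ∈ out c) (h : s(a, b) = s(c, d)) : a = c ∧ b = d := by
  rw [Sym2.eq_iff] at h
  rcases h with h | ⟨rfl, rfl⟩
  · exact h
  · exact absurd h2 (anti _ _ h1)

theorem supply {V : Type} [Fintype V] (q : ℕ) (hq : 0 < q) : ∀ (h N : ℕ) (K : Type)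
    (J : V → Finset K) (_ : ∀ u, (J u).card ≤ N) (out : V → Finset V)
    (_ : ∀ u v, v ∈ out u → u ∉ out v) (_ : ∀ u, need q h N ≤ (out u).card),
    ∃ F : V → K → Set (Sym2 V),
      (∀ u, ∀ k ∈ J u, (∀ e ∈ F u k, IsArc out e) ∧ Rich q (F u k) h u) ∧
      (∀ u k u' k', k ∈ J u → k' ∈ J u' → (u, k) ≠ (u', k') → Disjoint (F u k) (F u' k')) := by
  intro h
  induction h with
  | zero =>
    intro N K J _ out _ _
    exact ⟨fun _ _ => ∅, fun u k _ => ⟨by simp, trivial⟩, by simp⟩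
  | succ h ih =>
    intro N K J hJ out anti hout
    have hsub : ∀ u, ∃ o ⊆ out u, o.card = q * (N * q) := fun u =>
      Finset.exists_subset_card_eq (le_trans (by rw [need]; omega) (hout u))
    choose out1 hout1 hcard1 using hsub
    obtain ⟨P, hP1, hP2⟩ := ih (q * (N * q) + 1) (Option V) (fun w => Finset.insertNone (out1 w))
      (by intro u; rw [Finset.card_insertNone, hcard1]) (fun u => out u \ out1 u)
      (by
        intro u v huv hvu
        exact anti u v (Finset.mem_sdiff.1 huv).1 (Finset.mem_sdiff.1 hvu).1)
      (by
        intro u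
        have h1 := hout u
        rw [need] at h1
        rw [Finset.card_sdiff_of_subset (hout1 u), hcard1]
        omega)
    have hval : ∀ w o, ValidRes out1 w o → o ∈ Finset.insertNone (out1 w) := by
      intro w o ho
      rw [Finset.mem_insertNone]
      intro a ha
      exact ho a ha
    let ρ : V → Option V → Set (Sym2 V) := fun w o => P w o ∪ {e | ∃ y, o = some y ∧ e = s(w, y)}
    have hmix : ∀ w o w' y', ValidRes out1 w o → y' ∈ out1 w' → s(w', y') ∉ P w o := by
      intro w o w' y' hv hy' hmem
      obtain ⟨a, b, hb, heq⟩ := (hP1 w o (hval _ _ hv)).1 _ hmem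
      rw [Finset.mem_sdiff] at hb
      obtain ⟨rfl, rfl⟩ := arc_inj anti (hout1 _ hy') hb.1 heq
      exact hb.2 hy'
    obtain ⟨y, R, hR1, hR2⟩ := plant q (N * q) hq out1
      (fun u => (J u) ×ˢ (Finset.univ : Finset (Fin q)))
      (by
        intro u
        rw [Finset.card_product, Finset.card_univ, Fintype.card_fin]
        exact Nat.mul_le_mul_right _ (hJ u))
      (fun u => (hcard1 u).ge) ρ (fun y R => Rich q R h y)
      (by
        intro w o w' o' hv hv' hne
        rw [Set.disjoint_left]
        rintro e (he | ⟨z, rfl, rfl⟩) (he' | ⟨z', rfl, hz'⟩)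
        · exact Set.disjoint_left.1 (hP2 w o w' o' (hval _ _ hv) (hval _ _ hv') hne) he he'
        · subst hz'
          exact hmix _ _ _ _ hv (hv' _ rfl) he
        · exact hmix _ _ _ _ hv' (hv _ rfl) he'
        · obtain ⟨rfl, rfl⟩ := arc_inj anti (hout1 _ (hv _ rfl)) (hout1 _ (hv' _ rfl)) hz'
          exact hne rfl)
      (fun w y _ => Or.inr ⟨y, rfl, rfl⟩)
      (by
        intro y C R hC hw
        cases h with
        | zero => trivial
        | succ h =>
          refine ⟨C, hC, fun w hwC => ?_⟩
          obtain ⟨h1, h2⟩ := hw w hwC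
          refine ⟨h2 (Or.inr ⟨y, rfl, Sym2.eq_swap⟩), ?_⟩
          have h3 := (hP1 w (some y) (by simpa using h1)).2
          exact (h3.mono (fun e he => h2 (Or.inl he))).pred)
      (by
        intro y R hR
        exact (hP1 y none (by simp)).2.mono (fun e he => hR (Or.inl he)))
    refine ⟨fun u k => ⋃ j : Fin q, R u (k, j), ?_, ?_⟩
    · intro u k hk
      have hkj : ∀ j : Fin q, (k, j) ∈ (J u) ×ˢ (Finset.univ : Finset (Fin q)) := by
        intro j; simp [hk]
      constructor
      · intro e he
        obtain ⟨j, hj⟩ := Set.mem_iUnion.1 he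
        obtain ⟨w, o, hv, he'⟩ := (hR1 u (k, j) (hkj j)).2.2.2 e hj
        rcases he' with he' | ⟨z, rfl, rfl⟩
        · obtain ⟨a, b, hb, rfl⟩ := (hP1 w o (hval _ _ hv)).1 _ he'
          exact ⟨a, b, (Finset.mem_sdiff.1 hb).1, rfl⟩
        · exact ⟨w, z, hout1 _ (hv _ rfl), rfl⟩
      · refine ⟨(Finset.univ : Finset (Fin q)).image (fun j => y u (k, j)), ?_, ?_⟩
        · rw [Finset.card_image_of_injective]
          · simp
          · intro j j' hjj
            by_contra hne
            have h1 := (hR1 u (k, j) (hkj j)).2.1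
            have h2 := (hR1 u (k, j') (hkj j')).2.1
            simp only at hjj
            rw [← hjj] at h2
            exact Set.disjoint_left.1 (hR2 u (k, j) u (k, j') (hkj j) (hkj j')
              (by simpa using hne)) h1 h2
        · intro z hz
          obtain ⟨j, _, rfl⟩ := Finset.mem_image.1 hz
          obtain ⟨_, h2, h3, _⟩ := hR1 u (k, j) (hkj j)
          exact ⟨Set.mem_iUnion.2 ⟨j, h2⟩, h3.mono (fun e he => Set.mem_iUnion.2 ⟨j, he⟩)⟩
    · intro u k u' k' hk hk' hne
      rw [Set.disjoint_left]
      intro e he he'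
      obtain ⟨j, hj⟩ := Set.mem_iUnion.1 he
      obtain ⟨j', hj'⟩ := Set.mem_iUnion.1 he'
      refine Set.disjoint_left.1 (hR2 u (k, j) u' (k', j') (by simp [hk]) (by simp [hk']) ?_) hj hj'
      intro heq
      simp only [Prod.mk.injEq] at heq
      exact hne (by rw [heq.1, heq.2.1])

theorem split_sets {V K : Type} (q : ℕ) (J : Finset K) : ∀ (S : Finset V), q * J.card ≤ S.card →
    ∃ L : K → Finset V, (∀ k ∈ J, L k ⊆ S ∧ q ≤ (L k).card) ∧
      ∀ k ∈ J, ∀ k' ∈ J, k ≠ k' → Disjoint (L k) (L k') := by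
  induction J using Finset.induction_on with
  | empty => intro S _; exact ⟨fun _ => ∅, by simp, by simp⟩
  | insert a J ha ih =>
    intro S hS
    rw [Finset.card_insert_of_notMem ha, Nat.mul_add, Nat.mul_one] at hS
    obtain ⟨A, hA, hAc⟩ := Finset.exists_subset_card_eq (n := q) (s := S) (by omega)
    obtain ⟨L, hL1, hL2⟩ := ih (S \ A) (by rw [Finset.card_sdiff_of_subset hA]; omega)
    have hd : ∀ k ∈ J, Disjoint A (L k) := by
      intro k hk
      rw [Finset.disjoint_left]
      intro x hx hx'
      exact (Finset.mem_sdiff.1 ((hL1 k hk).1 hx')).2 hx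
    have hne : ∀ k ∈ J, k ≠ a := fun k hk h => ha (h ▸ hk)
    refine ⟨fun k => if k = a then A else L k, ?_, ?_⟩
    · intro k hk
      rcases Finset.mem_insert.1 hk with rfl | hk
      · simp [hA, hAc]
      · simp only [hne k hk, if_false]
        exact ⟨(hL1 k hk).1.trans Finset.sdiff_subset, (hL1 k hk).2⟩
    · intro k hk k' hk' hkk
      rcases Finset.mem_insert.1 hk with h1 | h1 <;> rcases Finset.mem_insert.1 hk' with h2 | h2
      · exact absurd (h1.trans h2.symm) hkk
      · simp only [h1, if_true, hne k' h2, if_false]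
        exact hd k' h2
      · simp only [h2, if_true, hne k h1, if_false]
        exact (hd k h1).symm
      · simp only [hne k h1, hne k' h2, if_false]
        exact hL2 k h1 k' h2 hkk

theorem supply3 {V K : Type} [Fintype V] (q N : ℕ) (hq : 0 < q)
    (J : V → Finset K) (hJ : ∀ u, (J u).card ≤ N) (out : V → Finset V)
    (anti : ∀ u v, v ∈ out u → u ∉ out v) (hout : ∀ u, q * N + q + q * N ≤ (out u).card) :
    ∃ F : V → K → Set (Sym2 V),
      (∀ u, ∀ k ∈ J u, (∀ e ∈ F u k, IsArc out e) ∧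
        (∃ y, s(u, y) ∈ F u k ∧ ∃ C : Finset V, q ≤ C.card ∧ ∀ w ∈ C, s(y, w) ∈ F u k) ∧
        ∃ C : Finset V, q ≤ C.card ∧ ∀ w ∈ C, s(u, w) ∈ F u k) ∧
      (∀ u k u' k', k ∈ J u → k' ∈ J u' → (u, k) ≠ (u', k') → Disjoint (F u k) (F u' k')) := by
  have hsub : ∀ u, ∃ o ⊆ out u, o.card = q * N := fun u =>
    Finset.exists_subset_card_eq (by have := hout u; omega)
  choose out1 hout1 hcard1 using hsub
  have hsub2 : ∀ u, ∃ o ⊆ out u \ out1 u, o.card = q := fun u =>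
    Finset.exists_subset_card_eq (by
      rw [Finset.card_sdiff_of_subset (hout1 u), hcard1]
      have := hout u; omega)
  choose out2 hout2 hcard2 using hsub2
  have hsub3 : ∀ u, ∃ L : K → Finset V,
      (∀ k ∈ J u, L k ⊆ (out u \ out1 u) \ out2 u ∧ q ≤ (L k).card) ∧
      ∀ k ∈ J u, ∀ k' ∈ J u, k ≠ k' → Disjoint (L k) (L k') := fun u =>
    split_sets q (J u) _ (by
      rw [Finset.card_sdiff_of_subset (hout2 u), Finset.card_sdiff_of_subset (hout1 u), hcard1,
        hcard2]
      have := hout u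
      have := Nat.mul_le_mul_left q (hJ u)
      omega)
  choose L hL1 hL2 using hsub3
  have m2 : ∀ a b, b ∈ out2 a → b ∈ out a ∧ b ∉ out1 a := fun a b h =>
    Finset.mem_sdiff.1 (hout2 a h)
  have m3 : ∀ a, ∀ k ∈ J a, ∀ b ∈ L a k, b ∈ out a ∧ b ∉ out1 a ∧ b ∉ out2 a := by
    intro a k hk b h
    have := (hL1 a k hk).1 h
    simp only [Finset.mem_sdiff] at this
    exact ⟨this.1.1, this.1.2, this.2⟩
  let ρ : V → Option V → Set (Sym2 V) := fun w o =>
    {e | (o = none ∧ ∃ z ∈ out2 w, e = s(w, z)) ∨ ∃ y, o = some y ∧ e = s(w, y)}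
  have hρ : ∀ w o e, ValidRes out1 w o → e ∈ ρ w o → ∃ z, e = s(w, z) ∧ z ∈ out w ∧
      ((o = none ∧ z ∈ out2 w) ∨ (o = some z ∧ z ∈ out1 w)) := by
    rintro w o e hv (⟨rfl, z, hz, rfl⟩ | ⟨y, rfl, rfl⟩)
    · exact ⟨z, rfl, (m2 _ _ hz).1, Or.inl ⟨rfl, hz⟩⟩
    · exact ⟨y, rfl, hout1 _ (hv _ rfl), Or.inr ⟨rfl, hv _ rfl⟩⟩
  obtain ⟨y, R, hR1, hR2⟩ := plant q N hq out1 J hJ (fun u => (hcard1 u).ge) ρ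
      (fun y R => ∃ C : Finset V, q ≤ C.card ∧ ∀ w ∈ C, s(y, w) ∈ R)
      (by
        intro w o w' o' hv hv' hne
        rw [Set.disjoint_left]
        intro e he he'
        obtain ⟨z, rfl, hz, h1⟩ := hρ w o e hv he
        obtain ⟨z', heq, hz', h1'⟩ := hρ w' o' _ hv' he'
        obtain ⟨rfl, rfl⟩ := arc_inj anti hz hz' heq
        rcases h1 with ⟨rfl, h2⟩ | ⟨rfl, h2⟩ <;> rcases h1' with ⟨rfl, h2'⟩ | ⟨rfl, h2'⟩
        · exact hne rfl
        · exact (m2 _ _ h2).2 h2'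
        · exact (m2 _ _ h2').2 h2
        · exact hne rfl)
      (fun w y _ => Or.inr ⟨y, rfl, rfl⟩)
      (by
        intro y C R hC hw
        refine ⟨C, hC, fun w hwC => ?_⟩
        exact (hw w hwC).2 (Or.inr ⟨y, rfl, Sym2.eq_swap⟩))
      (by
        intro y R hR
        refine ⟨out2 y, (hcard2 y).ge, fun w hw => hR (Or.inl ⟨rfl, w, hw, rfl⟩)⟩)
  have hdL : ∀ u k u' k', k ∈ J u → k' ∈ J u' → ∀ e ∈ R u k, ∀ z ∈ L u' k', e ≠ s(u', z) := by
    intro u k u' k' hk hk' e he z hz heq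
    obtain ⟨w, o, hv, he'⟩ := (hR1 u k hk).2.2.2 e he
    obtain ⟨x, rfl, hx, h1⟩ := hρ w o e hv he'
    obtain ⟨h2, h3, h4⟩ := m3 _ _ hk' _ hz
    obtain ⟨rfl, rfl⟩ := arc_inj anti hx h2 heq
    rcases h1 with ⟨_, h1⟩ | ⟨_, h1⟩
    · exact h4 h1
    · exact h3 h1
  refine ⟨fun u k => R u k ∪ {e | ∃ z ∈ L u k, e = s(u, z)}, ?_, ?_⟩
  · intro u k hk
    obtain ⟨h1, h2, ⟨C, hC, h3⟩, h4⟩ := hR1 u k hk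
    refine ⟨?_, ⟨y u k, Or.inl h2, C, hC, fun w hw => Or.inl (h3 w hw)⟩,
      ⟨L u k, (hL1 u k hk).2, fun w hw => Or.inr ⟨w, hw, rfl⟩⟩⟩
    rintro e (he | ⟨z, hz, rfl⟩)
    · obtain ⟨w, o, hv, he'⟩ := h4 e he
      obtain ⟨x, rfl, hx, -⟩ := hρ w o e hv he'
      exact ⟨w, x, hx, rfl⟩
    · exact ⟨u, z, (m3 _ _ hk _ hz).1, rfl⟩
  · intro u k u' k' hk hk' hne
    rw [Set.disjoint_left]
    rintro e (he | ⟨z, hz, rfl⟩) (he' | ⟨z', hz', heq⟩)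
    · exact Set.disjoint_left.1 (hR2 u k u' k' hk hk' hne) he he'
    · exact hdL _ _ _ _ hk hk' e he z' hz' heq
    · exact hdL _ _ _ _ hk' hk _ he' z hz rfl
    · obtain ⟨rfl, rfl⟩ := arc_inj anti (m3 _ _ hk _ hz).1 (m3 _ _ hk' _ hz').1 heq
      refine Finset.disjoint_left.1 (hL2 u k hk k' hk' ?_) hz hz'
      rintro rfl
      exact hne rfl

theorem need_le (q : ℕ) (hq : 2 ≤ q) : ∀ h N, need q h N + (N + 1) ≤ (2 * q ^ 2) ^ h * (N + 1) := by
  intro h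
  induction h with
  | zero => intro N; simp [need]
  | succ h ih =>
    intro N
    have h1 := ih (q * (N * q) + 1)
    rw [need]
    have h2 : q * (N * q) = q ^ 2 * N := by ring
    rw [h2] at h1 ⊢
    have h3 : (2 * q ^ 2) ^ h * (q ^ 2 * N + 1 + 1) ≤ (2 * q ^ 2) ^ h * (q ^ 2 * (N + 1)) := by
      apply Nat.mul_le_mul_left
      nlinarith
    have h4 : (2 * q ^ 2) ^ (h + 1) * (N + 1) = 2 * ((2 * q ^ 2) ^ h * (q ^ 2 * (N + 1))) := by
      rw [pow_succ]; ring
    have h5 : 1 * (q ^ 2 * (N + 1)) ≤ (2 * q ^ 2) ^ h * (q ^ 2 * (N + 1)) := by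
      apply Nat.mul_le_mul_right
      exact Nat.one_le_pow _ _ (by positivity)
    rw [h4]
    have h6 : q ^ 2 * (N + 1) = q ^ 2 * N + q ^ 2 := by ring
    have h7 : N + 1 ≤ q ^ 2 * (N + 1) := Nat.le_mul_of_pos_left (N + 1) (by positivity)
    omega

end

section
open scoped Classical

theorem conn_parent {V : Type} {G : SimpleGraph V} (hG : G.Connected) (x : V) :
    ∀ w, w ≠ x → ∃ p, G.Adj w p ∧ G.dist x w = G.dist x p + 1 := by
  intro w hw
  obtain ⟨p, hp⟩ := hG.exists_walk_length_eq_dist w x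
  cases p with
  | nil => exact absurd rfl hw
  | @cons _ b _ h q =>
    refine ⟨b, h, ?_⟩
    have h1 : G.dist b x ≤ q.length := SimpleGraph.dist_le q
    have h2 : G.dist w x ≤ G.dist w b + G.dist b x := hG.dist_triangle
    have h3 : G.dist w b = 1 := SimpleGraph.dist_eq_one_iff_adj.2 h
    simp only [SimpleGraph.Walk.length_cons] at hp
    rw [G.dist_comm (u := x), G.dist_comm (u := x)]
    omega

theorem tree_parent {W : Type} [Fintype W] {T : SimpleGraph W} (hT : T.IsTree) (x : W) :
    ∃ par : W → W, (∀ w, w ≠ x → T.Adj w (par w) ∧ T.dist x w = T.dist x (par w) + 1) ∧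
      ∀ e ∈ T.edgeSet, ∃ w, w ≠ x ∧ e = s(w, par w) := by
  have h := conn_parent hT.connected x
  choose! par hpar using h
  refine ⟨par, hpar, ?_⟩
  let S : Finset (Sym2 W) := (Finset.univ.erase x).image (fun w => s(w, par w))
  have hS : S.card = Fintype.card W - 1 := by
    rw [Finset.card_image_of_injOn]
    · simp [Finset.card_erase_of_mem]
    · intro a ha b hb hab
      have ha' : a ≠ x := by simpa using ha
      have hb' : b ≠ x := by simpa using hb
      have h1 := (hpar a ha').2
      have h2 := (hpar b hb').2
      rcases Sym2.eq_iff.1 hab with ⟨h, _⟩ | ⟨h3, h4⟩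
      · exact h
      · rw [h4] at h1
        rw [← h3] at h2
        omega
  have hsub : S ⊆ T.edgeFinset := by
    intro e he
    obtain ⟨w, hw, rfl⟩ := Finset.mem_image.1 he
    have hw' : w ≠ x := by simpa using hw
    simpa using (hpar w hw').1
  have heq : S = T.edgeFinset := by
    apply Finset.eq_of_subset_of_card_le hsub
    have := hT.card_edgeFinset
    omega
  intro e he
  have : e ∈ S := by rw [heq]; simpa using he
  obtain ⟨w, hw, rfl⟩ := Finset.mem_image.1 this
  exact ⟨w, by simpa using hw, rfl⟩

theorem parent_unique {W : Type} [Fintype W] {T : SimpleGraph W} (hT : T.IsTree) (r a b c : W)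
    (hb : T.Adj a b) (hc : T.Adj a c) (h1 : T.dist r a = T.dist r b + 1)
    (h2 : T.dist r a = T.dist r c + 1) : b = c := by
  obtain ⟨par, hpar, hE⟩ := tree_parent hT r
  have key : ∀ d, T.Adj a d → T.dist r a = T.dist r d + 1 → par a = d := by
    intro d hd h
    obtain ⟨w, hw, heq⟩ := hE s(a, d) hd
    rcases Sym2.eq_iff.1 heq with ⟨h3, h4⟩ | ⟨h3, h4⟩
    · rw [h3, h4]
    · have := (hpar w hw).2
      rw [← h3, ← h4] at this
      omega
  rw [← key b hb h1, ← key c hc h2]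

theorem tree_leaf {W : Type} [Fintype W] {T : SimpleGraph W} (hT : T.IsTree)
    (hc : 4 < Fintype.card W) : ∃ l x, T.Adj l x ∧ ∀ y, T.Adj l y → y = x := by
  have : Nontrivial W := Fintype.one_lt_card_iff_nontrivial.1 (by omega)
  obtain ⟨l, hl⟩ := hT.exists_vert_degree_one_of_nontrivial
  obtain ⟨x, hx, hu⟩ := SimpleGraph.degree_eq_one_iff_existsUnique_adj.1 hl
  exact ⟨l, x, hx, hu⟩

/-- The tree rooted at the neighbour `x` of a leaf `l`. -/
theorem tree_rooted {W : Type} [Fintype W] {T : SimpleGraph W} (hT : T.IsTree)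
    (hc : 4 < Fintype.card W) : ∃ (x l : W) (par : W → W), l ≠ x ∧ par l = x ∧
      (∀ y, T.Adj l y → y = x) ∧ T.Adj l x ∧
      (∀ w, w ≠ x → par w ≠ l) ∧
      (∀ w, w ≠ x → T.Adj w (par w) ∧ T.dist x w = T.dist x (par w) + 1) ∧
      ∀ e ∈ T.edgeSet, ∃ w, w ≠ x ∧ e = s(w, par w) := by
  obtain ⟨l, x, hlx, hu⟩ := tree_leaf hT hc
  obtain ⟨par, h1, h2⟩ := tree_parent hT x
  have hne : l ≠ x := hlx.ne
  refine ⟨x, l, par, hne, hu _ (h1 l hne).1, hu, hlx, ?_, h1, h2⟩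
  intro w hw h
  have h3 := (h1 w hw).1
  rw [h] at h3
  exact hw (hu _ h3.symm)

theorem tree_rooted3 {W : Type} [Fintype W] {T : SimpleGraph W} (hT : T.IsTree)
    (hc : 4 < Fintype.card W) (hd : ∀ u v : W, T.dist u v ≤ 3) :
    ∃ (x l z : W) (par : W → W), T.Adj x l ∧ l ≠ x ∧ z ≠ x ∧ z ≠ l ∧ par l = x ∧ par z = x ∧
      (∀ w, w ≠ x → par w = x ∨ par w = z) ∧
      ∀ e ∈ T.edgeSet, ∃ w, w ≠ x ∧ e = s(w, par w) := by
  obtain ⟨x, l, par, hlx, hpl, hu, hadj, hnl, hpar, hE⟩ := tree_rooted hT hc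
  have hd2 : ∀ w, w ≠ l → T.dist x w ≤ 2 := by
    intro w hw
    rcases hT.dist_eq_dist_add_one_of_adj w hadj with h | h
    · have := hd w l
      rw [T.dist_comm (u := x)]
      omega
    · obtain ⟨p, hp, h2⟩ := conn_parent hT.connected w l hw.symm
      rw [hu p hp] at h2
      omega
  have hx : ∀ w, T.dist x w = 0 → w = x := fun w h => (hT.connected.dist_eq_zero_iff.1 h).symm
  by_cases hex : ∃ w, w ≠ x ∧ par w ≠ x
  · obtain ⟨w, hw, hpw⟩ := hex
    have hpw1 : ∀ w, w ≠ x → par w ≠ x → w ≠ l ∧ par w ≠ l ∧ par (par w) = x ∧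
        T.dist x w = 2 ∧ T.dist x (par w) = 1 := by
      intro w hw hpw
      have h0 : w ≠ l := by rintro rfl; exact hpw hpl
      have h1 := hd2 w h0
      have h2 := (hpar w hw).2
      have h3 := (hpar _ hpw).2
      have h4 := hx (par (par w)) (by omega)
      rw [h4] at h3
      rw [T.dist_self] at h3
      exact ⟨h0, hnl w hw, h4, by omega, by omega⟩
    obtain ⟨a1, a2, a3, a4, a5⟩ := hpw1 w hw hpw
    refine ⟨x, l, par w, par, hadj.symm, hlx, hpw, a2, hpl, a3, ?_, hE⟩
    intro w' hw'
    by_contra hcon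
    push Not at hcon
    obtain ⟨hp', hne⟩ := hcon
    obtain ⟨b1, b2, b3, b4, b5⟩ := hpw1 w' hw' hp'
    have hadjz : T.Adj (par w') x := by have := (hpar _ hp').1; rwa [b3] at this
    have hw'z := (hpar w' hw').1
    have hwx : T.dist w x = 2 := by rw [T.dist_comm]; exact a4
    have hz3 : T.dist w (par w') = 3 := by
      rcases hT.dist_eq_dist_add_one_of_adj w hadjz with h | h
      · omega
      · exfalso
        have h1 : T.dist w (par w') = 1 := by omega
        have h2 := SimpleGraph.dist_eq_one_iff_adj.1 h1
        exact hne (parent_unique hT x w (par w') (par w) h2 (hpar w hw).1 (by omega) (by omega))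
    rcases hT.dist_eq_dist_add_one_of_adj w hw'z with h | h
    · have := hd w w'
      omega
    · exact hw' (parent_unique hT w (par w') w' x hw'z.symm hadjz (by omega) (by omega))
  · push Not at hex
    obtain ⟨z, hz⟩ : ∃ z, z ∉ ({x, l} : Finset W) := by
      by_contra hcon
      push Not at hcon
      have h1 : (Finset.univ : Finset W) ⊆ {x, l} := fun a _ => hcon a
      have h2 := Finset.card_le_card h1
      have h3 : ({x, l} : Finset W).card ≤ 2 := Finset.card_le_two
      rw [Finset.card_univ] at h2
      omega
    simp only [Finset.mem_insert, Finset.mem_singleton, not_or] at hz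
    exact ⟨x, l, z, par, hadj.symm, hlx, hz.1, hz.2, hpl, hex z hz.1, fun w hw => Or.inl (hex w hw), hE⟩

/-- Greedy embedding. -/
theorem greedy {V W : Type} [Fintype W] (S0 : Finset W) (par : W → W) (lvl : W → ℕ)
    (hlvl : ∀ w, w ∉ S0 → lvl (par w) < lvl w) (Good : W → V → Prop) (Rel : V → V → Prop)
    (H : ∀ w, w ∉ S0 → ∀ y, Good (par w) y → ∃ C : Finset V, Fintype.card W ≤ C.card ∧
      ∀ y' ∈ C, Good w y' ∧ Rel y y')
    (φ0 : W → V) (hinj : Set.InjOn φ0 S0) (hgood : ∀ s ∈ S0, Good s (φ0 s)) :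
    ∃ φ : W → V, Function.Injective φ ∧ (∀ s ∈ S0, φ s = φ0 s) ∧
      ∀ w, w ∉ S0 → Rel (φ (par w)) (φ w) := by
  let P : Finset W → Prop := fun S => S0 ⊆ S ∧ (∀ w ∈ S, w ∉ S0 → par w ∈ S) ∧
    ∃ φ : W → V, Set.InjOn φ S ∧ (∀ s ∈ S0, φ s = φ0 s) ∧ (∀ s ∈ S, Good s (φ s)) ∧
      ∀ w ∈ S, w ∉ S0 → Rel (φ (par w)) (φ w)
  have hP0 : (Finset.univ.filter P).Nonempty :=
    ⟨S0, by simpa using ⟨subset_rfl, fun w h h' => absurd h h', φ0, hinj, fun _ _ => rfl, hgood,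
      fun w h h' => absurd h h'⟩⟩
  obtain ⟨S, hS, hmax⟩ := Finset.exists_max_image _ Finset.card hP0
  obtain ⟨hS0, hcl, φ, h1, h2, h3, h4⟩ := (Finset.mem_filter.1 hS).2
  by_cases hu : S = Finset.univ
  · subst hu
    refine ⟨φ, ?_, h2, fun w hw => h4 w (Finset.mem_univ _) hw⟩
    intro a b hab
    exact h1 (by simp) (by simp) hab
  exfalso
  have hne : (Finset.univ \ S).Nonempty := by
    rw [Finset.sdiff_nonempty]
    intro h
    exact hu (Finset.eq_univ_iff_forall.2 fun a => h (Finset.mem_univ a))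
  obtain ⟨w, hw, hmin⟩ := Finset.exists_min_image _ lvl hne
  have hwS : w ∉ S := (Finset.mem_sdiff.1 hw).2
  have hw0 : w ∉ S0 := fun h => hwS (hS0 h)
  have hpw : par w ∈ S := by
    by_contra h
    have := hmin (par w) (by simp [h])
    have := hlvl w hw0
    omega
  have hpne : par w ≠ w := fun h => hwS (h ▸ hpw)
  obtain ⟨C, hC, hCg⟩ := H w hw0 _ (h3 _ hpw)
  have hlt : (S.image φ).card < C.card := by
    have h5 : S.card < Fintype.card W := by
      rw [← Finset.card_univ]
      exact Finset.card_lt_card ⟨Finset.subset_univ _, fun h => hu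
        (Finset.eq_univ_iff_forall.2 fun a => h (Finset.mem_univ a))⟩
    have := Finset.card_image_le (s := S) (f := φ)
    omega
  obtain ⟨y, hyC, hy⟩ := Finset.exists_mem_notMem_of_card_lt_card hlt
  obtain ⟨g1, g2⟩ := hCg y hyC
  have hne2 : ∀ s ∈ S, s ≠ w := fun s hs h => hwS (h ▸ hs)
  have hup : ∀ s ∈ S, Function.update φ w y s = φ s := fun s hs =>
    Function.update_of_ne (hne2 s hs) _ _
  have hP : P (insert w S) := by
    refine ⟨hS0.trans (Finset.subset_insert _ _), ?_, Function.update φ w y, ?_, ?_, ?_, ?_⟩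
    · intro a ha ha0
      rcases Finset.mem_insert.1 ha with rfl | ha
      · exact Finset.mem_insert_of_mem hpw
      · exact Finset.mem_insert_of_mem (hcl a ha ha0)
    · rw [Finset.coe_insert, Set.injOn_insert (by simpa using hwS)]
      refine ⟨fun a ha b hb hab => ?_, ?_⟩
      · rw [hup a ha, hup b hb] at hab
        exact h1 ha hb hab
      · rintro ⟨a, ha, hab⟩
        rw [hup a ha, Function.update_self] at hab
        exact hy (Finset.mem_image.2 ⟨a, ha, hab⟩)
    · intro s hs
      rw [hup s (hS0 hs), h2 s hs]
    · intro s hs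
      rcases Finset.mem_insert.1 hs with rfl | hs
      · rw [Function.update_self]; exact g1
      · rw [hup s hs]; exact h3 s hs
    · intro a ha ha0
      rcases Finset.mem_insert.1 ha with rfl | ha
      · rw [Function.update_self, hup _ hpw]; exact g2
      · rw [hup _ ha, hup _ (hcl a ha ha0)]; exact h4 a ha ha0
  have := hmax (insert w S) (by simpa using hP)
  rw [Finset.card_insert_of_notMem hwS] at this
  omega

/-- The edge set of the image of `T` under `φ`. -/
def copyE {V W : Type} (T : SimpleGraph W) (φ : W → V) : Set (Sym2 V) :=
  Sym2.map φ '' T.edgeSet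

theorem copyE_subset {V W : Type} {T : SimpleGraph W} {x : W} {par : W → W}
    (hE : ∀ e ∈ T.edgeSet, ∃ w, w ≠ x ∧ e = s(w, par w)) (φ : W → V) (F : Set (Sym2 V))
    (h : ∀ w, w ≠ x → s(φ (par w), φ w) ∈ F) : copyE T φ ⊆ F := by
  rintro _ ⟨e, he, rfl⟩
  obtain ⟨w, hw, rfl⟩ := hE e he
  rw [Sym2.map_mk, Sym2.eq_swap]
  exact h w hw

theorem embed_min {V W : Type} [Fintype W] {T : SimpleGraph W} (hT : T.IsTree)
    (hc : 4 < Fintype.card W) (N : Set (Sym2 V)) (U : Finset V) (hU : U.Nonempty)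
    (h : ∀ y ∈ U, ∃ C ⊆ U, Fintype.card W ≤ C.card ∧ ∀ y' ∈ C, s(y, y') ∈ N) :
    ∃ φ : W → V, Function.Injective φ ∧ copyE T φ ⊆ N := by
  obtain ⟨x, l, par, hlx, hpl, hu, hadj, hnl, hpar, hE⟩ := tree_rooted hT hc
  obtain ⟨u, hu⟩ := hU
  obtain ⟨φ, h1, h2, h3⟩ := greedy {x} par (T.dist x)
    (fun w hw => by have := (hpar w (by simpa using hw)).2; omega)
    (fun _ y => y ∈ U) (fun y y' => s(y, y') ∈ N)
    (fun w _ y hy => by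
      obtain ⟨C, h1, h2, h3⟩ := h y hy
      exact ⟨C, h2, fun y' hy' => ⟨h1 hy', h3 y' hy'⟩⟩)
    (fun _ => u) (by simp) (fun _ _ => hu)
  exact ⟨φ, h1, copyE_subset hE φ N (fun w hw => h3 w (by simpa using hw))⟩

theorem embed_rich {V W : Type} [Fintype W] {T : SimpleGraph W} (hT : T.IsTree)
    (hc : 4 < Fintype.card W) (F : Set (Sym2 V)) (u v : V) (huv : u ≠ v)
    (h : Rich (Fintype.card W) F (Fintype.card W) u) :
    ∃ φ : W → V, Function.Injective φ ∧ copyE T φ ⊆ insert s(u, v) F ∧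
      s(u, v) ∈ copyE T φ := by
  obtain ⟨x, l, par, hlx, hpl, hu, hadj, hnl, hpar, hE⟩ := tree_rooted hT hc
  have hdist : ∀ w, T.dist x w < Fintype.card W := by
    intro w
    obtain ⟨p, hp, hl⟩ := hT.connected.exists_path_of_dist x w
    rw [← hl]
    exact hp.length_lt
  obtain ⟨φ, h1, h2, h3⟩ := greedy {x, l} par (T.dist x)
    (fun w hw => by
      have := (hpar w (by simp at hw; tauto)).2; omega)
    (fun w y => w = l ∨ Rich (Fintype.card W) F (Fintype.card W - T.dist x w) y)
    (fun y y' => s(y, y') ∈ F)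
    (fun w hw y hy => by
      have hwx : w ≠ x := by simp at hw; tauto
      have h5 := hy.resolve_left (hnl w hwx)
      have h6 := (hpar w hwx).2
      have h7 := hdist w
      have h8 : Fintype.card W - T.dist x (par w) = (Fintype.card W - T.dist x w) + 1 := by omega
      rw [h8] at h5
      obtain ⟨C, hC, h9⟩ := h5
      exact ⟨C, hC, fun y' hy' => ⟨Or.inr (h9 y' hy').2, (h9 y' hy').1⟩⟩)
    (fun w => if w = x then u else v)
    (by
      intro a ha b hb hab
      simp only [Finset.coe_insert, Finset.coe_singleton, Set.mem_insert_iff,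
        Set.mem_singleton_iff] at ha hb
      rcases ha with rfl | rfl <;> rcases hb with rfl | rfl <;> simp_all)
    (by
      intro s hs
      simp only [Finset.mem_insert, Finset.mem_singleton] at hs
      rcases hs with rfl | rfl
      · right; simpa using h
      · left; rfl)
  have hx : φ x = u := by rw [h2 x (by simp)]; simp
  have hl : φ l = v := by rw [h2 l (by simp)]; simp [hlx]
  refine ⟨φ, h1, copyE_subset hE φ _ (fun w hw => ?_), ⟨s(x, l), hadj.symm, ?_⟩⟩
  · by_cases hwl : w = l
    · left; rw [hwl, hpl, hx, hl]
    · right; exact h3 w (by simp [hw, hwl])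
  · rw [Sym2.map_mk, hx, hl]

theorem embed_three {V W : Type} [Fintype W] {T : SimpleGraph W} (hT : T.IsTree)
    (hc : 4 < Fintype.card W) (hd : ∀ u v : W, T.dist u v ≤ 3)
    (F : Set (Sym2 V)) (u v y : V) (huv : u ≠ v) (hyu : y ≠ u) (hyv : y ≠ v)
    (hy : s(u, y) ∈ F) (C1 C2 : Finset V) (hC1 : Fintype.card W ≤ C1.card)
    (hC2 : Fintype.card W ≤ C2.card) (hF1 : ∀ w ∈ C1, s(y, w) ∈ F) (hF2 : ∀ w ∈ C2, s(u, w) ∈ F) :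
    ∃ φ : W → V, Function.Injective φ ∧ copyE T φ ⊆ insert s(u, v) F ∧
      s(u, v) ∈ copyE T φ := by
  obtain ⟨x, l, z, par, hadj, hlx, hzx, hzl, hpl, hpz, hpar, hE⟩ := tree_rooted3 hT hc hd
  obtain ⟨φ, h1, h2, h3⟩ := greedy {x, l, z} par (fun w => if w = x then 0 else if w = z then 1
      else 2)
    (fun w hw => by
      simp only [Finset.mem_insert, Finset.mem_singleton, not_or] at hw
      rcases hpar w hw.1 with h | h <;> simp [h, hw, hzx])
    (fun w a => (w = x → a = u) ∧ (w = z → a = y))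
    (fun y y' => s(y, y') ∈ F)
    (fun w hw a ha => by
      simp only [Finset.mem_insert, Finset.mem_singleton, not_or] at hw
      rcases hpar w hw.1 with h | h
      · have := ha.1 h
        subst this
        exact ⟨C2, hC2, fun b hb => ⟨⟨fun h => absurd h hw.1, fun h => absurd h hw.2.2⟩, hF2 b hb⟩⟩
      · have := ha.2 h
        subst this
        exact ⟨C1, hC1, fun b hb => ⟨⟨fun h => absurd h hw.1, fun h => absurd h hw.2.2⟩, hF1 b hb⟩⟩)
    (fun w => if w = x then u else if w = z then y else v)
    (by
      intro a ha b hb hab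
      simp only [Finset.coe_insert, Finset.coe_singleton, Set.mem_insert_iff,
        Set.mem_singleton_iff] at ha hb
      have e1 := hzl.symm
      have e2 := huv.symm
      have e3 := hyu.symm
      have e4 := hyv.symm
      rcases ha with rfl | rfl | rfl <;> rcases hb with rfl | rfl | rfl <;> simp_all)
    (by
      intro s hs
      simp only [Finset.mem_insert, Finset.mem_singleton] at hs
      rcases hs with rfl | rfl | rfl
      · simp [hzx.symm]
      · simp [hlx, hzl.symm]
      · simp [hzx])
  have hx : φ x = u := by rw [h2 x (by simp)]; simp
  have hl : φ l = v := by rw [h2 l (by simp)]; simp [hlx, hzl.symm]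
  have hz : φ z = y := by rw [h2 z (by simp)]; simp [hzx]
  refine ⟨φ, h1, copyE_subset hE φ _ (fun w hw => ?_), ⟨s(x, l), hadj, by
    rw [Sym2.map_mk, hx, hl]⟩⟩
  by_cases hwl : w = l
  · left; rw [hwl, hpl, hx, hl]
  · by_cases hwz : w = z
    · right; rw [hwz, hpz, hx, hz]; exact hy
    · right; exact h3 w (by simp [hw, hwl, hwz])

end

section
open scoped Classical

/-- Edge sets that decompose into copies of `T`. -/
inductive TD {V W : Type} (T : SimpleGraph W) : Set (Sym2 V) → Prop
  | empty : TD T ∅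
  | add (E : Set (Sym2 V)) (φ : W → V) (hφ : Function.Injective φ)
      (hd : Disjoint E (copyE T φ)) (h : TD T E) : TD T (E ∪ copyE T φ)

theorem TD.copy {V W : Type} {T : SimpleGraph W} (φ : W → V) (hφ : Function.Injective φ) :
    TD T (copyE T φ) := by
  have := TD.add (T := T) ∅ φ hφ (by simp) TD.empty
  simpa using this

theorem TD.union {V W : Type} {T : SimpleGraph W} {A B : Set (Sym2 V)} (hA : TD T A)
    (hB : TD T B) (hd : Disjoint A B) : TD T (A ∪ B) := by
  induction hB with
  | empty => simpa using hA
  | add E φ hφ hd' h ih =>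
    rw [Set.disjoint_union_right] at hd
    rw [← Set.union_assoc]
    exact TD.add _ φ hφ (Set.disjoint_union_left.2 ⟨hd.2, hd'⟩) (ih hd.1)

theorem TD.biUnion {V W ι : Type} {T : SimpleGraph W} (f : ι → Set (Sym2 V)) (s : Finset ι)
    (h : ∀ i ∈ s, TD T (f i)) (hd : ∀ i ∈ s, ∀ j ∈ s, i ≠ j → Disjoint (f i) (f j)) :
    TD T (⋃ i ∈ s, f i) := by
  induction s using Finset.induction_on with
  | empty => simpa using TD.empty
  | insert a s ha ih =>
    rw [Finset.set_biUnion_insert]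
    refine TD.union (h a (by simp)) (ih (fun i hi => h i (by simp [hi]))
      (fun i hi j hj => hd i (by simp [hi]) j (by simp [hj]))) ?_
    rw [Set.disjoint_iUnion₂_right]
    intro i hi
    exact hd a (by simp) i (by simp [hi]) (fun h => ha (h ▸ hi))

theorem copyE_ncard {V W : Type} {T : SimpleGraph W} (φ : W → V) (hφ : Function.Injective φ) :
    (copyE T φ).ncard = T.edgeSet.ncard :=
  Set.ncard_image_of_injective _ (Sym2.map.injective hφ)

theorem TD.dvd {V W : Type} [Fintype V] {T : SimpleGraph W} {A : Set (Sym2 V)} (hA : TD T A) :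
    T.edgeSet.ncard ∣ A.ncard := by
  induction hA with
  | empty => simp
  | add E φ hφ hd h ih =>
    rw [Set.ncard_union_eq hd (Set.toFinite _) (Set.toFinite _), copyE_ncard φ hφ]
    exact Dvd.dvd.add ih (dvd_refl _)

theorem copy_subgraph {V W : Type} {T : SimpleGraph W} {G : SimpleGraph V} (φ : W → V)
    (hφ : Function.Injective φ) (h : copyE T φ ⊆ G.edgeSet) :
    ∃ H : G.Subgraph, Nonempty (H.coe ≃g T) ∧ H.edgeSet = copyE T φ := by
  let f : T →g G := ⟨φ, fun {a b} hab => by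
    have h1 : s(φ a, φ b) ∈ G.edgeSet := h ⟨s(a, b), hab, by simp⟩
    exact h1⟩
  let c : SimpleGraph.Copy T G := ⟨f, hφ⟩
  refine ⟨c.toSubgraph, ⟨c.isoToSubgraph.symm⟩, ?_⟩
  rw [SimpleGraph.Subgraph.edgeSet_map]
  rfl

theorem TD.decomp {V W : Type} {T : SimpleGraph W} {G : SimpleGraph V}
    {A : Set (Sym2 V)} (hA : TD T A) (hG : A ⊆ G.edgeSet) :
    ∃ D : Set G.Subgraph, (∀ H ∈ D, Nonempty (H.coe ≃g T)) ∧
      (∀ H ∈ D, ∀ K ∈ D, H ≠ K → Disjoint H.edgeSet K.edgeSet) ∧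
      (⋃ H ∈ D, H.edgeSet) = A := by
  induction hA with
  | empty => exact ⟨∅, by simp, by simp, by simp⟩
  | add E φ hφ hd h ih =>
    obtain ⟨D, h1, h2, h3⟩ := ih (Set.subset_union_left.trans hG)
    obtain ⟨H, h4, h5⟩ := copy_subgraph φ hφ (Set.subset_union_right.trans hG)
    have hdis : ∀ K ∈ D, Disjoint K.edgeSet H.edgeSet := by
      intro K hK
      rw [h5]
      refine hd.mono_left ?_
      rw [← h3]
      exact Set.subset_biUnion_of_mem (u := fun H : G.Subgraph => H.edgeSet) hK
    refine ⟨insert H D, ?_, ?_, ?_⟩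
    · intro K hK
      rcases hK with rfl | hK
      · exact h4
      · exact h1 K hK
    · intro K hK L hL hne
      rcases hK with rfl | hK <;> rcases hL with rfl | hL
      · exact absurd rfl hne
      · exact (hdis L hL).symm
      · exact hdis K hK
      · exact h2 K hK L hL hne
    · rw [Set.biUnion_insert, h3, h5, Set.union_comm]

theorem decomp_TD {V W : Type} [Fintype V] {T : SimpleGraph W} {G : SimpleGraph V}
    {D : Set G.Subgraph} (hD : IsDecompInto G T D) : TD T G.edgeSet := by
  obtain ⟨h1, h2, h3⟩ := hD
  have hfin : D.Finite := Set.toFinite D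
  have h4 := TD.biUnion (T := T) (fun H : G.Subgraph => H.edgeSet) hfin.toFinset (by
      intro H hH
      obtain ⟨f⟩ := h1 H (by simpa using hH)
      have : H.edgeSet = copyE T (fun w => (f.symm w : V)) := by
        ext e
        induction e with
        | _ a b =>
          simp only [copyE, Set.mem_image, SimpleGraph.Subgraph.mem_edgeSet]
          constructor
          · intro hab
            refine ⟨s(f ⟨a, H.edge_vert hab⟩, f ⟨b, H.edge_vert hab.symm⟩), ?_, by simp⟩
            exact f.map_adj_iff.2 hab
          · rintro ⟨e, he, heq⟩
            induction e with
            | _ c d =>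
              have h6 : H.coe.Adj (f.symm c) (f.symm d) := f.symm.map_adj_iff.2 he
              have h7 : H.Adj (f.symm c) (f.symm d) := h6
              rw [Sym2.map_mk] at heq
              rcases Sym2.eq_iff.1 heq with ⟨rfl, rfl⟩ | ⟨rfl, rfl⟩
              · exact h7
              · exact h7.symm
      simp only [this]
      exact TD.copy _ (Subtype.val_injective.comp f.symm.injective))
    (by
      intro H hH K hK hne
      exact h2 H (by simpa using hH) K (by simpa using hK) hne)
  rw [← h3]
  simpa using h4

theorem max_TD {V W : Type} [Fintype V] {T : SimpleGraph W} (hT : 0 < T.edgeSet.ncard)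
    (N : Set (Sym2 V)) :
    ∃ A ⊆ N, TD T A ∧ ∀ φ : W → V, Function.Injective φ → ¬ copyE T φ ⊆ N \ A := by
  obtain ⟨A, ⟨hA1, hA2⟩, hmax⟩ := Set.exists_max_image {A : Set (Sym2 V) | A ⊆ N ∧ TD T A}
    Set.ncard (Set.toFinite _) ⟨∅, Set.empty_subset _, TD.empty⟩
  refine ⟨A, hA1, hA2, fun φ hφ hsub => ?_⟩
  have hd : Disjoint A (copyE T φ) := Set.disjoint_left.2 fun e h h' => (hsub h').2 h
  have := hmax (A ∪ copyE T φ)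
    ⟨Set.union_subset hA1 (hsub.trans Set.sdiff_subset), TD.add _ _ hφ hd hA2⟩
  rw [Set.ncard_union_eq hd (Set.toFinite _) (Set.toFinite _), copyE_ncard φ hφ] at this
  omega

theorem orient {V W : Type} [Fintype V] [Fintype W] {T : SimpleGraph W} (hT : T.IsTree)
    (hc : 4 < Fintype.card W) (B : Set (Sym2 V)) (hl : ∀ v, s(v, v) ∉ B)
    (hfree : ∀ φ : W → V, Function.Injective φ → ¬ copyE T φ ⊆ B) :
    ∃ J : V → Finset V, (∀ u, (J u).card ≤ Fintype.card W) ∧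
      (∀ u v, v ∈ J u → s(u, v) ∈ B) ∧ (∀ u v, v ∈ J u → u ∉ J v) ∧
      (∀ u v, s(u, v) ∈ B → v ∈ J u ∨ u ∈ J v) := by
  have key : ∀ (n : ℕ) (U : Finset V), U.card = n → ∃ J : V → Finset V,
      (∀ u, (J u).card ≤ Fintype.card W) ∧
      (∀ u v, v ∈ J u → u ∈ U ∧ v ∈ U ∧ s(u, v) ∈ B) ∧ (∀ u v, v ∈ J u → u ∉ J v) ∧
      (∀ u ∈ U, ∀ v ∈ U, s(u, v) ∈ B → v ∈ J u ∨ u ∈ J v) := by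
    intro n
    induction n with
    | zero =>
      intro U hU
      rw [Finset.card_eq_zero] at hU
      subst hU
      exact ⟨fun _ => ∅, by simp, by simp, by simp, by simp⟩
    | succ n ih =>
      intro U hU
      have hne : U.Nonempty := Finset.card_pos.1 (by omega)
      obtain ⟨y, hy, hlt⟩ : ∃ y ∈ U, (U.filter (fun z => s(y, z) ∈ B)).card < Fintype.card W := by
        by_contra hcon
        push Not at hcon
        obtain ⟨φ, h1, h2⟩ := embed_min hT hc B U hne (fun y hy =>
          ⟨U.filter (fun z => s(y, z) ∈ B), Finset.filter_subset _ _, hcon y hy,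
            fun z hz => (Finset.mem_filter.1 hz).2⟩)
        exact hfree φ h1 h2
      obtain ⟨J, j1, j2, j3, j4⟩ := ih (U.erase y) (by rw [Finset.card_erase_of_mem hy]; omega)
      refine ⟨fun u => if u = y then U.filter (fun z => s(y, z) ∈ B) else J u, ?_, ?_, ?_, ?_⟩
      · intro u
        dsimp only
        split_ifs
        · exact hlt.le
        · exact j1 u
      · intro u v huv
        dsimp only at huv
        split_ifs at huv with h
        · rw [Finset.mem_filter] at huv
          subst h
          exact ⟨hy, huv⟩
        · obtain ⟨a, b, c⟩ := j2 u v huv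
          exact ⟨Finset.mem_of_mem_erase a, Finset.mem_of_mem_erase b, c⟩
      · intro u v huv hvu
        dsimp only at huv hvu
        split_ifs at huv hvu with h h' h'
        · rw [Finset.mem_filter] at huv
          subst h h'
          exact hl _ huv.2
        · obtain ⟨a, b, c⟩ := j2 v u hvu
          exact Finset.ne_of_mem_erase b h
        · obtain ⟨a, b, c⟩ := j2 u v huv
          exact Finset.ne_of_mem_erase b h'
        · exact j3 u v huv hvu
      · intro u hu v hv huv
        dsimp only
        by_cases h : u = y
        · left
          rw [if_pos h, Finset.mem_filter]
          exact ⟨hv, h ▸ huv⟩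
        · by_cases h' : v = y
          · right
            rw [if_pos h', Finset.mem_filter]
            refine ⟨hu, ?_⟩
            rw [Sym2.eq_swap, ← h']
            exact huv
          · rw [if_neg h, if_neg h']
            exact j4 u (Finset.mem_erase.2 ⟨h, hu⟩) v (Finset.mem_erase.2 ⟨h', hv⟩) huv
  obtain ⟨J, h1, h2, h3, h4⟩ := key _ Finset.univ rfl
  exact ⟨J, h1, fun u v h => (h2 u v h).2.2, h3, fun u v h => h4 u (by simp) v (by simp) h⟩

end

section
open scoped Classical

/-- Every bounded system of demands can be completed to edge-disjoint copies of `T` using arcs. -/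
def CanSupply (V : Type) {W : Type} [Fintype W] (T : SimpleGraph W) (d : ℕ) : Prop :=
  ∀ (out J : V → Finset V), (∀ u, (J u).card ≤ Fintype.card W) →
    (∀ u v, v ∈ out u → u ∉ out v) → (∀ u, d ≤ (out u).card) →
    (∀ u v, v ∈ J u → u ≠ v ∧ ¬ IsArc out s(u, v)) →
    ∃ φ : V → V → W → V, (∀ u v, v ∈ J u → Function.Injective (φ u v) ∧
        (∀ e ∈ copyE T (φ u v), e = s(u, v) ∨ IsArc out e) ∧ s(u, v) ∈ copyE T (φ u v)) ∧
      (∀ u v u' v', v ∈ J u → v' ∈ J u' → (u, v) ≠ (u', v') →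
        ∀ e, IsArc out e → e ∈ copyE T (φ u v) → e ∉ copyE T (φ u' v'))

theorem canSupply_of {V W : Type} [Fintype W] {T : SimpleGraph W} (out J : V → Finset V)
    (F : V → V → Set (Sym2 V))
    (hF1 : ∀ u v, v ∈ J u → (∀ e ∈ F u v, IsArc out e) ∧ ∃ φ : W → V, Function.Injective φ ∧
      copyE T φ ⊆ insert s(u, v) (F u v) ∧ s(u, v) ∈ copyE T φ)
    (hF2 : ∀ u k u' k', k ∈ J u → k' ∈ J u' → (u, k) ≠ (u', k') → Disjoint (F u k) (F u' k'))
    (hJ : ∀ u v, v ∈ J u → u ≠ v ∧ ¬ IsArc out s(u, v)) :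
    ∃ φ : V → V → W → V, (∀ u v, v ∈ J u → Function.Injective (φ u v) ∧
        (∀ e ∈ copyE T (φ u v), e = s(u, v) ∨ IsArc out e) ∧ s(u, v) ∈ copyE T (φ u v)) ∧
      (∀ u v u' v', v ∈ J u → v' ∈ J u' → (u, v) ≠ (u', v') →
        ∀ e, IsArc out e → e ∈ copyE T (φ u v) → e ∉ copyE T (φ u' v')) := by
  have h : ∀ u v, ∃ φ : W → V, v ∈ J u → Function.Injective φ ∧
      copyE T φ ⊆ insert s(u, v) (F u v) ∧ s(u, v) ∈ copyE T φ := by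
    intro u v
    by_cases hv : v ∈ J u
    · obtain ⟨φ, hφ⟩ := (hF1 u v hv).2
      exact ⟨φ, fun _ => hφ⟩
    · exact ⟨fun _ => u, fun h => absurd h hv⟩
  choose φ hφ using h
  refine ⟨φ, ?_, ?_⟩
  · intro u v hv
    obtain ⟨h1, h2, h3⟩ := hφ u v hv
    refine ⟨h1, fun e he => ?_, h3⟩
    rcases h2 he with h | h
    · exact Or.inl h
    · exact Or.inr ((hF1 u v hv).1 e h)
  · intro u v u' v' hv hv' hne e harc he he'
    have h1 : e ∈ F u v := by
      rcases (hφ u v hv).2.1 he with h | h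
      · rw [h] at harc; exact absurd harc (hJ u v hv).2
      · exact h
    have h2 : e ∈ F u' v' := by
      rcases (hφ u' v' hv').2.1 he' with h | h
      · rw [h] at harc; exact absurd harc (hJ u' v' hv').2
      · exact h
    exact Set.disjoint_left.1 (hF2 u v u' v' hv hv' hne) h1 h2

theorem canSupply_gen (V : Type) [Fintype V] {W : Type} [Fintype W] (T : SimpleGraph W)
    (hT : T.IsTree) (hc : 4 < Fintype.card W) (d : ℕ)
    (hd : need (Fintype.card W) (Fintype.card W) (Fintype.card W) ≤ d) : CanSupply V T d := by
  intro out J hJ anti hout hJ2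
  obtain ⟨F, hF1, hF2⟩ := supply (V := V) (Fintype.card W) (by omega) (Fintype.card W)
    (Fintype.card W) V J hJ out anti (fun u => hd.trans (hout u))
  refine canSupply_of out J F (fun u v hv => ⟨(hF1 u v hv).1, ?_⟩) hF2 hJ2
  exact embed_rich hT hc (F u v) u v (hJ2 u v hv).1 (hF1 u v hv).2

theorem canSupply_three (V : Type) [Fintype V] {W : Type} [Fintype W] (T : SimpleGraph W)
    (hT : T.IsTree) (hc : 4 < Fintype.card W) (hdi : ∀ u v : W, T.dist u v ≤ 3) (d : ℕ)
    (hd : Fintype.card W * Fintype.card W + Fintype.card W + Fintype.card W * Fintype.card W ≤ d) :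
    CanSupply V T d := by
  intro out J hJ anti hout hJ2
  obtain ⟨F, hF1, hF2⟩ := supply3 (V := V) (Fintype.card W) (Fintype.card W) (by omega)
    J hJ out anti (fun u => hd.trans (hout u))
  refine canSupply_of out J F (fun u v hv => ⟨(hF1 u v hv).1, ?_⟩) hF2 hJ2
  obtain ⟨h1, ⟨y, hy, C1, hC1, hF3⟩, C2, hC2, hF4⟩ := hF1 u v hv
  refine embed_three hT hc hdi (F u v) u v y (hJ2 u v hv).1 ?_ ?_ hy C1 C2 hC1 hC2 hF3 hF4
  · rintro rfl
    obtain ⟨a, b, hb, heq⟩ := h1 _ hy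
    have hab : a = b := by
      rcases Sym2.eq_iff.1 heq with ⟨h, h'⟩ | ⟨h, h'⟩ <;> rw [← h, ← h']
    subst hab
    exact anti _ _ hb hb
  · rintro rfl
    exact (hJ2 u y hv).2 (h1 _ hy)

/-- Orienting connected edge-disjoint classes towards distinct roots. -/
theorem out_arcs {V : Type} [Fintype V] (n : ℕ) (hn : n ≤ Fintype.card V)
    (c : Fin n → Finset (Sym2 V)) (hdis : ∀ i j, i ≠ j → Disjoint (c i) (c j))
    (hconn : ∀ i, (SimpleGraph.fromEdgeSet (c i : Set (Sym2 V))).Connected) :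
    ∃ out : V → Finset V, (∀ u v, v ∈ out u → u ∉ out v) ∧ (∀ u, n - 1 ≤ (out u).card) ∧
      ∀ e, IsArc out e → ∃ i, e ∈ c i := by
  obtain ⟨r⟩ : Nonempty (Fin n ↪ V) :=
    Function.Embedding.nonempty_of_card_le (by simpa using hn)
  have h := fun i => conn_parent (hconn i) (r i)
  choose! par hpar using h
  have hadj : ∀ i w, w ≠ r i → s(w, par i w) ∈ c i := by
    intro i w hw
    have := (hpar i w hw).1
    rw [SimpleGraph.fromEdgeSet_adj] at this
    exact this.1
  have huniq : ∀ i j e, e ∈ c i → e ∈ c j → i = j := by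
    intro i j e h1 h2
    by_contra hne
    exact Finset.disjoint_left.1 (hdis i j hne) h1 h2
  have hmem : ∀ u v, v ∈ (Finset.univ.filter (fun j => u ≠ r j)).image (fun j => par j u) →
      ∃ j, u ≠ r j ∧ par j u = v := by
    intro u v h
    obtain ⟨j, hj, h2⟩ := Finset.mem_image.1 h
    exact ⟨j, (Finset.mem_filter.1 hj).2, h2⟩
  refine ⟨fun v => (Finset.univ.filter (fun j => v ≠ r j)).image (fun j => par j v), ?_, ?_, ?_⟩
  · intro u v huv hvu
    obtain ⟨j, hj, hj2⟩ := hmem u v huv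
    obtain ⟨i, hi, hi2⟩ := hmem v u hvu
    have h1 := hadj j u hj
    have h2 := hadj i v hi
    rw [hj2] at h1
    rw [hi2, Sym2.eq_swap] at h2
    have := huniq i j _ h2 h1
    subst this
    have h3 := (hpar i u hj).2
    have h4 := (hpar i v hi).2
    rw [hj2] at h3
    rw [hi2] at h4
    omega
  · intro u
    dsimp only
    rw [Finset.card_image_of_injOn]
    · have h1 : (Finset.univ.filter (fun j => u = r j)).card ≤ 1 := by
        rw [Finset.card_le_one]
        intro a ha b hb
        exact r.injective ((Finset.mem_filter.1 ha).2.symm.trans (Finset.mem_filter.1 hb).2)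
      have h2 := Finset.card_filter_add_card_filter_not (s := (Finset.univ : Finset (Fin n)))
        (fun j => u = r j)
      rw [Finset.card_univ, Fintype.card_fin] at h2
      show n - 1 ≤ (Finset.univ.filter (fun j => ¬ u = r j)).card
      omega
    · intro i hi j hj hij
      simp only [Finset.coe_filter, Finset.mem_univ, true_and, Set.mem_setOf_eq] at hi hj
      have h1 := hadj i u hi
      have h2 := hadj j u hj
      dsimp only at hij
      rw [← hij] at h2
      exact huniq i j _ h1 h2
  · rintro e ⟨a, b, hb, rfl⟩
    obtain ⟨j, hj, rfl⟩ := hmem a b hb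
    exact ⟨j, hadj j a hj⟩

theorem kconn_of {V : Type} (H : SimpleGraph V) (k : ℕ)
    (c : Fin k → Finset (Sym2 V)) (hdis : ∀ i j, i ≠ j → Disjoint (c i) (c j))
    (hconn : ∀ i, (SimpleGraph.fromEdgeSet (c i : Set (Sym2 V))).Connected)
    (hsub : ∀ i, ∀ e ∈ c i, e ∈ H.edgeSet) : IsKEdgeConnected H k := by
  intro S hS
  obtain ⟨i, hi⟩ : ∃ i, Disjoint (c i) S := by
    by_contra hcon
    push Not at hcon
    have h1 : ∀ i, ∃ e, e ∈ c i ∧ e ∈ S := fun i => Finset.not_disjoint_iff.1 (hcon i)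
    choose f hf1 hf2 using h1
    have h2 : Function.Injective f := by
      intro i j hij
      by_contra hne
      exact Finset.disjoint_left.1 (hdis i j hne) (hf1 i) (hij ▸ hf1 j)
    have h3 : (Finset.univ.image f).card ≤ S.card := Finset.card_le_card (by
      intro e he
      obtain ⟨i, _, rfl⟩ := Finset.mem_image.1 he
      exact hf2 i)
    rw [Finset.card_image_of_injective _ h2, Finset.card_univ, Fintype.card_fin] at h3
    omega
  refine (hconn i).mono ?_
  intro a b hab
  rw [SimpleGraph.fromEdgeSet_adj] at hab
  rw [SimpleGraph.deleteEdges_adj]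
  exact ⟨hsub i _ hab.1, fun h => Finset.disjoint_left.1 hi hab.1 h⟩

theorem main_core {V W : Type} [Fintype V] [Fintype W] (T : SimpleGraph W)
    (hT : T.IsTree) (hc : 4 < Fintype.card W) (G : SimpleGraph V) (X k' : ℕ) (hX : 1 ≤ X)
    (hBip : BipDecompProp T k') (hconn : IsKEdgeConnected G (4 * k' + 16 * X))
    (hdvd : T.edgeSet.ncard ∣ G.edgeSet.ncard) (hsup : CanSupply V T (4 * X - 1)) :
    ∃ D : Set G.Subgraph, IsDecompInto G T D := by
  have hGc : (G.deleteEdges ↑(∅ : Finset (Sym2 V))).Connected := hconn ∅ (by simp; omega)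
  have hne : Nonempty V := hGc.nonempty
  rcases subsingleton_or_nontrivial V with hsub | hnt
  · refine ⟨∅, by simp, by simp, ?_⟩
    simp only [Set.mem_empty_iff_false, Set.iUnion_of_empty, Set.iUnion_empty]
    symm
    rw [Set.eq_empty_iff_forall_notMem]
    intro e
    induction e with
    | _ a b =>
      intro h
      exact G.ne_of_adj h (Subsingleton.elim a b)
  have hE : ∀ e, e ∈ G.edgeFinset ↔ e ∈ G.edgeSet := fun e => SimpleGraph.mem_edgeFinset
  have hcut := cut_of_conn G G.edgeFinset (4 * k' + 16 * X) hE hconn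
  obtain ⟨χ, hχ⟩ := max_cut G.edgeFinset
  generalize hB : G.edgeFinset.filter (Crosses χ) = B at hχ
  have hBmem : ∀ e, e ∈ B ↔ e ∈ G.edgeSet ∧ Crosses χ e := by
    intro e; rw [← hB, Finset.mem_filter, hE]
  obtain ⟨c, hcB, hcd, hcc⟩ := tree_packing (k' + 4 * X) B (by
    intro f ha hb
    have h1 := hcut f ha hb
    have h2 := hχ f
    omega)
  have hVcard : 4 * X ≤ Fintype.card V := by
    obtain ⟨a, b, hab⟩ := exists_pair_ne V
    have h1 := hcut (fun v => decide (v = a)) ⟨a, by simp⟩ ⟨b, by simpa using hab.symm⟩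
    have h2 : G.edgeFinset.filter (Crosses (fun v => decide (v = a))) ⊆
        Finset.univ.image (fun w => s(a, w)) := by
      intro e he
      have h3 := (Finset.mem_filter.1 he).2
      induction e with
      | _ p q =>
        rw [crosses_mk] at h3
        by_cases hp : p = a
        · subst hp; exact Finset.mem_image.2 ⟨q, by simp, rfl⟩
        · by_cases hq : q = a
          · subst hq; exact Finset.mem_image.2 ⟨p, by simp, Sym2.eq_swap⟩
          · simp [hp, hq] at h3
    have h4 := (Finset.card_le_card h2).trans Finset.card_image_le
    rw [Finset.card_univ] at h4
    omega
  obtain ⟨out, anti, hout, harc⟩ := out_arcs (4 * X) hVcard (fun j => c (Fin.natAdd k' j))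
    (fun i j hij => hcd _ _ (fun h => hij (by simpa [Fin.ext_iff] using h))) (fun j => hcc _)
  have harcB : ∀ e, IsArc out e → e ∈ B := by
    intro e he
    obtain ⟨i, hi⟩ := harc e he
    exact hcB _ hi
  -- the inner edges
  have hTpos : 0 < T.edgeSet.ncard := by
    have h1 := hT.card_edgeFinset
    have h2 : T.edgeSet.ncard = T.edgeFinset.card := by
      rw [← SimpleGraph.coe_edgeFinset, Set.ncard_coe_finset]
    omega
  obtain ⟨A, hAN, hA, hfree⟩ := max_TD hTpos (G.edgeSet \ (B : Set (Sym2 V)))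
  obtain ⟨J, hJ1, hJ2, hJ3, hJ4⟩ := orient hT hc ((G.edgeSet \ (B : Set (Sym2 V))) \ A)
    (fun v h => G.loopless.irrefl v h.1.1) hfree
  obtain ⟨φ, hφ1, hφ2⟩ := hsup out J hJ1 anti hout (by
    intro u v huv
    have h1 := hJ2 u v huv
    refine ⟨G.ne_of_adj h1.1.1, fun h => h1.1.2 (harcB _ h)⟩)
  let P : Finset (V × V) := Finset.univ.filter (fun p => p.2 ∈ J p.1)
  have hP : ∀ p, p ∈ P ↔ p.2 ∈ J p.1 := fun p => by simp [P]
  let C : Set (Sym2 V) := ⋃ p ∈ P, copyE T (φ p.1 p.2)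
  have hCmem : ∀ e, e ∈ C ↔ ∃ u v, v ∈ J u ∧ e ∈ copyE T (φ u v) := by
    intro e
    simp only [C, Set.mem_iUnion, hP, Prod.exists, exists_prop]
  have hC : TD T C := by
    refine TD.biUnion (fun p : V × V => copyE T (φ p.1 p.2)) P ?_ ?_
    · intro p hp
      exact TD.copy _ (hφ1 p.1 p.2 ((hP p).1 hp)).1
    · rintro ⟨u, v⟩ hp ⟨u', v'⟩ hp' hne
      have hv : v ∈ J u := (hP _).1 hp
      have hv' : v' ∈ J u' := (hP _).1 hp'
      rw [Set.disjoint_left]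
      intro e he he'
      by_cases ha : IsArc out e
      · exact hφ2 u v u' v' hv hv' hne e ha he he'
      · have h1 := ((hφ1 u v hv).2.1 e he).resolve_right ha
        have h2 := ((hφ1 u' v' hv').2.1 e he').resolve_right ha
        obtain ⟨rfl, rfl⟩ := arc_inj hJ3 hv hv' (h1.symm.trans h2)
        exact hne rfl
  have hCarc : ∀ e ∈ C, e ∈ (G.edgeSet \ (B : Set (Sym2 V))) \ A ∨ IsArc out e := by
    intro e he
    obtain ⟨u, v, hv, he⟩ := (hCmem e).1 he
    rcases (hφ1 u v hv).2.1 e he with rfl | h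
    · exact Or.inl (hJ2 u v hv)
    · exact Or.inr h
  have hAC : Disjoint A C := by
    rw [Set.disjoint_left]
    intro e he he'
    rcases hCarc e he' with h | h
    · exact h.2 he
    · exact (hAN he).2 (harcB e h)
  have hAC2 := hA.union hC hAC
  let B' : Set (Sym2 V) := (B : Set (Sym2 V)) \ C
  have hB'G : ∀ e ∈ B', e ∈ G.edgeSet := fun e he => ((hBmem e).1 he.1).1
  have hdisj : Disjoint (A ∪ C) B' := by
    rw [Set.disjoint_left]
    rintro e (he | he) he'
    · exact (hAN he).2 he'.1
    · exact he'.2 he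
  have hunion : (A ∪ C) ∪ B' = G.edgeSet := by
    ext e
    constructor
    · rintro ((he | he) | he)
      · exact (hAN he).1
      · rcases hCarc e he with h | h
        · exact h.1.1
        · exact ((hBmem e).1 (harcB e h)).1
      · exact hB'G e he
    · intro he
      by_cases heC : e ∈ C
      · exact Or.inl (Or.inr heC)
      by_cases heB : e ∈ B
      · exact Or.inr ⟨heB, heC⟩
      by_cases heA : e ∈ A
      · exact Or.inl (Or.inl heA)
      exfalso
      apply heC
      induction e with
      | _ a b =>
        rcases hJ4 a b ⟨⟨he, heB⟩, heA⟩ with h | h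
        · exact (hCmem _).2 ⟨a, b, h, (hφ1 a b h).2.2⟩
        · refine (hCmem _).2 ⟨b, a, h, ?_⟩
          rw [Sym2.eq_swap]
          exact (hφ1 b a h).2.2
  let H : SimpleGraph V := SimpleGraph.fromEdgeSet B'
  have hHE : H.edgeSet = B' := by
    rw [SimpleGraph.edgeSet_fromEdgeSet]
    ext e
    constructor
    · exact fun h => h.1
    · refine fun h => ⟨h, fun hd => ?_⟩
      exact G.not_isDiag_of_mem_edgeSet (hB'G e h) hd
  have hcol : H.Colorable 2 := by
    have h1 : H.Coloring Bool := SimpleGraph.Coloring.mk χ (by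
      intro a b hab
      have h2 : s(a, b) ∈ B' := by rw [← hHE]; exact hab
      exact (crosses_mk χ a b).1 ((hBmem _).1 h2.1).2)
    simpa using h1.colorable
  have hHk : IsKEdgeConnected H k' := by
    refine kconn_of H k' (fun i => c (Fin.castAdd (4 * X) i))
      (fun i j hij => hcd _ _ (fun h => hij (by simpa [Fin.ext_iff] using h)))
      (fun i => hcc _) ?_
    intro i e he
    rw [hHE]
    refine ⟨hcB _ he, fun heC => ?_⟩
    rcases hCarc e heC with h | h
    · exact h.1.2 (hcB _ he)
    · obtain ⟨j, hj⟩ := harc e h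
      refine Finset.disjoint_left.1 (hcd _ _ ?_) he hj
      intro heq
      have h5 := congrArg Fin.val heq
      simp only [Fin.val_castAdd, Fin.val_natAdd] at h5
      have := i.isLt
      omega
  have hHd : T.edgeSet.ncard ∣ H.edgeSet.ncard := by
    rw [hHE]
    rw [← hunion, Set.ncard_union_eq hdisj (Set.toFinite _) (Set.toFinite _)] at hdvd
    exact (Nat.dvd_add_right hAC2.dvd).1 hdvd
  obtain ⟨D, hD⟩ := hBip V H hcol hHk hHd
  have hTD := decomp_TD hD
  rw [hHE] at hTD
  have hfin := hAC2.union hTD hdisj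
  rw [hunion] at hfin
  exact hfin.decomp subset_rfl

theorem arith_gen (t : ℕ) (ht : 4 < t) : need t t t ≤ 4 * (t - 1) ^ (6 * t - 5) - 1 := by
  have h1 := need_le t (by omega) t t
  obtain ⟨s, rfl⟩ : ∃ s, t = s + 5 := ⟨t - 5, by omega⟩
  have e1 : s + 5 - 1 = s + 4 := by omega
  rw [e1]
  have h2 : 2 * (s + 5) ^ 2 ≤ (s + 4) ^ 3 := by nlinarith [Nat.zero_le s, Nat.zero_le (s ^ 2), Nat.zero_le (s ^ 3)]
  have h3 : s + 5 + 1 ≤ (s + 4) ^ 2 := by nlinarith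
  have h4 : (2 * (s + 5) ^ 2) ^ (s + 5) * (s + 5 + 1) ≤ ((s + 4) ^ 3) ^ (s + 5) * (s + 4) ^ 2 :=
    Nat.mul_le_mul (Nat.pow_le_pow_left h2 _) h3
  have h5 : ((s + 4) ^ 3) ^ (s + 5) * (s + 4) ^ 2 ≤ (s + 4) ^ (6 * (s + 5) - 5) := by
    rw [← pow_mul, ← pow_add]
    exact Nat.pow_le_pow_right (by omega) (by omega)
  omega

theorem arith_three (t : ℕ) (ht : 4 < t) : t * t + t + t * t ≤ 4 * (t * (t - 1)) - 1 := by
  obtain ⟨s, rfl⟩ : ∃ s, t = s + 5 := ⟨t - 5, by omega⟩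
  have e1 : s + 5 - 1 = s + 4 := by omega
  rw [e1]
  apply Nat.le_sub_of_add_le
  nlinarith

end

/-- The equivalence theorem with the explicit bounds. -/
theorem bipartite_decomposition_conjecture_equivalence
    {W : Type} [Fintype W] (T : SimpleGraph W) (t : ℕ)
    (hcard : Fintype.card W = t) (ht : 4 < t) (htree : T.IsTree) :
    ((∃ k', BipDecompProp T k') ↔ (∃ k, DecompProp T k)) ∧
    (∀ k', BipDecompProp T k' →
      DecompProp T (4 * k' + 16 * (t - 1) ^ (6 * t - 5))) ∧
    ((∀ u v : W, T.dist u v ≤ 3) → ∀ k', BipDecompProp T k' →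
      DecompProp T (4 * k' + 16 * t * (t - 1))) := by
  subst hcard
  have hgen : ∀ k', BipDecompProp T k' → DecompProp T
      (4 * k' + 16 * (Fintype.card W - 1) ^ (6 * Fintype.card W - 5)) := by
    intro k' hk V _ G hconn hdvd
    exact main_core T htree ht G _ k' (Nat.one_le_pow _ _ (by omega)) hk hconn hdvd
      (canSupply_gen V T htree ht _ (arith_gen _ ht))
  refine ⟨⟨fun ⟨k', hk⟩ => ⟨_, hgen k' hk⟩, fun ⟨k, hk⟩ => ⟨k, fun V _ G _ h1 h2 => hk V G h1 h2⟩⟩,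
    hgen, ?_⟩
  intro hd k' hk V _ G hconn hdvd
  rw [Nat.mul_assoc] at hconn
  exact main_core T htree ht G _ k' (Nat.mul_pos (by omega) (by omega)) hk hconn hdvd
    (canSupply_three V T htree ht hd _ (arith_three _ ht))
end

section
/- Let k ≥ 3 be an odd natural number and let G be a (3k−3)-edge-connected finite graph. Let p : V(G) → {0, 1, …, k−1} be a function such that the sum of p(v) over all vertices v of G is congruent to |E(G)| modulo k. Then there exists an orientation O of the edges of G such that the outdegree d⁺_O(v) is congruent to p(v) modulo k for every vertex v of G. -/
open SimpleGraph

namespace LTWZ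

/-- Distance of `n` to the multiples of `2k`. -/
def N (k : ℕ) (n : ℤ) : ℤ := |Int.bmod n (2 * k)|

theorem N_ex (k : ℕ) (n : ℤ) : ∃ z : ℤ, N k n = |n - 2 * k * z| := by
  refine ⟨Int.bdiv n (2 * k), ?_⟩
  have h := Int.bmod_add_bdiv n (2 * k)
  unfold N
  congr 1
  push_cast at h
  linarith

theorem N_le_k (k : ℕ) (hk : 1 ≤ k) (n : ℤ) : N k n ≤ k := by
  unfold N
  have h1 := @Int.bmod_lt n (2 * k) (by omega)
  have h2 := @Int.le_bmod n (2 * k) (by omega)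
  rw [abs_le]
  push_cast at h1 h2
  constructor <;> omega

theorem N_nonneg (k : ℕ) (n : ℤ) : 0 ≤ N k n := abs_nonneg _

theorem N_le (k : ℕ) (hk : 1 ≤ k) (n z : ℤ) : N k n ≤ |n - 2 * k * z| := by
  obtain ⟨w, hw⟩ := N_ex k n
  have h1 := N_le_k k hk n
  rcases eq_or_ne w z with h | h
  · rw [hw, h]
  · by_contra hlt
    push Not at hlt
    have h2 : |2 * (k : ℤ) * (w - z)| < 2 * k := by
      have : 2 * (k : ℤ) * (w - z) = (n - 2 * k * z) - (n - 2 * k * w) := by ring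
      rw [this]
      calc _ ≤ |n - 2 * k * z| + |n - 2 * k * w| := abs_sub _ _
        _ < 2 * k := by rw [← hw]; linarith
    rw [abs_mul, abs_of_nonneg (by positivity : (0 : ℤ) ≤ 2 * k)] at h2
    have h3 : 1 ≤ |w - z| := Int.one_le_abs (sub_ne_zero.mpr h)
    have : (1 : ℤ) ≤ k := by exact_mod_cast hk
    nlinarith

theorem N_congr (k : ℕ) (hk : 1 ≤ k) {a b : ℤ} (h : (2 * k : ℤ) ∣ a - b) : N k a = N k b := by
  obtain ⟨q, hq⟩ := h
  apply le_antisymm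
  · obtain ⟨z, hz⟩ := N_ex k b
    rw [hz]
    refine (N_le k hk a (z + q)).trans (le_of_eq ?_)
    congr 1; linear_combination hq
  · obtain ⟨z, hz⟩ := N_ex k a
    rw [hz]
    refine (N_le k hk b (z - q)).trans (le_of_eq ?_)
    congr 1; linear_combination -hq

theorem N_add (k : ℕ) (hk : 1 ≤ k) (a b : ℤ) : N k (a + b) ≤ N k a + N k b := by
  obtain ⟨z, hz⟩ := N_ex k a
  obtain ⟨w, hw⟩ := N_ex k b
  rw [hz, hw]
  refine (N_le k hk _ (z + w)).trans ?_
  refine le_trans (le_of_eq ?_) (abs_add_le _ _)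
  congr 1; ring

theorem N_le_abs (k : ℕ) (hk : 1 ≤ k) (a : ℤ) : N k a ≤ |a| := by
  simpa using N_le k hk a 0

theorem N_neg (k : ℕ) (hk : 1 ≤ k) (a : ℤ) : N k (-a) = N k a := by
  apply le_antisymm
  · obtain ⟨z, hz⟩ := N_ex k a
    rw [hz, abs_sub_comm]
    refine (N_le k hk _ (-z)).trans (le_of_eq ?_)
    congr 1; ring
  · obtain ⟨z, hz⟩ := N_ex k (-a)
    rw [hz, abs_sub_comm]
    refine (N_le k hk _ (-z)).trans (le_of_eq ?_)
    congr 1; ring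

theorem N_shift (k : ℕ) (hk : 1 ≤ k) (a d : ℤ) : N k (a + d) ≤ N k a + |d| :=
  (N_add k hk a d).trans (by have := N_le_abs k hk d; linarith)

theorem N_par (k : ℕ) (n : ℤ) : (2 : ℤ) ∣ N k n - n := by
  obtain ⟨z, hz⟩ := N_ex k n
  rw [hz]
  rcases abs_choice (n - 2 * k * z) with h | h <;> rw [h]
  · exact ⟨-(k * z), by ring⟩
  · exact ⟨k * z - n, by ring⟩

theorem N_self (k : ℕ) (hk : 1 ≤ k) (n : ℤ) (h : |n| ≤ k) : N k n = |n| := by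
  apply le_antisymm (N_le_abs k hk n)
  obtain ⟨z, hz⟩ := N_ex k n
  rw [hz]
  rcases eq_or_ne z 0 with h0 | h0
  · simp [h0]
  · have h3 : 1 ≤ |z| := Int.one_le_abs h0
    have h4 : |2 * (k : ℤ) * z| = 2 * k * |z| := by
      rw [abs_mul, abs_of_nonneg (by positivity : (0 : ℤ) ≤ 2 * k)]
    have h5 : |2 * (k : ℤ) * z| ≤ |n - 2 * k * z| + |n| := by
      have h6 := abs_sub (n - 2 * (k : ℤ) * z) n
      have h7 : n - 2 * (k : ℤ) * z - n = -(2 * k * z) := by ring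
      rw [h7, abs_neg] at h6
      exact h6
    nlinarith

set_option linter.unusedSectionVars false

variable {V : Type} [DecidableEq V]

/-- Indicator of an edge crossing the boundary of `A`. -/
def cross (A : Finset V) : Sym2 V → ℤ :=
  Sym2.lift ⟨fun x y => if (x ∈ A ↔ y ∈ A) then 0 else 1, fun x y => by simp [iff_comm]⟩

theorem cross_mk (A : Finset V) (x y : V) :
    cross A s(x, y) = if (x ∈ A ↔ y ∈ A) then 0 else 1 := rfl

def cut (L : Multiset (Sym2 V)) (A : Finset V) : ℤ := (L.map (cross A)).sum

@[simp] theorem cut_cons (e : Sym2 V) (L : Multiset (Sym2 V)) (A : Finset V) :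
    cut (e ::ₘ L) A = cross A e + cut L A := by simp [cut]

@[simp] theorem cut_add (L M : Multiset (Sym2 V)) (A : Finset V) :
    cut (L + M) A = cut L A + cut M A := by simp [cut]

@[simp] theorem cut_zero (A : Finset V) : cut (0 : Multiset (Sym2 V)) A = 0 := by simp [cut]

theorem cut_nonneg (L : Multiset (Sym2 V)) (A : Finset V) : 0 ≤ cut L A := by
  induction L using Multiset.induction_on with
  | empty => simp
  | cons e L ih =>
    rw [cut_cons]
    induction e with
    | h x y => rw [cross_mk]; split_ifs <;> omega

def outd (D : Multiset (V × V)) (x : V) : ℤ := (D.map fun e => if e.1 = x then (1 : ℤ) else 0).sum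
def ind (D : Multiset (V × V)) (x : V) : ℤ := (D.map fun e => if e.2 = x then (1 : ℤ) else 0).sum

@[simp] theorem outd_cons (e : V × V) (D : Multiset (V × V)) (x : V) :
    outd (e ::ₘ D) x = (if e.1 = x then 1 else 0) + outd D x := by simp [outd]
@[simp] theorem ind_cons (e : V × V) (D : Multiset (V × V)) (x : V) :
    ind (e ::ₘ D) x = (if e.2 = x then 1 else 0) + ind D x := by simp [ind]
@[simp] theorem outd_add (D E : Multiset (V × V)) (x : V) :
    outd (D + E) x = outd D x + outd E x := by simp [outd]
@[simp] theorem ind_add (D E : Multiset (V × V)) (x : V) :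
    ind (D + E) x = ind D x + ind E x := by simp [ind]
@[simp] theorem outd_zero (x : V) : outd (0 : Multiset (V × V)) x = 0 := by simp [outd]
@[simp] theorem ind_zero (x : V) : ind (0 : Multiset (V × V)) x = 0 := by simp [ind]

theorem outd_nonneg (D : Multiset (V × V)) (x : V) : 0 ≤ outd D x := by
  induction D using Multiset.induction_on with
  | empty => simp
  | cons e L ih => rw [outd_cons]; split_ifs <;> omega

theorem ind_nonneg (D : Multiset (V × V)) (x : V) : 0 ≤ ind D x := by
  induction D using Multiset.induction_on with
  | empty => simp
  | cons e L ih => rw [ind_cons]; split_ifs <;> omega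

/-- underlying undirected edges -/
def und (D : Multiset (V × V)) : Multiset (Sym2 V) := D.map fun e => s(e.1, e.2)

@[simp] theorem und_cons (e : V × V) (D : Multiset (V × V)) :
    und (e ::ₘ D) = s(e.1, e.2) ::ₘ und D := by simp [und]
@[simp] theorem und_add (D E : Multiset (V × V)) : und (D + E) = und D + und E := by simp [und]
@[simp] theorem und_zero : und (0 : Multiset (V × V)) = 0 := by simp [und]

def Ori (k : ℕ) (S : Finset V) (L : Multiset (Sym2 V)) (c : V → ℤ) : Prop :=
  ∃ D : Multiset (V × V), und D = L ∧ ∀ x ∈ S, (2 * k : ℤ) ∣ outd D x - ind D x - c x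

def sl (k : ℕ) (L : Multiset (Sym2 V)) (c o i : V → ℤ) (A : Finset V) : ℤ :=
  cut L A + ∑ x ∈ A, (o x + i x) - (2 * k - 2) - N k (∑ x ∈ A, (c x - o x + i x))

structure Inst (k : ℕ) (S : Finset V) (L : Multiset (Sym2 V)) (c o i : V → ℤ)
    (X : Finset V) : Prop where
  ne : S.Nonempty
  hL : ∀ e ∈ L, ¬ e.IsDiag ∧ ∀ v ∈ e, v ∈ S
  ho : ∀ x, 0 ≤ o x
  hi : ∀ x, 0 ≤ i x
  par : ∀ A ⊆ S, (2 : ℤ) ∣ ∑ x ∈ A, c x - cut L A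
  sum : (2 * k : ℤ) ∣ ∑ x ∈ S, c x
  z0 : ∑ x ∈ S, (o x + i x) ≤ 2 * k - 2 + N k (∑ x ∈ S, (c x - o x + i x))
  XS : X ⊆ S
  Xc : X.card ≤ 1
  XN : ∀ v ∈ X, N k (c v - o v + i v) = 0
  cond : ∀ A ⊆ S, A.Nonempty → A ≠ S → A ≠ X → 0 ≤ sl k L c o i A

def IH (k : ℕ) (S : Finset V) (L : Multiset (Sym2 V)) (o i : V → ℤ) : Prop :=
  ∀ (S' : Finset V) (L' : Multiset (Sym2 V)) (c' o' i' : V → ℤ) (X' : Finset V),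
    Inst k S' L' c' o' i' X' →
    (S'.card < S.card ∨ S'.card = S.card ∧ (L'.card < L.card ∨ L'.card = L.card ∧
      ∑ x ∈ S', (o' x + i' x) < ∑ x ∈ S, (o x + i x))) → Ori k S' L' c'

theorem sl_even {k : ℕ} {S : Finset V} {L : Multiset (Sym2 V)} {c o i : V → ℤ} {X : Finset V}
    (H : Inst k S L c o i X) {A : Finset V} (hA : A ⊆ S) : (2 : ℤ) ∣ sl k L c o i A := by
  have h1 := H.par A hA
  have h2 := N_par k (∑ x ∈ A, (c x - o x + i x))
  unfold sl
  simp only [Finset.sum_add_distrib, Finset.sum_sub_distrib] at h2 ⊢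
  omega

/-- pulling back an orientation along a vertex map -/
theorem pullback (π : V → V) (L : Multiset (Sym2 V)) : ∀ D' : Multiset (V × V),
    und D' = L.map (Sym2.map π) →
    ∃ D : Multiset (V × V), und D = L ∧ D.map (Prod.map π π) = D' := by
  induction L using Multiset.induction_on with
  | empty =>
    intro D' h
    simp only [und, Multiset.map_zero, Multiset.map_eq_zero] at h
    exact ⟨0, by simp, by simp [h]⟩
  | cons e L ih =>
    intro D' h
    rw [Multiset.map_cons] at h
    have hm : Sym2.map π e ∈ und D' := by rw [h]; simp
    obtain ⟨⟨a, b⟩, hab, he⟩ := Multiset.mem_map.mp hm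
    obtain ⟨D1, rfl⟩ := Multiset.exists_cons_of_mem hab
    rw [und_cons, he, Multiset.cons_inj_right] at h
    obtain ⟨D, hD, hD'⟩ := ih D1 h
    induction e with
    | h x y =>
      simp only [Sym2.map_mk] at he
      rw [Sym2.eq_iff] at he
      rcases he with ⟨h1, h2⟩ | ⟨h1, h2⟩
      · exact ⟨(x, y) ::ₘ D, by simp [hD], by simp [hD', h1, h2]⟩
      · exact ⟨(y, x) ::ₘ D, by simp [hD, Sym2.eq_swap], by simp [hD', h1, h2]⟩

theorem outd_map (π : V → V) (D : Multiset (V × V)) (S : Finset V)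
    (hS : ∀ e ∈ D, e.1 ∈ S ∧ e.2 ∈ S) (x : V) :
    outd (D.map (Prod.map π π)) x = ∑ y ∈ S with π y = x, outd D y := by
  induction D using Multiset.induction_on with
  | empty => simp
  | cons e D ih =>
    rw [Multiset.map_cons, outd_cons, ih (fun e he => hS e (Multiset.mem_cons_of_mem he))]
    have := hS e (Multiset.mem_cons_self _ _)
    simp [Finset.sum_add_distrib, this.1]

theorem ind_map (π : V → V) (D : Multiset (V × V)) (S : Finset V)
    (hS : ∀ e ∈ D, e.1 ∈ S ∧ e.2 ∈ S) (x : V) :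
    ind (D.map (Prod.map π π)) x = ∑ y ∈ S with π y = x, ind D y := by
  induction D using Multiset.induction_on with
  | empty => simp
  | cons e D ih =>
    rw [Multiset.map_cons, ind_cons, ih (fun e he => hS e (Multiset.mem_cons_of_mem he))]
    have := hS e (Multiset.mem_cons_self _ _)
    simp [Finset.sum_add_distrib, this.2]

theorem exists_split (L : Multiset (Sym2 V)) (P : Sym2 V → Prop) :
    ∃ L1 L2, L = L1 + L2 ∧ (∀ e ∈ L1, P e) ∧ (∀ e ∈ L2, ¬ P e) := by
  classical
  refine ⟨L.filter P, L.filter (fun e => ¬ P e), (Multiset.filter_add_not P L).symm, ?_, ?_⟩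
  · intro e he; exact (Multiset.mem_filter.mp he).2
  · intro e he; exact (Multiset.mem_filter.mp he).2

theorem cut_map (π : V → V) (S : Finset V) (L : Multiset (Sym2 V)) (B : Finset V)
    (hL : ∀ e ∈ L, ∀ v ∈ e, v ∈ S) :
    cut (L.map (Sym2.map π)) B = cut L (S.filter fun y => π y ∈ B) := by
  unfold cut
  rw [Multiset.map_map]
  congr 1
  apply Multiset.map_congr rfl
  intro e he
  have := hL e he
  induction e with
  | h x y =>
    have hx := this x (by simp)
    have hy := this y (by simp)
    simp [cross_mk, hx, hy]

theorem cut_eq_zero (L : Multiset (Sym2 V)) (B : Finset V)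
    (h : ∀ e ∈ L, ∀ x y, e = s(x, y) → (x ∈ B ↔ y ∈ B)) : cut L B = 0 := by
  induction L using Multiset.induction_on with
  | empty => simp
  | cons e L ih =>
    rw [cut_cons, ih (fun e he => h e (Multiset.mem_cons_of_mem he))]
    have := h e (Multiset.mem_cons_self _ _)
    induction e with
    | h x y => rw [cross_mk, if_pos (this x y rfl)]; rfl

theorem mem_und {D : Multiset (V × V)} {e : V × V} (h : e ∈ D) : s(e.1, e.2) ∈ und D :=
  Multiset.mem_map.mpr ⟨e, h, rfl⟩

theorem contract {k : ℕ} {S : Finset V} {L : Multiset (Sym2 V)} {c o i : V → ℤ}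
    {X : Finset V} (H : Inst k S L c o i X) (ih : IH k S L o i) {A : Finset V} (hA : A ⊆ S)
    (hA2 : 2 ≤ A.card) {Lin Lout : Multiset (Sym2 V)} (hLL : L = Lin + Lout)
    (hin : ∀ e ∈ Lin, ∀ v ∈ e, v ∈ A) (hout : ∀ e ∈ Lout, ¬ ∀ v ∈ e, v ∈ A) :
    ∃ D, und D = Lout ∧ (∀ x ∈ S \ A, (2 * k : ℤ) ∣ outd D x - ind D x - c x) ∧
      (2 * k : ℤ) ∣ ∑ x ∈ A, (outd D x - ind D x) - ∑ x ∈ A, c x := by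
  obtain ⟨a, ha⟩ : A.Nonempty := Finset.card_pos.mp (by omega)
  set π : V → V := fun x => if x ∈ A then a else x with hπ
  have hπA : ∀ x ∈ A, π x = a := fun x hx => by simp [hπ, hx]
  have hπn : ∀ x, x ∉ A → π x = x := fun x hx => by simp [hπ, hx]
  have hLS : ∀ e ∈ Lout, ∀ v ∈ e, v ∈ S := fun e he =>
    (H.hL e (by rw [hLL]; exact Multiset.mem_add.mpr (Or.inr he))).2
  have key : ∀ (g : V → ℤ) (B : Finset V), ∑ x ∈ B, ∑ y ∈ S with π y = x, g y =
      ∑ y ∈ S with π y ∈ B, g y := fun g B => Finset.sum_fiberwise_eq_sum_filter _ _ _ _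
  have keyS : ∀ g : V → ℤ, ∑ x ∈ S.image π, ∑ y ∈ S with π y = x, g y = ∑ y ∈ S, g y := by
    intro g
    rw [key]
    congr 1
    apply Finset.filter_true_of_mem
    intro x hx; exact Finset.mem_image_of_mem _ hx
  have keycut : ∀ B, cut (Lout.map (Sym2.map π)) B = cut L (S.filter fun y => π y ∈ B) := by
    intro B
    rw [cut_map π S Lout B hLS, hLL, cut_add, cut_eq_zero Lin, zero_add]
    intro e he x y hxy
    have hx := hin e he x (by simp [hxy])
    have hy := hin e he y (by simp [hxy])
    simp [hπA x hx, hπA y hy, hA hx, hA hy]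
  have fA : (S.filter fun y => π y = a) = A := by
    ext y
    simp only [Finset.mem_filter]
    constructor
    · rintro ⟨h1, h2⟩
      by_contra hy
      rw [hπn y hy] at h2
      exact hy (h2 ▸ ha)
    · intro hy; exact ⟨hA hy, hπA y hy⟩
  have fn : ∀ x ∈ S \ A, (S.filter fun y => π y = x) = {x} := by
    intro x hx
    rw [Finset.mem_sdiff] at hx
    ext y
    simp only [Finset.mem_filter, Finset.mem_singleton]
    constructor
    · rintro ⟨h1, h2⟩
      by_cases hy : y ∈ A
      · rw [hπA y hy] at h2; exact absurd (h2 ▸ ha) hx.2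
      · rwa [hπn y hy] at h2
    · rintro rfl; exact ⟨hx.1, hπn _ hx.2⟩
  have hI : Inst k (S.image π) (Lout.map (Sym2.map π)) (fun x => ∑ y ∈ S with π y = x, c y)
      (fun x => ∑ y ∈ S with π y = x, o y) (fun x => ∑ y ∈ S with π y = x, i y) (X \ A) := by
    refine ⟨H.ne.image _, ?_, ?_, ?_, ?_, ?_, ?_, ?_, ?_, ?_, ?_⟩
    · intro e he
      obtain ⟨e', he', rfl⟩ := Multiset.mem_map.mp he
      have h1 := H.hL e' (by rw [hLL]; exact Multiset.mem_add.mpr (Or.inr he'))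
      have h2 := hout e' he'
      induction e' with
      | h x y =>
        simp only [Sym2.mk_isDiag_iff, Sym2.mem_iff, forall_eq_or_imp, forall_eq,
          Sym2.map_mk] at h1 h2 ⊢
        refine ⟨?_, Finset.mem_image_of_mem _ h1.2.1, Finset.mem_image_of_mem _ h1.2.2⟩
        intro h
        by_cases hx : x ∈ A <;> by_cases hy : y ∈ A
        · exact h2 ⟨hx, hy⟩
        · rw [hπA x hx, hπn y hy] at h; exact hy (h ▸ ha)
        · rw [hπA y hy, hπn x hx] at h; exact hx (h ▸ ha)
        · rw [hπn x hx, hπn y hy] at h; exact h1.1 h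
    · intro x; exact Finset.sum_nonneg fun y _ => H.ho y
    · intro x; exact Finset.sum_nonneg fun y _ => H.hi y
    · intro B hB
      rw [key, keycut]
      exact H.par _ (Finset.filter_subset _ _)
    · rw [keyS]; exact H.sum
    · have := H.z0
      simp only [Finset.sum_add_distrib, Finset.sum_sub_distrib] at this ⊢
      simpa only [keyS] using this
    · intro x hx
      rw [Finset.mem_sdiff] at hx
      exact Finset.mem_image.mpr ⟨x, H.XS hx.1, hπn x hx.2⟩
    · exact (Finset.card_le_card Finset.sdiff_subset).trans H.Xc
    · intro v hv
      rw [Finset.mem_sdiff] at hv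
      have := H.XN v hv.1
      simp only [fn v (Finset.mem_sdiff.mpr ⟨H.XS hv.1, hv.2⟩), Finset.sum_singleton]
      exact this
    · intro B hB hBn hBS hBX
      have h := H.cond (S.filter fun y => π y ∈ B) (Finset.filter_subset _ _) ?_ ?_ ?_
      · unfold sl at h ⊢
        rw [keycut]
        simp only [Finset.sum_add_distrib, Finset.sum_sub_distrib] at h ⊢
        simpa only [key] using h
      · obtain ⟨x, hx⟩ := hBn
        obtain ⟨y, hy, rfl⟩ := Finset.mem_image.mp (hB hx)
        exact ⟨y, Finset.mem_filter.mpr ⟨hy, hx⟩⟩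
      · intro h
        apply hBS
        apply Finset.Subset.antisymm hB
        intro x hx
        obtain ⟨y, hy, rfl⟩ := Finset.mem_image.mp hx
        rw [← h] at hy
        exact (Finset.mem_filter.mp hy).2
      · intro h
        apply hBX
        have haB : a ∉ B := by
          intro haB
          have : A ⊆ X := by
            rw [← h]
            intro y hy
            exact Finset.mem_filter.mpr ⟨hA hy, by rw [hπA y hy]; exact haB⟩
          have := Finset.card_le_card this
          have := H.Xc
          omega
        rw [← h]
        ext x
        simp only [Finset.mem_sdiff, Finset.mem_filter]
        constructor
        · intro hx
          obtain ⟨y, hy, rfl⟩ := Finset.mem_image.mp (hB hx)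
          by_cases hyA : y ∈ A
          · rw [hπA y hyA] at hx; exact absurd hx haB
          · rw [hπn y hyA] at hx ⊢; rw [hπn y hyA]; exact ⟨⟨hy, hx⟩, hyA⟩
        · rintro ⟨⟨h1, h2⟩, h3⟩
          rwa [hπn x h3] at h2
  have hcard : (S.image π).card < S.card := by
    apply lt_of_le_of_ne Finset.card_image_le
    intro h
    have hinj := Finset.card_image_iff.mp h
    obtain ⟨x, hx, y, hy, hxy⟩ := Finset.one_lt_card.mp (show 1 < A.card by omega)
    exact hxy (hinj (hA hx) (hA hy) (by rw [hπA x hx, hπA y hy]))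
  obtain ⟨D', hD', hnet⟩ := ih _ _ _ _ _ _ hI (Or.inl hcard)
  obtain ⟨D, hD, rfl⟩ := pullback π Lout D' hD'
  have hDS : ∀ e ∈ D, e.1 ∈ S ∧ e.2 ∈ S := by
    intro e he
    have h1 := hLS _ (hD ▸ mem_und he)
    exact ⟨h1 _ (by simp), h1 _ (by simp)⟩
  refine ⟨D, hD, ?_, ?_⟩
  · intro x hx
    have h := hnet x (by
      rw [Finset.mem_sdiff] at hx
      exact Finset.mem_image.mpr ⟨x, hx.1, hπn x hx.2⟩)
    rw [outd_map π D S hDS, ind_map π D S hDS] at h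
    simpa only [fn x hx, Finset.sum_singleton] using h
  · have h := hnet a (Finset.mem_image.mpr ⟨a, hA ha, hπA a ha⟩)
    rw [outd_map π D S hDS, ind_map π D S hDS] at h
    simp only [fA] at h
    rwa [Finset.sum_sub_distrib]

theorem outd_eq_zero (D : Multiset (V × V)) (x : V) (h : ∀ e ∈ D, e.1 ≠ x) : outd D x = 0 := by
  unfold outd
  apply Multiset.sum_eq_zero
  intro r hr
  obtain ⟨e, he, rfl⟩ := Multiset.mem_map.mp hr
  simp [h e he]

theorem ind_eq_zero (D : Multiset (V × V)) (x : V) (h : ∀ e ∈ D, e.2 ≠ x) : ind D x = 0 := by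
  unfold ind
  apply Multiset.sum_eq_zero
  intro r hr
  obtain ⟨e, he, rfl⟩ := Multiset.mem_map.mp hr
  simp [h e he]

theorem cut_und (D : Multiset (V × V)) (A B : Finset V) (hB : B ⊆ A)
    (h : ∀ e ∈ D, ¬ (e.1 ∈ A ∧ e.2 ∈ A)) :
    cut (und D) B = ∑ x ∈ B, (outd D x + ind D x) := by
  induction D using Multiset.induction_on with
  | empty => simp
  | cons e D ih =>
    have ih' := ih (fun e he => h e (Multiset.mem_cons_of_mem he))
    have h1 := h e (Multiset.mem_cons_self _ _)
    rw [und_cons, cut_cons, ih', cross_mk]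
    simp only [outd_cons, ind_cons, Finset.sum_add_distrib, Finset.sum_ite_eq]
    have h2 : ¬ (e.1 ∈ B ∧ e.2 ∈ B) := fun h => h1 ⟨hB h.1, hB h.2⟩
    by_cases ha : e.1 ∈ B <;> by_cases hb : e.2 ∈ B <;> simp [ha, hb] at h2 ⊢ <;> ring

/-- Claim 1 -/
theorem tight {k : ℕ} {S : Finset V} {L : Multiset (Sym2 V)} {c o i : V → ℤ}
    {X : Finset V} (H : Inst k S L c o i X) (ih : IH k S L o i) {A : Finset V} (hA : A ⊆ S)
    (hA2 : 2 ≤ A.card) (hAS : A ≠ S) (hsl : sl k L c o i A ≤ 0) : Ori k S L c := by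
  obtain ⟨Lin, Lout, hLL, hin, hout⟩ := exists_split L (fun e => ∀ v ∈ e, v ∈ A)
  obtain ⟨D, hD, hD1, hD2⟩ := contract H ih hA hA2 hLL hin hout
  have hDA : ∀ e ∈ D, ¬ (e.1 ∈ A ∧ e.2 ∈ A) := by
    intro e he h
    apply hout _ (hD ▸ mem_und he)
    intro v hv
    rw [Sym2.mem_iff] at hv
    rcases hv with rfl | rfl
    exacts [h.1, h.2]
  have hcut : ∀ B ⊆ A, cut L B = cut Lin B + ∑ x ∈ B, (outd D x + ind D x) := by
    intro B hB
    rw [hLL, cut_add, ← hD, cut_und D A B hB hDA]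
  have hb : ∀ x, c x - (outd D x - ind D x) - (o x + ind D x) + (i x + outd D x)
      = c x - o x + i x := fun x => by ring
  have hI : Inst k A Lin (fun x => c x - (outd D x - ind D x)) (fun x => o x + ind D x)
      (fun x => i x + outd D x) (X ∩ A) := by
    refine ⟨Finset.card_pos.mp (by omega), ?_, ?_, ?_, ?_, ?_, ?_, ?_, ?_, ?_, ?_⟩
    · intro e he
      exact ⟨(H.hL e (by rw [hLL]; exact Multiset.mem_add.mpr (Or.inl he))).1, hin e he⟩
    · intro x; exact add_nonneg (H.ho x) (ind_nonneg _ _)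
    · intro x; exact add_nonneg (H.hi x) (outd_nonneg _ _)
    · intro B hB
      have h1 := H.par B (hB.trans hA)
      rw [hcut B hB] at h1
      simp only [Finset.sum_add_distrib, Finset.sum_sub_distrib] at h1 ⊢
      omega
    · have h1 := (dvd_neg.mpr hD2)
      rw [Finset.sum_sub_distrib]
      rw [neg_sub] at h1
      exact h1
    · simp only [hb]
      have h1 := hcut A (Finset.Subset.refl _)
      have h2 : cut Lin A = 0 := by
        apply cut_eq_zero
        intro e he x y hxy
        have hx := hin e he x (by simp [hxy])
        have hy := hin e he y (by simp [hxy])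
        simp [hx, hy]
      unfold sl at hsl
      simp only [Finset.sum_add_distrib] at h1 hsl ⊢
      linarith
    · exact Finset.inter_subset_right
    · exact (Finset.card_le_card Finset.inter_subset_left).trans H.Xc
    · intro v hv
      have := H.XN v (Finset.mem_inter.mp hv).1
      rw [← this]; congr 1; exact hb v
    · intro B hB hBn hBA hBX
      have h := H.cond B (hB.trans hA) hBn ?_ ?_
      · unfold sl at h ⊢
        simp only [hb]
        rw [hcut B hB] at h
        simp only [Finset.sum_add_distrib] at h ⊢
        linarith
      · rintro rfl; exact hBA (Finset.Subset.antisymm hB hA)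
      · rintro rfl; exact hBX (Finset.inter_eq_left.mpr hB).symm
  have hlt : A.card < S.card := Finset.card_lt_card (Finset.ssubset_iff_subset_ne.mpr ⟨hA, hAS⟩)
  obtain ⟨D2, hD2', hnet⟩ := ih _ _ _ _ _ _ hI (Or.inl hlt)
  refine ⟨D2 + D, by rw [und_add, hD2', hD, hLL], ?_⟩
  intro x hx
  by_cases hxA : x ∈ A
  · have h := hnet x hxA
    rw [outd_add, ind_add]
    have h2 : outd D2 x + outd D x - (ind D2 x + ind D x) - c x
        = outd D2 x - ind D2 x - (c x - (outd D x - ind D x)) := by ring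
    rw [h2]
    exact h
  · have h := hD1 x (Finset.mem_sdiff.mpr ⟨hx, hxA⟩)
    rw [outd_add, ind_add, outd_eq_zero D2 x, ind_eq_zero D2 x]
    · simpa using h
    · rintro e he rfl; exact hxA (hin _ (hD2' ▸ mem_und he) _ (by simp))
    · rintro e he rfl; exact hxA (hin _ (hD2' ▸ mem_und he) _ (by simp))

theorem sum_ind (A : Finset V) (x : V) :
    ∑ z ∈ A, (if x = z then (1 : ℤ) else 0) = if x ∈ A then 1 else 0 := by
  simp

theorem inst_neg {k : ℕ} (hk : 1 ≤ k) {S : Finset V} {L : Multiset (Sym2 V)} {c o i : V → ℤ}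
    {X : Finset V} (H : Inst k S L c o i X) : Inst k S L (fun x => - c x) i o X := by
  have hb : ∀ A : Finset V, ∑ x ∈ A, (- c x - i x + o x) = - ∑ x ∈ A, (c x - o x + i x) := by
    intro A
    rw [← Finset.sum_neg_distrib]
    apply Finset.sum_congr rfl
    intro x _; ring
  have hw : ∀ A : Finset V, ∑ x ∈ A, (i x + o x) = ∑ x ∈ A, (o x + i x) := by
    intro A
    apply Finset.sum_congr rfl
    intro x _; ring
  refine ⟨H.ne, H.hL, H.hi, H.ho, ?_, ?_, ?_, H.XS, H.Xc, ?_, ?_⟩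
  · intro A hA
    have := H.par A hA
    rw [Finset.sum_neg_distrib]
    omega
  · rw [Finset.sum_neg_distrib]; exact dvd_neg.mpr H.sum
  · rw [hb, N_neg k hk, hw]; exact H.z0
  · intro v hv
    rw [← H.XN v hv, ← N_neg k hk]
    congr 1; ring
  · intro A h1 h2 h3 h4
    have := H.cond A h1 h2 h3 h4
    unfold sl at this ⊢
    rwa [hb, N_neg k hk, hw]

theorem sl_neg {k : ℕ} (hk : 1 ≤ k) (L : Multiset (Sym2 V)) (c o i : V → ℤ)
    (A : Finset V) : sl k L (fun x => - c x) i o A = sl k L c o i A := by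
  have hb : ∑ x ∈ A, (- c x - i x + o x) = - ∑ x ∈ A, (c x - o x + i x) := by
    rw [← Finset.sum_neg_distrib]
    apply Finset.sum_congr rfl
    intro x _; ring
  have hw : ∑ x ∈ A, (i x + o x) = ∑ x ∈ A, (o x + i x) := by
    apply Finset.sum_congr rfl
    intro x _; ring
  unfold sl
  rw [hb, N_neg k hk, hw]

theorem ih_neg {k : ℕ} {S : Finset V} {L : Multiset (Sym2 V)} {o i : V → ℤ}
    (ih : IH k S L o i) : IH k S L i o := by
  have hw : ∑ x ∈ S, (i x + o x) = ∑ x ∈ S, (o x + i x) := by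
    apply Finset.sum_congr rfl
    intro x _; ring
  unfold IH at ih ⊢
  rw [hw]
  exact ih

theorem ori_neg {k : ℕ} {S : Finset V} {L : Multiset (Sym2 V)} {c : V → ℤ}
    (h : Ori k S L (fun x => - c x)) : Ori k S L c := by
  obtain ⟨D, hD, hn⟩ := h
  refine ⟨D.map Prod.swap, ?_, ?_⟩
  · rw [← hD]
    simp only [und, Multiset.map_map]
    apply Multiset.map_congr rfl
    intro e _
    simp [Sym2.eq_swap]
  · intro x hx
    have h1 : outd (D.map Prod.swap) x = ind D x := by simp [outd, ind, Multiset.map_map]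
    have h2 : ind (D.map Prod.swap) x = outd D x := by simp [outd, ind, Multiset.map_map]
    have h3 := dvd_neg.mpr (hn x hx)
    rw [h1, h2]
    have h4 : -(outd D x - ind D x - - c x) = ind D x - outd D x - c x := by ring
    rwa [h4] at h3

theorem ori_congr {k : ℕ} {S : Finset V} {L : Multiset (Sym2 V)} {c c' : V → ℤ}
    (hc : ∀ x, (2 * k : ℤ) ∣ c' x - c x) (h : Ori k S L c') : Ori k S L c := by
  obtain ⟨D, hD, hn⟩ := h
  refine ⟨D, hD, fun x hx => ?_⟩
  have h3 := dvd_add (hn x hx) (hc x)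
  have h4 : outd D x - ind D x - c' x + (c' x - c x) = outd D x - ind D x - c x := by ring
  rwa [h4] at h3

theorem sl_congr {k : ℕ} (hk : 1 ≤ k) (L : Multiset (Sym2 V)) {c c' : V → ℤ} (o i : V → ℤ)
    (A : Finset V) (hc : ∀ x, (2 * k : ℤ) ∣ c' x - c x) :
    sl k L c' o i A = sl k L c o i A := by
  unfold sl
  rw [N_congr k hk (a := ∑ x ∈ A, (c' x - o x + i x)) (b := ∑ x ∈ A, (c x - o x + i x))]
  rw [← Finset.sum_sub_distrib]
  apply Finset.dvd_sum
  intro x _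
  have : c' x - o x + i x - (c x - o x + i x) = c' x - c x := by ring
  rw [this]; exact hc x

theorem inst_congr {k : ℕ} (hk : 1 ≤ k) {S : Finset V} {L : Multiset (Sym2 V)}
    {c c' o i : V → ℤ}
    {X : Finset V} (H : Inst k S L c o i X) (hc : ∀ x, (2 * k : ℤ) ∣ c' x - c x) :
    Inst k S L c' o i X := by
  have hs : ∀ A : Finset V, (2 * k : ℤ) ∣ ∑ x ∈ A, c' x - ∑ x ∈ A, c x := by
    intro A
    rw [← Finset.sum_sub_distrib]
    exact Finset.dvd_sum fun x _ => hc x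
  have hN : ∀ A : Finset V, N k (∑ x ∈ A, (c' x - o x + i x)) =
      N k (∑ x ∈ A, (c x - o x + i x)) := by
    intro A
    apply N_congr k hk
    have := hs A
    simp only [Finset.sum_add_distrib, Finset.sum_sub_distrib] at this ⊢
    rwa [show ∀ a b d e : ℤ, a - b + d - (e - b + d) = a - e by intros; ring]
  refine ⟨H.ne, H.hL, H.ho, H.hi, ?_, ?_, ?_, H.XS, H.Xc, ?_, ?_⟩
  · intro A hA
    have h1 := H.par A hA
    have h2 : (2 : ℤ) ∣ ∑ x ∈ A, c' x - ∑ x ∈ A, c x := (Dvd.intro _ rfl).trans (hs A)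
    omega
  · have := dvd_add (hs S) H.sum
    simpa using this
  · rw [hN]; exact H.z0
  · intro v hv
    have := hN {v}
    simp only [Finset.sum_singleton] at this
    rw [this]; exact H.XN v hv
  · intro A h1 h2 h3 h4
    rw [sl_congr hk L o i A hc]
    exact H.cond A h1 h2 h3 h4

theorem dstep {k : ℕ} {S : Finset V} {L L0 : Multiset (Sym2 V)} {c o i : V → ℤ}
    {X : Finset V} (H : Inst k S L c o i X) (ih : IH k S L o i)
    (hbig : ∀ A ⊆ S, 2 ≤ A.card → A ≠ S → 2 ≤ sl k L c o i A)
    {x y : V} (hLL : L = s(x, y) ::ₘ L0) (c' o' i' : V → ℤ)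
    (hc' : c' = fun z => c z - (if x = z then 1 else 0) + (if y = z then 1 else 0))
    (ho' : ∀ x, 0 ≤ o' x) (hi' : ∀ x, 0 ≤ i' x)
    (z0 : ∑ x ∈ S, (o' x + i' x) ≤ 2 * k - 2 + N k (∑ x ∈ S, (c' x - o' x + i' x)))
    (XN : ∀ v ∈ X, N k (c' v - o' v + i' v) = 0)
    (h2 : ∀ A ⊆ S, 2 ≤ A.card → A ≠ S → sl k L c o i A - 2 ≤ sl k L0 c' o' i' A)
    (h1 : ∀ v ∈ S, S ≠ {v} → X ≠ {v} → 0 ≤ sl k L0 c' o' i' {v}) : Ori k S L c := by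
  have hx : x ∈ S := (H.hL s(x, y) (by simp [hLL])).2 x (by simp)
  have hy : y ∈ S := (H.hL s(x, y) (by simp [hLL])).2 y (by simp)
  have hs : ∀ A : Finset V, ∑ z ∈ A, c' z = ∑ z ∈ A, c z - (if x ∈ A then 1 else 0)
      + (if y ∈ A then 1 else 0) := by
    intro A
    rw [hc', Finset.sum_add_distrib, Finset.sum_sub_distrib, sum_ind, sum_ind]
  have hI : Inst k S L0 c' o' i' X := by
    refine ⟨H.ne, ?_, ho', hi', ?_, ?_, z0, H.XS, H.Xc, XN, ?_⟩
    · intro e he; exact H.hL e (by simp [hLL, he])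
    · intro A hA
      have := H.par A hA
      rw [hLL, cut_cons, cross_mk] at this
      rw [hs]
      split_ifs at this ⊢ <;> first | omega | tauto
    · rw [hs]; simp only [hx, hy, if_true]
      simpa using H.sum
    · intro A hA hAn hAS hAX
      rcases Nat.lt_or_ge A.card 2 with h | h
      · have : A.card = 1 := by have := Finset.card_pos.mpr hAn; omega
        obtain ⟨v, rfl⟩ := Finset.card_eq_one.mp this
        exact h1 v (hA (by simp)) (Ne.symm hAS) (Ne.symm hAX)
      · have := h2 A hA h hAS
        have := hbig A hA h hAS
        omega
  obtain ⟨D, hD, hn⟩ := ih _ _ _ _ _ _ hI (Or.inr ⟨rfl, Or.inl (by simp [hLL])⟩)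
  refine ⟨(x, y) ::ₘ D, by simp [hD, hLL], ?_⟩
  intro z hz
  have := hn z hz
  rw [hc'] at this
  simp only [outd_cons, ind_cons]
  have h4 : (if x = z then (1 : ℤ) else 0) + outd D z - ((if y = z then 1 else 0) + ind D z) - c z
    = outd D z - ind D z - (c z - (if x = z then 1 else 0) + (if y = z then 1 else 0)) := by ring
  rw [h4]; exact this

theorem lstep {k : ℕ} {S : Finset V} {L L0 : Multiset (Sym2 V)} {c o i : V → ℤ}
    {X : Finset V} (H : Inst k S L c o i X) (ih : IH k S L o i)
    (hbig : ∀ A ⊆ S, 2 ≤ A.card → A ≠ S → 2 ≤ sl k L c o i A)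
    {v y w : V} (hyw : y ≠ w) (hLL : L = s(v, y) ::ₘ s(v, w) ::ₘ L0)
    (hv : X = {v} ∨ 2 ≤ sl k L c o i {v}) : Ori k S L c := by
  have hvS : v ∈ S := (H.hL s(v, y) (by simp [hLL])).2 v (by simp)
  have hyS : y ∈ S := (H.hL s(v, y) (by simp [hLL])).2 y (by simp)
  have hwS : w ∈ S := (H.hL s(v, w) (by simp [hLL])).2 w (by simp)
  have hvy : v ≠ y := by simpa using (H.hL s(v, y) (by simp [hLL])).1
  have hvw : v ≠ w := by simpa using (H.hL s(v, w) (by simp [hLL])).1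
  have hcut : ∀ A : Finset V, cut (s(y, w) ::ₘ L0) A = cut L A - 
      (if (v ∈ A ∧ y ∉ A ∧ w ∉ A) ∨ (v ∉ A ∧ y ∈ A ∧ w ∈ A) then 2 else 0) := by
    intro A
    rw [hLL]
    simp only [cut_cons, cross_mk]
    by_cases h1 : v ∈ A <;> by_cases h2 : y ∈ A <;> by_cases h3 : w ∈ A <;> simp [h1, h2, h3] <;>
      ring
  have hI : Inst k S (s(y, w) ::ₘ L0) c o i X := by
    refine ⟨H.ne, ?_, H.ho, H.hi, ?_, H.sum, H.z0, H.XS, H.Xc, H.XN, ?_⟩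
    · intro e he
      rw [Multiset.mem_cons] at he
      rcases he with rfl | he
      · simp [hyw, hyS, hwS]
      · exact H.hL e (by simp [hLL, he])
    · intro A hA
      have := H.par A hA
      rw [hcut]
      split_ifs <;> omega
    · intro A hA hAn hAS hAX
      have h0 : sl k (s(y, w) ::ₘ L0) c o i A = sl k L c o i A - 
          (if (v ∈ A ∧ y ∉ A ∧ w ∉ A) ∨ (v ∉ A ∧ y ∈ A ∧ w ∈ A) then 2 else 0) := by
        unfold sl
        rw [hcut]; ring
      have hc := H.cond A hA hAn hAS hAX
      rw [h0]
      rcases Nat.lt_or_ge A.card 2 with h | h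
      · have : A.card = 1 := by have := Finset.card_pos.mpr hAn; omega
        obtain ⟨u, rfl⟩ := Finset.card_eq_one.mp this
        by_cases huv : v = u
        · subst huv
          rcases hv with hv | hv
          · exact absurd hv.symm hAX
          · split_ifs <;> omega
        · rw [if_neg]
          · omega
          · simp only [Finset.mem_singleton]
            rintro (⟨h1, _⟩ | ⟨_, h2, h3⟩)
            · exact huv h1
            · exact hyw (h2.trans h3.symm)
      · have := hbig A hA h hAS
        split_ifs <;> omega
  obtain ⟨D, hD, hn⟩ := ih _ _ _ _ _ _ hI (Or.inr ⟨rfl, Or.inl (by simp [hLL])⟩)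
  have hm : s(y, w) ∈ und D := by rw [hD]; simp
  obtain ⟨⟨a, b⟩, hab, he⟩ := Multiset.mem_map.mp hm
  obtain ⟨D1, rfl⟩ := Multiset.exists_cons_of_mem hab
  rw [und_cons, he, Multiset.cons_inj_right] at hD
  have hab' : s(a, b) = s(y, w) := he
  refine ⟨(a, v) ::ₘ (v, b) ::ₘ D1, ?_, ?_⟩
  · rw [und_cons, und_cons, hD, hLL]
    rw [Sym2.eq_iff] at hab'
    rcases hab' with ⟨rfl, rfl⟩ | ⟨rfl, rfl⟩
    · simp [Sym2.eq_swap]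
    · rw [Multiset.cons_swap]; simp [Sym2.eq_swap]
  · intro z hz
    have := hn z hz
    simp only [outd_cons, ind_cons] at this ⊢
    have h4 : (if a = z then (1 : ℤ) else 0) + ((if v = z then 1 else 0) + outd D1 z) -
        ((if v = z then 1 else 0) + ((if b = z then 1 else 0) + ind D1 z)) - c z =
        (if a = z then (1 : ℤ) else 0) + outd D1 z - ((if b = z then 1 else 0) + ind D1 z)
          - c z := by ring
    rw [h4]; exact this

theorem rstep {k : ℕ} (hk : 1 ≤ k) {S : Finset V} {L : Multiset (Sym2 V)} {c o i : V → ℤ}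
    {X : Finset V} (H : Inst k S L c o i X) (ih : IH k S L o i)
    {x y : V} (hxS : x ∈ S) (hyS : y ∈ S) (hxy : x ≠ y)
    (hx : ∀ e ∈ L, x ∈ e → e = s(x, y))
    (h : (k : ℤ) - 1 ≤ cut L {x} ∨ (2 * k : ℤ) ∣ c x) : Ori k S L c := by
  obtain ⟨Lin, Lout, hLL, hin, hout⟩ := exists_split L (fun e => ∀ v ∈ e, v ∈ ({x, y} : Finset V))
  have hA : ({x, y} : Finset V) ⊆ S := by
    intro z hz
    simp only [Finset.mem_insert, Finset.mem_singleton] at hz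
    rcases hz with rfl | rfl <;> assumption
  obtain ⟨D, hD, hD1, hD2⟩ := contract H ih hA (by rw [Finset.card_pair hxy]) hLL hin hout
  have hrep : Lin = Multiset.replicate Lin.card s(x, y) := by
    rw [Multiset.eq_replicate]
    refine ⟨rfl, fun e he => ?_⟩
    have h1 := hin e he
    have h2 := (H.hL e (by rw [hLL]; exact Multiset.mem_add.mpr (Or.inl he))).1
    induction e with
    | h a b =>
      simp only [Sym2.mem_iff, forall_eq_or_imp, forall_eq, Finset.mem_insert,
        Finset.mem_singleton, Sym2.mk_isDiag_iff] at h1 h2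
      rw [Sym2.eq_iff]
      rcases h1 with ⟨rfl | rfl, rfl | rfl⟩ <;> simp_all
  have hxD : ∀ e ∈ D, e.1 ≠ x ∧ e.2 ≠ x := by
    intro e he
    have h1 : s(e.1, e.2) ∈ Lout := hD ▸ mem_und he
    have h2 : x ∉ s(e.1, e.2) := by
      intro hm
      have := hx _ (by rw [hLL]; exact Multiset.mem_add.mpr (Or.inr h1)) hm
      rw [this] at h1
      apply hout _ h1
      simp
    constructor <;> rintro rfl <;> simp at h2
  have ho0 : outd D x = 0 := outd_eq_zero D x fun e he => (hxD e he).1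
  have hi0 : ind D x = 0 := ind_eq_zero D x fun e he => (hxD e he).2
  have hcutout : cut Lout {x} = 0 := by
    apply cut_eq_zero
    intro e he a b hab
    have h2 : x ∉ e := by
      intro hm
      have := hx _ (by rw [hLL]; exact Multiset.mem_add.mpr (Or.inr he)) hm
      rw [this] at he
      apply hout _ he
      simp
    subst hab
    simp only [Sym2.mem_iff, not_or] at h2
    simp [Ne.symm h2.1, Ne.symm h2.2]
  set m := Lin.card with hm
  have hcut : cut L {x} = m := by
    rw [hLL, cut_add, hcutout, hrep]
    unfold cut
    rw [Multiset.map_replicate, Multiset.sum_replicate, cross_mk]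
    simp [Ne.symm hxy]
  have hpar := H.par {x} (by simpa using hxS)
  rw [hcut, Finset.sum_singleton] at hpar
  obtain ⟨j, hjm, hj⟩ : ∃ j : ℕ, j ≤ m ∧ (2 * k : ℤ) ∣ 2 * j - m - c x := by
    rcases h with h | h
    · rw [hcut] at h
      obtain ⟨q, hq⟩ := hpar
      have hkpos : (0 : ℤ) < k := by exact_mod_cast hk
      have h1 := Int.emod_nonneg (q + m) hkpos.ne'
      have h2 := Int.emod_lt_of_pos (q + m) hkpos
      refine ⟨((q + m) % k).toNat, by omega, ?_⟩
      rw [Int.toNat_of_nonneg h1]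
      have h3 := Int.emod_add_mul_ediv (q + m) k
      exact ⟨-((q + m) / k), by linear_combination 2 * h3 - hq⟩
    · have h2 : (2 : ℤ) ∣ c x := (Dvd.intro _ rfl).trans h
      refine ⟨m / 2, by omega, ?_⟩
      have : 2 * ((m / 2 : ℕ) : ℤ) - m - c x = - c x := by omega
      rw [this]; exact dvd_neg.mpr h
  set E := Multiset.replicate j (x, y) + Multiset.replicate (m - j) (y, x) with hE
  have hEout : ∀ z, outd E z = j * (if x = z then 1 else 0) + (m - j) * (if y = z then 1 else 0) := by
    intro z
    rw [hE, outd_add]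
    unfold outd
    rw [Multiset.map_replicate, Multiset.sum_replicate, Multiset.map_replicate,
      Multiset.sum_replicate]
    simp [hjm]
  have hEin : ∀ z, ind E z = j * (if y = z then 1 else 0) + (m - j) * (if x = z then 1 else 0) := by
    intro z
    rw [hE, ind_add]
    unfold ind
    rw [Multiset.map_replicate, Multiset.sum_replicate, Multiset.map_replicate,
      Multiset.sum_replicate]
    simp [hjm]
  refine ⟨E + D, ?_, ?_⟩
  · rw [und_add, hD, hLL]
    congr 1
    rw [hrep, hE, und_add]
    unfold und
    rw [Multiset.map_replicate, Multiset.map_replicate, Sym2.eq_swap (a := y), ← Multiset.replicate_add]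
    congr 1; omega
  · intro z hz
    rw [outd_add, ind_add, hEout, hEin]
    by_cases hzx : x = z
    · subst hzx
      rw [ho0, hi0]
      simp only [if_true, if_neg (Ne.symm hxy)]
      have : (j : ℤ) * 1 + (m - j) * 0 + 0 - (j * 0 + (m - j) * 1 + 0) - c x = 2 * j - m - c x := by
        ring
      rw [this]; exact hj
    · by_cases hzy : y = z
      · subst hzy
        simp only [if_true, if_neg hxy]
        rw [Finset.sum_pair hxy, Finset.sum_pair hxy, ho0, hi0] at hD2
        have h5 := dvd_sub hD2 hj
        have : (j : ℤ) * 0 + (m - j) * 1 + outd D y - (j * 1 + (m - j) * 0 + ind D y) - c y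
          = 0 - 0 + (outd D y - ind D y) - (c x + c y) - (2 * j - m - c x) := by ring
        rw [this]; exact h5
      · simp only [if_neg hzx, if_neg hzy]
        have := hD1 z (by simp [hz, Ne.symm hzx, Ne.symm hzy])
        simpa using this

theorem N_zero_dvd {k : ℕ} {n : ℤ} (h : N k n = 0) : (2 * k : ℤ) ∣ n := by
  obtain ⟨z, hz⟩ := N_ex k n
  rw [h] at hz
  have := abs_eq_zero.mp hz.symm
  exact ⟨z, by linarith⟩

theorem partition {k : ℕ} (hk : 2 ≤ k) {S : Finset V} {L : Multiset (Sym2 V)} {c o i : V → ℤ}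
    (H : Inst k S L c o i ∅) {P : Finset V} (hP : P ⊆ S) (hPn : P.Nonempty) (hPS : P ≠ S) :
    ∃ x ∈ P, ∃ y ∈ S, y ∉ P ∧ s(x, y) ∈ L := by
  by_contra hcon
  push Not at hcon
  have h1 : cut L P = 0 := by
    apply cut_eq_zero
    intro e he x y hxy
    subst hxy
    have hx := (H.hL _ he).2 x (by simp)
    have hy := (H.hL _ he).2 y (by simp)
    constructor
    · intro h
      by_contra h'
      exact hcon x h y hy h' he
    · intro h
      by_contra h'
      exact hcon y h x hx h' (Sym2.eq_swap ▸ he)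
  have h2 : cut L (S \ P) = 0 := by
    apply cut_eq_zero
    intro e he x y hxy
    subst hxy
    have hx := (H.hL _ he).2 x (by simp)
    have hy := (H.hL _ he).2 y (by simp)
    simp only [Finset.mem_sdiff, hx, hy, true_and, not_iff_not]
    constructor
    · intro h
      by_contra h'
      exact hcon x h y hy h' he
    · intro h
      by_contra h'
      exact hcon y h x hx h' (Sym2.eq_swap ▸ he)
  have hQn : (S \ P).Nonempty := by
    rw [Finset.sdiff_nonempty]
    intro h; exact hPS (Finset.Subset.antisymm hP h)
  have hQS : S \ P ≠ S := by
    intro h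
    obtain ⟨x, hx⟩ := hPn
    have := hP hx
    rw [← h, Finset.mem_sdiff] at this
    exact this.2 hx
  have h3 := H.cond P hP hPn hPS hPn.ne_empty
  have h4 := H.cond (S \ P) Finset.sdiff_subset hQn hQS hQn.ne_empty
  have h5 := H.z0
  rw [← Finset.sum_sdiff hP, ← Finset.sum_sdiff (f := fun x => c x - o x + i x) hP] at h5
  have h6 := N_add k (by omega) (∑ x ∈ S \ P, (c x - o x + i x)) (∑ x ∈ P, (c x - o x + i x))
  unfold sl at h3 h4
  rw [h1] at h3
  rw [h2] at h4
  have : (2 : ℤ) ≤ k := by exact_mod_cast hk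
  linarith

theorem liftB {k : ℕ} {S : Finset V} {L : Multiset (Sym2 V)} {c o i : V → ℤ}
    {X : Finset V} (H : Inst k S L c o i X) (ih : IH k S L o i)
    (hbig : ∀ A ⊆ S, 2 ≤ A.card → A ≠ S → 2 ≤ sl k L c o i A)
    {v y : V} (hvy : s(v, y) ∈ L) (hov : 0 < o v)
    (hv : X = {v} ∨ (X = ∅ ∧ 2 ≤ sl k L c o i {v})) : Ori k S L c := by
  obtain ⟨L0, hLL⟩ := Multiset.exists_cons_of_mem hvy
  have hvS : v ∈ S := (H.hL _ hvy).2 v (by simp)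
  have hyS : y ∈ S := (H.hL _ hvy).2 y (by simp)
  have hne : v ≠ y := by simpa using (H.hL _ hvy).1
  have hw : ∀ A : Finset V, ∑ z ∈ A, (o z + (if y = z then 1 else 0) - (if v = z then 1 else 0)
      + i z) = ∑ z ∈ A, (o z + i z) + (if y ∈ A then 1 else 0) - (if v ∈ A then 1 else 0) := by
    intro A
    simp only [Finset.sum_add_distrib, Finset.sum_sub_distrib, sum_ind]
    ring
  have hb : ∀ z, (c z - (if v = z then 1 else 0) + (if y = z then 1 else 0)) -
      (o z + (if y = z then 1 else 0) - (if v = z then 1 else 0)) + i z = c z - o z + i z := by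
    intro z; ring
  have hsl : ∀ A : Finset V, sl k L0
      (fun z => c z - (if v = z then 1 else 0) + (if y = z then 1 else 0))
      (fun z => o z + (if y = z then 1 else 0) - (if v = z then 1 else 0)) i A =
      sl k L c o i A - (if v ∈ A ∧ y ∉ A then 2 else 0) := by
    intro A
    unfold sl
    simp only [hw, hb]
    rw [hLL, cut_cons, cross_mk]
    by_cases h1 : v ∈ A <;> by_cases h2 : y ∈ A <;> simp [h1, h2] <;> ring
  refine dstep H ih hbig hLL _ (fun z => o z + (if y = z then 1 else 0) - (if v = z then 1 else 0))
    i rfl ?_ H.hi ?_ ?_ ?_ ?_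
  · intro z
    have := H.ho z
    by_cases h1 : v = z
    · subst h1; simp only [if_true]; split_ifs <;> omega
    · simp only [if_neg h1]; split_ifs <;> omega
  · simp only [hw, hb, hvS, hyS, if_true]
    have := H.z0
    linarith
  · intro u hu
    simp only [hb]
    exact H.XN u hu
  · intro A _ _ _
    rw [hsl]
    split_ifs <;> omega
  · intro u hu h1 h2
    rw [hsl]
    rcases hv with hv | ⟨hv, hv2⟩
    · have huv : v ≠ u := by rintro rfl; exact h2 hv
      rw [if_neg (by simp [huv])]
      have := H.cond {u} (by simpa using hu) (by simp) (Ne.symm h1) (Ne.symm h2)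
      linarith
    · by_cases huv : v = u
      · subst huv
        split_ifs <;> omega
      · rw [if_neg (by simp [huv])]
        have := H.cond {u} (by simpa using hu) (by simp) (Ne.symm h1) (Ne.symm h2)
        linarith

theorem liftVertex {k : ℕ} (hk : 2 ≤ k) {S : Finset V} {L : Multiset (Sym2 V)} {c o i : V → ℤ}
    {X : Finset V} (H : Inst k S L c o i X) (ih : IH k S L o i)
    (hbig : ∀ A ⊆ S, 2 ≤ A.card → A ≠ S → 2 ≤ sl k L c o i A) (hS : 2 ≤ S.card)
    {v : V} (hvS : v ∈ S)
    (hv : X = {v} ∨ (X = ∅ ∧ 2 ≤ sl k L c o i {v})) : Ori k S L c := by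
  have hk1 : 1 ≤ k := by omega
  have hkz : (2 : ℤ) ≤ k := by exact_mod_cast hk
  by_cases hA : ∃ y w, y ≠ w ∧ s(v, y) ∈ L ∧ s(v, w) ∈ L
  · obtain ⟨y, w, hyw, hy, hw⟩ := hA
    obtain ⟨L1, hL1⟩ := Multiset.exists_cons_of_mem hy
    have hw2 : s(v, w) ∈ L1 := by
      rw [hL1, Multiset.mem_cons] at hw
      rcases hw with hw | hw
      · have : y = w := by
          rw [Sym2.eq_iff] at hw
          rcases hw with ⟨_, h⟩ | ⟨h1, h2⟩
          · exact h.symm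
          · rw [← h1, h2]
        exact absurd this hyw
      · exact hw
    obtain ⟨L0, hL0⟩ := Multiset.exists_cons_of_mem hw2
    exact lstep H ih hbig hyw (by rw [hL1, hL0]) (hv.imp id And.right)
  · push Not at hA
    by_cases hN : ∃ y, s(v, y) ∈ L
    · obtain ⟨y, hy⟩ := hN
      have ho := H.ho v
      have hi := H.hi v
      rcases ho.lt_or_eq with ho | ho
      · exact liftB H ih hbig hy ho hv
      rcases hi.lt_or_eq with hi | hi
      · apply ori_neg
        refine liftB (inst_neg hk1 H) (ih_neg ih) ?_ hy hi ?_
        · intro A h1 h2 h3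
          rw [sl_neg hk1]; exact hbig A h1 h2 h3
        · rw [sl_neg hk1]; exact hv
      · have hyS : y ∈ S := (H.hL _ hy).2 y (by simp)
        have hne : v ≠ y := by simpa using (H.hL _ hy).1
        refine rstep hk1 H ih hvS hyS hne ?_ ?_
        · intro e he hm
          obtain ⟨w, rfl⟩ := hm
          by_contra h
          exact hA y w (by rintro rfl; exact h rfl) hy he
        · rcases hv with hv | ⟨_, hv⟩
          · right
            have := H.XN v (by simp [hv])
            rw [← ho, ← hi] at this
            simpa using N_zero_dvd this
          · left
            unfold sl at hv
            have := N_nonneg k (∑ x ∈ {v}, (c x - o x + i x))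
            rw [Finset.sum_singleton, ← ho, ← hi] at hv
            linarith
    · push Not at hN
      have hne : ∀ e ∈ L, v ∉ e := by
        rintro e he ⟨w, rfl⟩
        exact hN w he
      have hcut : ∀ A : Finset V, (∀ x ∈ S, x ≠ v → x ∈ A) ∨ A = {v} → cut L A = 0 := by
        intro A hA
        apply cut_eq_zero
        intro e he a b hab
        subst hab
        have h1 := hne _ he
        have ha := (H.hL _ he).2 a (by simp)
        have hb := (H.hL _ he).2 b (by simp)
        simp only [Sym2.mem_iff, not_or] at h1
        rcases hA with hA | hA
        · simp [hA a ha (Ne.symm h1.1), hA b hb (Ne.symm h1.2)]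
        · simp [hA, Ne.symm h1.1, Ne.symm h1.2]
      have hAn : (S.erase v).Nonempty := by
        apply Finset.card_pos.mp
        rw [Finset.card_erase_of_mem hvS]; omega
      have hc := H.cond (S.erase v) (Finset.erase_subset _ _) hAn
        (by intro h; rw [← h] at hvS; simp at hvS)
        (by
          rcases hv with hv | ⟨hv, _⟩
          · rw [hv]; intro h
            have : v ∈ S.erase v := by rw [h]; simp
            simp at this
          · rw [hv]; exact hAn.ne_empty)
      have h5 := H.z0
      rw [← Finset.add_sum_erase _ _ hvS,
        ← Finset.add_sum_erase _ (fun x => c x - o x + i x) hvS] at h5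
      have h6 := N_add k hk1 (c v - o v + i v) (∑ x ∈ S.erase v, (c x - o x + i x))
      unfold sl at hc
      rw [hcut _ (Or.inl (fun x hx hxv => Finset.mem_erase.mpr ⟨hxv, hx⟩))] at hc
      have h7 : o v + i v ≤ N k (c v - o v + i v) := by linarith
      have h8 := N_nonneg k (c v - o v + i v)
      have ho := H.ho v
      have hi := H.hi v
      rcases hv with hv | ⟨_, hv⟩
      · have h9 := H.XN v (by simp [hv])
        have ho0 : o v = 0 := by omega
        have hi0 : i v = 0 := by omega
        rw [ho0, hi0] at h9
        obtain ⟨y, hy⟩ := hAn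
        rw [Finset.mem_erase] at hy
        refine rstep hk1 H ih hvS hy.2 (Ne.symm hy.1) ?_ (Or.inr ?_)
        · intro e he hm; exact absurd hm (hne e he)
        · simpa using N_zero_dvd h9
      · unfold sl at hv
        rw [hcut _ (Or.inr rfl), Finset.sum_singleton, Finset.sum_singleton] at hv
        exfalso
        linarith

/-- direct an edge, lowering `|b|` at both ends -/
theorem c2step {k : ℕ} (hk : 2 ≤ k) {S : Finset V} {L : Multiset (Sym2 V)} {c o i : V → ℤ}
    (H : Inst k S L c o i ∅) (ih : IH k S L o i)
    (hbig : ∀ A ⊆ S, 2 ≤ A.card → A ≠ S → 2 ≤ sl k L c o i A)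
    {x y : V} (hxy : s(x, y) ∈ L)
    (hx : N k (c x - o x + i x - 1) = N k (c x - o x + i x) - 1)
    (hy : N k (c y - o y + i y + 1) = N k (c y - o y + i y) - 1) : Ori k S L c := by
  have hk1 : 1 ≤ k := by omega
  obtain ⟨L0, hLL⟩ := Multiset.exists_cons_of_mem hxy
  have hxS : x ∈ S := (H.hL _ hxy).2 x (by simp)
  have hyS : y ∈ S := (H.hL _ hxy).2 y (by simp)
  have hne : x ≠ y := by simpa using (H.hL _ hxy).1
  have hb : ∀ A : Finset V, ∑ z ∈ A,
      ((c z - (if x = z then 1 else 0) + (if y = z then 1 else 0)) - o z + i z)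
      = ∑ z ∈ A, (c z - o z + i z) + (- (if x ∈ A then 1 else 0) + (if y ∈ A then 1 else 0)) := by
    intro A
    simp only [Finset.sum_add_distrib, Finset.sum_sub_distrib, sum_ind]
    ring
  refine dstep H ih hbig hLL _ o i rfl H.ho H.hi ?_ (by simp) ?_ ?_
  · rw [hb]
    simp only [hxS, hyS, if_true]
    simpa using H.z0
  · intro A _ _ _
    unfold sl
    rw [hb, hLL, cut_cons, cross_mk]
    have h1 := N_shift k hk1 (∑ z ∈ A, (c z - o z + i z)) 1
    have h2 := N_shift k hk1 (∑ z ∈ A, (c z - o z + i z)) (-1)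
    rw [abs_neg] at h2
    rw [abs_one] at h1 h2
    by_cases h3 : x ∈ A <;> by_cases h4 : y ∈ A <;> simp [h3, h4] <;> linarith
  · intro u hu hS _
    have hc := H.cond {u} (by simpa using hu) (by simp) (Ne.symm hS) (by simp)
    unfold sl at hc ⊢
    rw [hb]
    rw [hLL, cut_cons, cross_mk] at hc
    simp only [Finset.mem_singleton, Finset.sum_singleton] at hc ⊢
    by_cases h3 : x = u
    · subst h3
      simp only [Ne.symm hne, if_true, if_false, iff_false, not_true] at hc ⊢
      rw [show c x - o x + i x + (-1 + 0) = c x - o x + i x - 1 by ring, hx]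
      linarith
    · by_cases h4 : y = u
      · subst h4
        simp only [hne, if_true, if_false, false_iff, not_true] at hc ⊢
        rw [show c y - o y + i y + (-0 + 1) = c y - o y + i y + 1 by ring, hy]
        linarith
      · simp only [h3, h4, if_true, if_false] at hc ⊢
        simpa using hc

theorem final_pos {k : ℕ} (hk : 2 ≤ k) {S : Finset V} {L : Multiset (Sym2 V)} {c o i : V → ℤ}
    (H : Inst k S L c o i ∅) (ih : IH k S L o i) (hS : 2 ≤ S.card)
    (hbig : ∀ A ⊆ S, 2 ≤ A.card → A ≠ S → 2 ≤ sl k L c o i A)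
    (hpos : ∀ x ∈ S, 0 < c x - o x + i x ∧ c x - o x + i x < k) : Ori k S L c := by
  have hk1 : 1 ≤ k := by omega
  have hkz : (2 : ℤ) ≤ k := by exact_mod_cast hk
  have hNx : ∀ x ∈ S, N k (c x - o x + i x) = c x - o x + i x := by
    intro x hx
    have := hpos x hx
    rw [N_self k hk1, abs_of_pos this.1]
    rw [abs_of_pos this.1]; exact this.2.le
  have hNx1 : ∀ x ∈ S, N k (c x - o x + i x - 1) = c x - o x + i x - 1 := by
    intro x hx
    have := hpos x hx
    rw [N_self k hk1, abs_of_nonneg (by linarith)]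
    rw [abs_of_nonneg (by linarith)]; linarith
  have hcond : ∀ u ∈ S, 0 ≤ cut L {u} + (o u + i u) - (2 * k - 2) - (c u - o u + i u) := by
    intro u hu
    have hc := H.cond {u} (by simpa using hu) (by simp)
      (by intro h; rw [← h] at hS; simp at hS) (by simp)
    unfold sl at hc
    rwa [Finset.sum_singleton, Finset.sum_singleton, hNx u hu] at hc
  by_cases hi : ∃ x ∈ S, 0 < i x
  · obtain ⟨x, hx, hix⟩ := hi
    have hw : ∀ A : Finset V, ∑ z ∈ A, (o z + (i z - (if x = z then 1 else 0)))
        = ∑ z ∈ A, (o z + i z) - (if x ∈ A then 1 else 0) := by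
      intro A
      simp only [Finset.sum_add_distrib, Finset.sum_sub_distrib, sum_ind]
      ring
    have hb : ∀ A : Finset V, ∑ z ∈ A, (c z - o z + (i z - (if x = z then 1 else 0)))
        = ∑ z ∈ A, (c z - o z + i z) + -(if x ∈ A then 1 else 0) := by
      intro A
      simp only [Finset.sum_add_distrib, Finset.sum_sub_distrib, sum_ind]
      ring
    refine ih S L c o (fun z => i z - (if x = z then 1 else 0)) ∅ ?_
      (Or.inr ⟨rfl, Or.inr ⟨rfl, ?_⟩⟩)
    · refine ⟨H.ne, H.hL, H.ho, ?_, H.par, H.sum, ?_, H.XS, H.Xc, by simp, ?_⟩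
      · intro z
        have := H.hi z
        by_cases h : x = z
        · subst h; simp only [if_true]; linarith
        · simp only [if_neg h]; linarith
      · rw [hw, hb]
        simp only [hx, if_true]
        have h0 := H.z0
        have h1 := N_shift k hk1 (∑ z ∈ S, (c z - o z + i z) + -1) 1
        rw [abs_one, neg_add_cancel_right] at h1
        linarith
      · intro A hA hAn hAS hAX
        rcases Nat.lt_or_ge A.card 2 with h | h
        · have : A.card = 1 := by have := Finset.card_pos.mpr hAn; omega
          obtain ⟨u, rfl⟩ := Finset.card_eq_one.mp this
          have hu : u ∈ S := hA (by simp)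
          have hc := hcond u hu
          unfold sl
          rw [hw, hb]
          simp only [Finset.mem_singleton, Finset.sum_singleton]
          by_cases h3 : x = u
          · subst h3
            simp only [if_true]
            rw [← sub_eq_add_neg, hNx1 x hx]
            linarith
          · simp only [h3, if_false, neg_zero, add_zero, hNx u hu]
            linarith
        · have h2 := hbig A hA h hAS
          unfold sl at h2 ⊢
          rw [hw, hb]
          have h1 := N_shift k hk1 (∑ z ∈ A, (c z - o z + i z)) (-1)
          rw [abs_neg, abs_one] at h1
          split_ifs
          · linarith
          · simp only [neg_zero, add_zero]; linarith
    · rw [hw, if_pos hx]; linarith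
  · push Not at hi
    have hi0 : ∀ x ∈ S, i x = 0 := fun x hx => le_antisymm (hi x hx) (H.hi x)
    obtain ⟨x0, hx0⟩ := H.ne
    obtain ⟨x, hx1, y, hyS, hy1, hxy⟩ := partition hk H (P := {x0}) (by simpa using hx0)
      (by simp) (by intro h; rw [← h] at hS; simp at hS)
    have hxS : x ∈ S := by
      rw [Finset.mem_singleton] at hx1; rwa [hx1]
    have hne : x ≠ y := by rintro rfl; exact hy1 hx1
    clear hx1 hy1 hx0 x0
    set W := ∑ z ∈ S, (o z + i z) with hW
    have hWb : (2 * k : ℤ) ∣ ∑ z ∈ S, (c z - o z + i z) + W := by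
      have : ∑ z ∈ S, (c z - o z + i z) + W = ∑ z ∈ S, c z := by
        rw [hW, ← Finset.sum_add_distrib]
        apply Finset.sum_congr rfl
        intro z hz
        rw [hi0 z hz]; ring
      rw [this]; exact H.sum
    set B := ∑ z ∈ S, (c z - o z + i z) with hB
    have hNB : ∀ t : ℤ, N k (B + t) = N k (W - t) := by
      intro t
      rw [← N_neg k hk1 (W - t)]
      apply N_congr k hk1
      have : B + t - -(W - t) = B + W := by ring
      rw [this]; exact hWb
    have hz0 := H.z0
    rw [← hW, ← hB] at hz0
    have hW2 : W ≤ 2 * k - 1 := by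
      by_contra hcon
      have h1 := hNB 0
      rw [add_zero, sub_zero] at h1
      have h2 := N_le k hk1 W 1
      rw [abs_of_nonneg (by linarith)] at h2
      linarith
    have hyx : s(y, x) ∈ L := Sym2.eq_swap ▸ hxy
    rcases hW2.lt_or_eq with hW3 | hW3
    · obtain ⟨L0, hLL⟩ := Multiset.exists_cons_of_mem hxy
      have hw : ∀ A : Finset V, ∑ z ∈ A, (o z + (if y = z then 1 else 0) + i z)
          = ∑ z ∈ A, (o z + i z) + (if y ∈ A then 1 else 0) := by
        intro A
        simp only [Finset.sum_add_distrib, sum_ind]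
        ring
      have hb : ∀ A : Finset V, ∑ z ∈ A,
          ((c z - (if x = z then 1 else 0) + (if y = z then 1 else 0))
            - (o z + (if y = z then 1 else 0)) + i z)
          = ∑ z ∈ A, (c z - o z + i z) + - (if x ∈ A then 1 else 0) := by
        intro A
        simp only [Finset.sum_add_distrib, Finset.sum_sub_distrib, sum_ind]
        ring
      refine dstep H ih hbig hLL _ (fun z => o z + (if y = z then 1 else 0)) i rfl ?_ H.hi ?_
        (by simp) ?_ ?_
      · intro z
        have := H.ho z
        show 0 ≤ o z + (if y = z then 1 else 0)
        split_ifs <;> linarith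
      · rw [hw, hb, ← hW, ← hB, if_pos hxS, if_pos hyS, hNB]
        have h0 := N_nonneg k (W - -1)
        rcases (show W ≤ 2 * k - 2 by omega).lt_or_eq with h | h
        · omega
        · have : N k (W - -1) = 1 := by
            rw [N_congr k hk1 (b := -1) ⟨1, by rw [h]; ring⟩, N_self k hk1] <;> simp
            linarith
          linarith
      · intro A _ _ _
        unfold sl
        rw [hb, hw, hLL, cut_cons, cross_mk]
        have h2 := N_shift k hk1 (∑ z ∈ A, (c z - o z + i z)) (-1)
        rw [abs_neg, abs_one] at h2
        by_cases h3 : x ∈ A <;> by_cases h4 : y ∈ A <;> simp [h3, h4] <;> linarith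
      · intro u hu _ _
        have hc := hcond u hu
        unfold sl
        rw [hb, hw]
        rw [hLL, cut_cons, cross_mk] at hc
        simp only [Finset.mem_singleton, Finset.sum_singleton] at hc ⊢
        by_cases h3 : x = u
        · subst h3
          simp only [Ne.symm hne, if_true, if_false, iff_false, not_true] at hc ⊢
          rw [← sub_eq_add_neg, hNx1 x hxS]
          linarith
        · by_cases h4 : y = u
          · subst h4
            simp only [hne, if_true, if_false, false_iff, not_true] at hc ⊢
            rw [neg_zero, add_zero, hNx y hyS]
            linarith
          · simp only [h3, h4, if_true, if_false] at hc ⊢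
            simp only [neg_zero, add_zero, hNx u hu]
            linarith
    · obtain ⟨L0, hLL⟩ := Multiset.exists_cons_of_mem hyx
      obtain ⟨t, ht⟩ : ∃ t : ℤ, t = k - (c x - o x + i x) := ⟨_, rfl⟩
      have hpx := hpos x hxS
      have ht1 : 1 ≤ t := by omega
      have ht2 : t + 1 ≤ k := by omega
      have hst : ∀ A : Finset V, ∑ z ∈ A, (if x = z then t else 0) = if x ∈ A then t else 0 := by
        intro A; simp
      have hw : ∀ A : Finset V, ∑ z ∈ A, (o z + (i z + (if x = z then t else 0)))
          = ∑ z ∈ A, (o z + i z) + (if x ∈ A then t else 0) := by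
        intro A
        simp only [Finset.sum_add_distrib, hst]
        ring
      have hb : ∀ A : Finset V, ∑ z ∈ A,
          ((c z - (if y = z then 1 else 0) + (if x = z then 1 else 0))
            - o z + (i z + (if x = z then t else 0)))
          = ∑ z ∈ A, (c z - o z + i z) +
            (- (if y ∈ A then 1 else 0) + (if x ∈ A then 1 + t else 0)) := by
        intro A
        simp only [Finset.sum_add_distrib, Finset.sum_sub_distrib, sum_ind, hst]
        split_ifs <;> ring
      refine dstep H ih hbig hLL _ o (fun z => i z + (if x = z then t else 0)) rfl H.ho ?_ ?_
        (by simp) ?_ ?_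
      · intro z
        have := H.hi z
        show 0 ≤ i z + (if x = z then t else 0)
        split_ifs <;> linarith
      · rw [hw, hb, ← hW, ← hB, if_pos hxS, if_pos hyS, if_pos hxS, hNB]
        have : N k (W - (-1 + (1 + t))) = t + 1 := by
          rw [N_congr k hk1 (b := -(t + 1)), N_neg k hk1, N_self k hk1, abs_of_pos (by linarith)]
          · rw [abs_of_pos (by linarith)]; exact ht2
          · exact ⟨1, by rw [hW3]; ring⟩
        linarith
      · intro A _ _ _
        unfold sl
        rw [hb, hw, hLL, cut_cons, cross_mk]
        have h1 := N_shift k hk1 (∑ z ∈ A, (c z - o z + i z)) (-1)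
        have h2 := N_shift k hk1 (∑ z ∈ A, (c z - o z + i z)) t
        have h5 := N_shift k hk1 (∑ z ∈ A, (c z - o z + i z)) (1 + t)
        rw [abs_neg, abs_one] at h1
        rw [abs_of_pos (by linarith)] at h2 h5
        by_cases h3 : x ∈ A <;> by_cases h4 : y ∈ A <;> simp [h3, h4] <;> linarith
      · intro u hu _ _
        have hc := hcond u hu
        unfold sl
        rw [hb, hw]
        rw [hLL, cut_cons, cross_mk] at hc
        simp only [Finset.mem_singleton, Finset.sum_singleton] at hc ⊢
        by_cases h3 : x = u
        · subst h3
          simp only [Ne.symm hne, if_true, if_false, false_iff, not_true] at hc ⊢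
          have : N k (c x - o x + i x + (-0 + (1 + t))) = k - 1 := by
            rw [N_congr k hk1 (b := -(k - 1)), N_neg k hk1, N_self k hk1, abs_of_pos (by linarith)]
            · rw [abs_of_pos (by linarith)]; linarith
            · exact ⟨1, by rw [ht]; ring⟩
          rw [this]
          linarith
        · by_cases h4 : y = u
          · subst h4
            simp only [hne, if_true, if_false, iff_false, not_true] at hc ⊢
            rw [add_zero (-1 : ℤ), ← sub_eq_add_neg, hNx1 y hyS]
            linarith
          · simp only [h3, h4, if_true, if_false] at hc ⊢
            simp only [neg_zero, add_zero, hNx u hu]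
            linarith

theorem step {k : ℕ} (hk : 2 ≤ k) {S : Finset V} {L : Multiset (Sym2 V)} {c o i : V → ℤ}
    {X : Finset V} (H : Inst k S L c o i X) (ih : IH k S L o i) : Ori k S L c := by
  have hk1 : 1 ≤ k := by omega
  have hkz : (2 : ℤ) ≤ k := by exact_mod_cast hk
  rcases Nat.lt_or_ge S.card 2 with hS | hS
  · have : S.card = 1 := by have := Finset.card_pos.mpr H.ne; omega
    obtain ⟨v, rfl⟩ := Finset.card_eq_one.mp this
    have hL0 : L = 0 := by
      apply Multiset.eq_zero_of_forall_notMem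
      intro e he
      have h1 := H.hL e he
      induction e with
      | h a b => 
        simp only [Sym2.mem_iff, forall_eq_or_imp, forall_eq, Finset.mem_singleton,
          Sym2.mk_isDiag_iff] at h1
        exact h1.1 (h1.2.1.trans h1.2.2.symm)
    refine ⟨0, by simp [hL0], ?_⟩
    intro x hx
    rw [Finset.mem_singleton] at hx
    subst hx
    have := H.sum
    rw [Finset.sum_singleton] at this
    simpa using this
  by_cases hbig : ∀ A ⊆ S, 2 ≤ A.card → A ≠ S → 2 ≤ sl k L c o i A
  swap
  · push Not at hbig
    obtain ⟨A, hA, hA2, hAS, hsl⟩ := hbig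
    refine tight H ih hA hA2 hAS ?_
    have := sl_even H hA
    omega
  by_cases hX : X = ∅
  swap
  · have : X.card = 1 := by
      have := H.Xc
      have := Finset.card_pos.mpr (Finset.nonempty_iff_ne_empty.mpr hX)
      omega
    obtain ⟨v, rfl⟩ := Finset.card_eq_one.mp this
    exact liftVertex hk H ih hbig hS (H.XS (by simp)) (Or.inl rfl)
  subst hX
  by_cases h0 : ∃ v ∈ S, N k (c v - o v + i v) = 0
  · obtain ⟨v, hv, hN⟩ := h0
    have H' : Inst k S L c o i {v} := ⟨H.ne, H.hL, H.ho, H.hi, H.par, H.sum, H.z0,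
      by simpa using hv, by simp, by simpa using hN, fun A h1 h2 h3 _ =>
        H.cond A h1 h2 h3 h2.ne_empty⟩
    exact liftVertex hk H' ih hbig hS hv (Or.inl rfl)
  push Not at h0
  -- normalise
  set c' : V → ℤ := fun x => c x + (Int.bmod (c x - o x + i x) (2 * k) - (c x - o x + i x))
    with hc'
  have hcc : ∀ x, (2 * k : ℤ) ∣ c' x - c x := by
    intro x
    have := Int.bmod_add_bdiv (c x - o x + i x) (2 * k)
    push_cast at this
    refine ⟨-(Int.bdiv (c x - o x + i x) (2 * k)), ?_⟩
    rw [hc']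
    linear_combination this
  have hbn : ∀ x, c' x - o x + i x = Int.bmod (c x - o x + i x) (2 * k) := by
    intro x; rw [hc']; ring
  have H' := inst_congr hk1 H hcc
  refine ori_congr hcc ?_
  have hbig' : ∀ A ⊆ S, 2 ≤ A.card → A ≠ S → 2 ≤ sl k L c' o i A := by
    intro A h1 h2 h3
    rw [sl_congr hk1 L o i A hcc]; exact hbig A h1 h2 h3
  have hr : ∀ x ∈ S, c' x - o x + i x ≠ 0 ∧ -(k : ℤ) ≤ c' x - o x + i x ∧
      c' x - o x + i x < k := by
    intro x hx
    rw [hbn]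
    have h1 := @Int.bmod_lt (c x - o x + i x) (2 * k) (by omega)
    have h2 := @Int.le_bmod (c x - o x + i x) (2 * k) (by omega)
    push_cast at h1 h2
    refine ⟨?_, by omega, by omega⟩
    intro h
    apply h0 x hx
    unfold N
    rw [h]; simp
  have hNpos : ∀ x ∈ S, 0 < c' x - o x + i x → 
      N k (c' x - o x + i x - 1) = N k (c' x - o x + i x) - 1 := by
    intro x hx h
    have := hr x hx
    rw [N_self k hk1, N_self k hk1] <;> rw [abs_of_nonneg (by omega)]
    · rw [abs_of_nonneg (by omega)]
    · omega
    · omega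
  have hNneg : ∀ x ∈ S, c' x - o x + i x < 0 → 
      N k (c' x - o x + i x + 1) = N k (c' x - o x + i x) - 1 := by
    intro x hx h
    have := hr x hx
    rw [N_self k hk1, N_self k hk1] <;> rw [abs_of_nonpos (by omega)]
    · rw [abs_of_nonpos (by omega)]; ring
    · omega
    · omega
  have hNmin : ∀ x ∈ S, c' x - o x + i x = -k → 
      N k (c' x - o x + i x - 1) = N k (c' x - o x + i x) - 1 := by
    intro x hx h
    rw [h, N_congr k hk1 (a := -(k : ℤ) - 1) (b := k - 1), N_self k hk1, N_self k hk1]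
    · rw [abs_neg, abs_of_nonneg (by omega), abs_of_nonneg (by omega)]
    · rw [abs_neg, abs_of_nonneg (by omega)]
    · rw [abs_of_nonneg (by omega)]; omega
    · exact ⟨-1, by ring⟩
  by_cases hmin : ∃ x ∈ S, c' x - o x + i x = -k
  · obtain ⟨x0, hx0, hxk⟩ := hmin
    obtain ⟨x, hx1, y, hyS, hy1, hxy⟩ := partition hk H' (P := {x0}) (by simpa using hx0)
      (by simp) (by intro h; rw [← h] at hS; simp at hS)
    rw [Finset.mem_singleton] at hx1
    subst hx1
    rcases lt_or_gt_of_ne (hr y hyS).1 with h | h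
    · exact c2step hk H' ih hbig' hxy (hNmin x hx0 hxk) (hNneg y hyS h)
    · exact c2step hk H' ih hbig' (Sym2.eq_swap ▸ hxy) (hNpos y hyS h)
        (hNneg x hx0 (by omega))
  push Not at hmin
  by_cases hP : (S.filter fun x => 0 < c' x - o x + i x) = ∅
  · have hneg : ∀ x ∈ S, c' x - o x + i x < 0 := by
      intro x hx
      have h1 := Finset.filter_eq_empty_iff.mp hP hx
      have h2 := (hr x hx).1
      omega
    apply ori_neg
    refine final_pos hk (inst_neg hk1 H') (ih_neg ih) hS ?_ ?_
    · intro A h1 h2 h3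
      rw [sl_neg hk1]; exact hbig' A h1 h2 h3
    · intro x hx
      have h1 := hneg x hx
      have h2 := hr x hx
      have h3 := hmin x hx
      constructor <;> omega
  · by_cases hPS : (S.filter fun x => 0 < c' x - o x + i x) = S
    · refine final_pos hk H' ih hS hbig' ?_
      intro x hx
      exact ⟨Finset.filter_eq_self.mp hPS x hx, (hr x hx).2.2⟩
    · obtain ⟨x, hx1, y, hyS, hy1, hxy⟩ := partition hk H' (Finset.filter_subset _ _)
        (Finset.nonempty_iff_ne_empty.mpr hP) hPS
      rw [Finset.mem_filter] at hx1 hy1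
      refine c2step hk H' ih hbig' hxy (hNpos x hx1.1 hx1.2) (hNneg y hyS ?_)
      have h1 := (hr y hyS).1
      have h2 : ¬ 0 < c' y - o y + i y := fun h => hy1 ⟨hyS, h⟩
      omega

theorem main {k : ℕ} (hk : 2 ≤ k) : ∀ (a b d : ℕ) (S : Finset V) (L : Multiset (Sym2 V))
    (c o i : V → ℤ) (X : Finset V), S.card = a → L.card = b →
    (∑ x ∈ S, (o x + i x)).toNat = d → Inst k S L c o i X → Ori k S L c := by
  intro a
  induction a using Nat.strong_induction_on with
  | _ a iha =>
    intro b
    induction b using Nat.strong_induction_on with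
    | _ b ihb =>
      intro d
      induction d using Nat.strong_induction_on with
      | _ d ihd =>
        intro S L c o i X ha hb hd H
        refine step hk H ?_
        intro S' L' c' o' i' X' H' hlt
        rcases hlt with h | ⟨h1, h | ⟨h2, h⟩⟩
        · exact iha _ (by omega) _ _ S' L' c' o' i' X' rfl rfl rfl H'
        · exact ihb _ (by omega) _ S' L' c' o' i' X' (by omega) rfl rfl H'
        · have : 0 ≤ ∑ x ∈ S', (o' x + i' x) :=
            Finset.sum_nonneg fun x _ => add_nonneg (H'.ho x) (H'.hi x)
          exact ihd _ (by omega) S' L' c' o' i' X' (by omega) (by omega) rfl H'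

theorem cross_single {a b : V} (h : a ≠ b) (x : V) :
    cross {x} s(a, b) = (if a = x then 1 else 0) + (if b = x then 1 else 0) := by
  rw [cross_mk]
  by_cases h1 : a = x
  · subst h1; simp [Ne.symm h]
  · by_cases h2 : b = x <;> simp [h1, h2]

theorem sum_cut (L : Multiset (Sym2 V)) (hL : ∀ e ∈ L, ¬ e.IsDiag) (A : Finset V) :
    (2 : ℤ) ∣ ∑ x ∈ A, cut L {x} - cut L A := by
  induction L using Multiset.induction_on with
  | empty => simp
  | cons e L ih =>
    have ih' := ih (fun e he => hL e (Multiset.mem_cons_of_mem he))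
    have h1 := hL e (Multiset.mem_cons_self _ _)
    induction e with
    | h a b =>
      rw [Sym2.mk_isDiag_iff] at h1
      simp only [cut_cons, cross_single h1, Finset.sum_add_distrib, Finset.sum_ite_eq]
      rw [cross_mk]
      by_cases h2 : a ∈ A <;> by_cases h3 : b ∈ A <;> simp [h2, h3] <;> omega

theorem sum_cut_univ [Fintype V] (L : Multiset (Sym2 V)) (hL : ∀ e ∈ L, ¬ e.IsDiag) :
    ∑ x : V, cut L {x} = 2 * L.card := by
  induction L using Multiset.induction_on with
  | empty => simp
  | cons e L ih =>
    have ih' := ih (fun e he => hL e (Multiset.mem_cons_of_mem he))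
    have h1 := hL e (Multiset.mem_cons_self _ _)
    induction e with
    | h a b =>
      rw [Sym2.mk_isDiag_iff] at h1
      simp only [cut_cons, cross_single h1, Finset.sum_add_distrib, Finset.sum_ite_eq, ih',
        Finset.mem_univ, if_true, Multiset.card_cons]
      push_cast; ring

theorem cut_ge {V : Type} [DecidableEq V] [Fintype V] (G : SimpleGraph V) [Fintype G.edgeSet]
    (m : ℕ)
    (hG : ∀ S : Finset (Sym2 V), S.card < m → (G.deleteEdges ↑S).Connected) (A : Finset V)
    (hA : A.Nonempty) (hA2 : A ≠ Finset.univ) : (m : ℤ) ≤ cut G.edgeFinset.val A := by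
  set F := G.edgeFinset.filter (fun e => cross A e ≠ 0) with hF
  have hcut : cut G.edgeFinset.val A = F.card := by
    have h1 : cut G.edgeFinset.val A = ∑ e ∈ G.edgeFinset, cross A e := rfl
    rw [h1, hF, Finset.card_filter]
    push_cast
    apply Finset.sum_congr rfl
    intro e _
    induction e with
    | h a b =>
      rw [cross_mk]
      by_cases h2 : a ∈ A <;> by_cases h3 : b ∈ A <;> simp [h2, h3]
  rw [hcut]
  by_contra hcon
  have hc := hG F (by omega)
  have hadj : ∀ u v, (G.deleteEdges ↑F).Adj u v → (u ∈ A ↔ v ∈ A) := by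
    intro u v huv
    rw [SimpleGraph.deleteEdges_adj] at huv
    by_contra h
    apply huv.2
    rw [hF, Finset.mem_coe, Finset.mem_filter, SimpleGraph.mem_edgeFinset]
    refine ⟨huv.1, ?_⟩
    rw [cross_mk, if_neg h]; simp
  have hwalk : ∀ u v, (G.deleteEdges ↑F).Walk u v → (u ∈ A ↔ v ∈ A) := by
    intro u v w
    induction w with
    | nil => rfl
    | cons h _ ih => exact (hadj _ _ h).trans ih
  obtain ⟨x, hx⟩ := hA
  obtain ⟨y, hy⟩ : ∃ y, y ∉ A := by
    by_contra h
    push Not at h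
    exact hA2 (Finset.eq_univ_iff_forall.mpr h)
  obtain ⟨w⟩ := hc.preconnected x y
  exact hy ((hwalk x y w).mp hx)

theorem app {V : Type} [Fintype V] (k : ℕ) (hk3 : 3 ≤ k) (hkodd : Odd k)
    (G : SimpleGraph V)
    (hG : ∀ S : Finset (Sym2 V), S.card < 3 * k - 3 → (G.deleteEdges ↑S).Connected)
    (p : V → ℕ)
    (hsum : (∑ v, p v) ≡ G.edgeSet.ncard [MOD k]) :
    ∃ D : V → V → Prop,
      (∀ u v, G.Adj u v ↔ (D u v ∨ D v u)) ∧
      (∀ u v, ¬ (D u v ∧ D v u)) ∧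
      (∀ v, {u | D v u}.ncard ≡ p v [MOD k]) := by
  classical
  have hk1 : 1 ≤ k := by omega
  have hloop : ∀ e ∈ G.edgeFinset.val, ¬ e.IsDiag := by
    intro e he
    exact G.not_isDiag_of_mem_edgeSet (SimpleGraph.mem_edgeFinset.mp he)
  have hnon : Nonempty V := (hG ∅ (by simp; omega)).nonempty
  have hcardE : (G.edgeSet.ncard : ℤ) = G.edgeFinset.val.card := by
    rw [← SimpleGraph.coe_edgeFinset, Set.ncard_coe_finset]; rfl
  have hI : Inst k Finset.univ G.edgeFinset.val (fun x => 2 * p x - cut G.edgeFinset.val {x})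
      (fun _ => 0) (fun _ => 0) ∅ := by
    have hpar : ∀ A : Finset V, (2 : ℤ) ∣
        ∑ x ∈ A, (2 * (p x : ℤ) - cut G.edgeFinset.val {x}) - cut G.edgeFinset.val A := by
      intro A
      have h1 := sum_cut _ hloop A
      rw [Finset.sum_sub_distrib, ← Finset.mul_sum]
      omega
    refine ⟨Finset.univ_nonempty, fun e he => ⟨hloop e he, by simp⟩, by simp, by simp,
      fun A _ => hpar A, ?_, ?_, by simp, by simp, by simp, ?_⟩
    · rw [Finset.sum_sub_distrib, ← Finset.mul_sum, sum_cut_univ _ hloop, ← hcardE, ← mul_sub]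
      apply mul_dvd_mul_left
      have := (Nat.modEq_iff_dvd.mp hsum.symm)
      push_cast at this
      exact this
    · have := N_nonneg k (∑ x : V, ((2 * (p x : ℤ) - cut G.edgeFinset.val {x}) - 0 + 0))
      simp only [add_zero, Finset.sum_const_zero] at this ⊢
      have : (3 : ℤ) ≤ k := by exact_mod_cast hk3
      linarith
    · intro A _ hA hAu _
      have h1 := cut_ge G _ hG A hA hAu
      have h2 := hpar A
      unfold sl
      simp only [add_zero, sub_zero, Finset.sum_const_zero]
      have h3 := N_par k (∑ x ∈ A, (2 * (p x : ℤ) - cut G.edgeFinset.val {x}))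
      have h4 := N_le_k k hk1 (∑ x ∈ A, (2 * (p x : ℤ) - cut G.edgeFinset.val {x}))
      obtain ⟨r, hr⟩ := hkodd
      generalize N k (∑ x ∈ A, (2 * (p x : ℤ) - cut G.edgeFinset.val {x})) = n at *
      generalize ∑ x ∈ A, (2 * (p x : ℤ) - cut G.edgeFinset.val {x}) = q at *
      generalize cut G.edgeFinset.val A = m at *
      omega
  obtain ⟨D, hD, hnet⟩ := main (by omega : 2 ≤ k) _ _ _ _ _ _ _ _ _ rfl rfl rfl hI
  have hnd : (und D).Nodup := by rw [hD]; exact G.edgeFinset.nodup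
  have hDnd : D.Nodup := Multiset.Nodup.of_map _ hnd
  have hmem : ∀ u v, (u, v) ∈ D → G.Adj u v := by
    intro u v h
    have h1 : s(u, v) ∈ und D := mem_und h
    rw [hD] at h1
    exact SimpleGraph.mem_edgeFinset.mp h1
  refine ⟨fun u v => (u, v) ∈ D, ?_, ?_, ?_⟩
  · intro u v
    constructor
    · intro h
      have h1 : s(u, v) ∈ und D := by rw [hD]; exact SimpleGraph.mem_edgeFinset.mpr h
      obtain ⟨⟨a, b⟩, hab, he⟩ := Multiset.mem_map.mp h1
      rw [Sym2.eq_iff] at he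
      rcases he with ⟨h1, h2⟩ | ⟨h1, h2⟩ <;> simp only at h1 h2 <;> subst h1 h2
      · exact Or.inl hab
      · exact Or.inr hab
    · rintro (h | h)
      · exact hmem _ _ h
      · exact (hmem _ _ h).symm
  · rintro u v ⟨h1, h2⟩
    have := Multiset.inj_on_of_nodup_map hnd _ h1 _ h2 Sym2.eq_swap
    rw [Prod.mk.injEq] at this
    exact (hmem _ _ h1).ne this.1
  · intro v
    set F : Finset (V × V) := ⟨D, hDnd⟩ with hF
    have h1 : {u | (v, u) ∈ D} = ((F.filter (fun e => e.1 = v)).image Prod.snd : Finset V) := by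
      ext u
      simp only [Set.mem_setOf_eq, Finset.coe_image, Set.mem_image, Finset.mem_coe,
        Finset.mem_filter]
      constructor
      · intro h; exact ⟨(v, u), ⟨h, rfl⟩, rfl⟩
      · rintro ⟨⟨a, b⟩, ⟨h, h'⟩, h''⟩
        simp only at h' h''
        subst h' h''
        exact h
    have h2 : ({u | (v, u) ∈ D}.ncard : ℤ) = outd D v := by
      rw [h1, Set.ncard_coe_finset, Finset.card_image_of_injOn, Finset.card_filter]
      · push_cast; rfl
      · rintro ⟨a, b⟩ ha ⟨a', b'⟩ ha' h
        simp only [Finset.coe_filter, Set.mem_setOf_eq] at ha ha' h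
        rw [ha.2, ha'.2, h]
    have h3 : cut (und D) {v} = outd D v + ind D v := by
      rw [cut_und D {v} {v} (Finset.Subset.refl _), Finset.sum_singleton]
      rintro e he ⟨ha, hb⟩
      rw [Finset.mem_singleton] at ha hb
      exact (hmem e.1 e.2 he).ne (ha.trans hb.symm)
    have h4 := hnet v (Finset.mem_univ _)
    rw [← hD] at h4
    simp only [h3, ← h2] at h4
    apply Nat.ModEq.symm
    rw [Nat.modEq_iff_dvd]
    obtain ⟨q, hq⟩ := h4
    exact ⟨q, by linarith⟩

end LTWZ

/-- Lovász–Thomassen–Wu–Zhang: let `k ≥ 3` be odd and `G` a `(3k-3)`-edge-connected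
finite graph.  If `p : V → {0, …, k-1}` satisfies `∑ v, p v ≡ |E(G)| (mod k)`, then
`G` has an orientation `D` in which every vertex `v` has outdegree `≡ p v (mod k)`. -/
theorem orientation_with_prescribed_outdegrees_mod_k
    {V : Type} [Fintype V] (k : ℕ) (hk3 : 3 ≤ k) (hkodd : Odd k)
    (G : SimpleGraph V) (hG : IsKEdgeConnected G (3 * k - 3))
    (p : V → ℕ) (hp : ∀ v, p v < k)
    (hsum : (∑ v, p v) ≡ G.edgeSet.ncard [MOD k]) :
    ∃ D : V → V → Prop,
      (∀ u v, G.Adj u v ↔ (D u v ∨ D v u)) ∧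
      (∀ u v, ¬ (D u v ∧ D v u)) ∧
      (∀ v, {u | D v u}.ncard ≡ p v [MOD k]) := by
  exact LTWZ.app k hk3 hkodd G hG p hsum
end
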